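/- arXiv:1107.2493 — 3 statements merged into one kernel-verified Lean document; each statement's English description precedes it below -/
import Mathlib

section
/- Let θ be a quadratic irrational: θ is a root of aX² + bX + c with a, b, c integers, a > 0, gcd(a,b,c) = 1, and discriminant D_θ = b² − 4ac > 0 not a perfect square. Let R_{ℤ,φ} be a uniquely ergodic Cantor minimal ℤ-system (arising from a free action of ℤ on a Cantor set X) whose unique invariant probability measure μ satisfies E_μ = ℤ + ℤθ, where E_μ is the additive subgroup of ℝ generated by {μ(V) : V clopen in X}. Then F(R_{ℤ,φ}) = {ε₀^n : n ∈ ℤ}, where ε₀ = (t + u√{D_θ})/2 is the smallest number exceeding 1 of this form with t, u positive integers satisfying one of the Pell equations t² − D_θ u² = ±4. -/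
open MeasureTheory
open scoped ENNReal

/-- The group of self-homeomorphisms of a space, under composition. -/
instance homeomorphGroup {X : Type*} [TopologicalSpace X] : Group (X ≃ₜ X) where
  mul f g := g.trans f
  one := Homeomorph.refl X
  inv := Homeomorph.symm
  mul_assoc f g h := rfl
  one_mul f := Homeomorph.ext fun x => rfl
  mul_one f := Homeomorph.ext fun x => rfl
  inv_mul_cancel f := Homeomorph.ext fun x => f.symm_apply_apply x

section Defs

variable {X Y : Type*} [TopologicalSpace X] [TopologicalSpace Y]

/-- The orbit equivalence relation `R_{G,φ}` of an action of `G` on `X` by homeomorphisms. -/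
def orbitRelOf {G : Type*} [Group G] (φ : G →* (X ≃ₜ X)) : Set (X × X) :=
  {p | ∃ g : G, φ g p.1 = p.2}

/-- Freeness of an action by homeomorphisms. -/
def IsFreeAction {G : Type*} [Group G] (φ : G →* (X ≃ₜ X)) : Prop :=
  ∀ g : G, g ≠ 1 → ∀ x : X, φ g x ≠ x

/-- The orbit relation of a single homeomorphism, i.e. of the generated `ℤ`-action. -/
def orbitRelZ (φ : X ≃ₜ X) : Set (X × X) :=
  {p | ∃ n : ℤ, (φ ^ n) p.1 = p.2}

/-- Freeness of the `ℤ`-action generated by a homeomorphism. -/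
def IsFreeZ (φ : X ≃ₜ X) : Prop :=
  ∀ n : ℤ, n ≠ 0 → ∀ x : X, (φ ^ n) x ≠ x

/-- Minimality of an orbit equivalence relation: every class `R[x]` is dense. -/
def IsMinimalRel (R : Set (X × X)) : Prop :=
  ∀ x : X, Dense {y : X | (x, y) ∈ R}

/-- A Borel measure is `R`-invariant if it is invariant under every homeomorphism `h`
with `(x, h x) ∈ R` for all `x`. -/
def IsInvariantMeasure [MeasurableSpace X] (R : Set (X × X)) (μ : Measure X) : Prop :=
  ∀ h : X ≃ₜ X, (∀ x : X, (x, h x) ∈ R) → Measure.map h μ = μ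

/-- Restriction `R|_U = R ∩ (U × U)` of a relation, as a relation on the subtype `U`. -/
def restrictRel (R : Set (X × X)) (U : Set X) : Set (↥U × ↥U) :=
  {p | ((p.1 : X), (p.2 : X)) ∈ R}

/-- `R^n` on `X × {1,…,n}`: `((x,i),(y,j)) ∈ R^n ↔ (x,y) ∈ R`. -/
def finProdRel (R : Set (X × X)) (n : ℕ) : Set ((X × Fin n) × (X × Fin n)) :=
  {p | (p.1.1, p.2.1) ∈ R}

/-- `R^∞` on `X × ℕ`: `((x,i),(y,j)) ∈ R^∞ ↔ (x,y) ∈ R`. -/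
def natProdRel (R : Set (X × X)) : Set ((X × ℕ) × (X × ℕ)) :=
  {p | (p.1.1, p.2.1) ∈ R}

/-- Topological orbit equivalence of two equivalence relations: a homeomorphism `F` of the
underlying spaces with `(F × F)(R₁) = R₂`. -/
def OrbitEquiv (R₁ : Set (X × X)) (R₂ : Set (Y × Y)) : Prop :=
  ∃ F : X ≃ₜ Y, ∀ x y : X, (x, y) ∈ R₁ ↔ (F x, F y) ∈ R₂

/-- The fundamental group `F(R)` of a uniquely ergodic Cantor minimal system, where `μ` is
the unique invariant probability measure: the set of values `(μ × δ)(U)` (with `δ` counting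
measure) over clopen sets `U ⊆ X × {1,…,n}`, `n ∈ ℕ`, such that `R^n|_U` is orbit
equivalent to `R`. -/
noncomputable def fundGroup [MeasurableSpace X] (R : Set (X × X)) (μ : Measure X) : Set ℝ :=
  {l : ℝ | ∃ (n : ℕ) (U : Set (X × Fin n)), IsClopen U ∧
    OrbitEquiv R (restrictRel (finProdRel R n) U) ∧
    l = ((μ.prod Measure.count) U).toReal}

/-- `E_μ`: the additive subgroup of `ℝ` generated by the measures of clopen sets. -/
noncomputable def clopenValueGroup [MeasurableSpace X] (μ : Measure X) : AddSubgroup ℝ :=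
  AddSubgroup.closure {r : ℝ | ∃ V : Set X, IsClopen V ∧ r = (μ V).toReal}

/-- The positive inner multiplier group `IM₊(E)` of an additive subgroup of `ℝ`. -/
def IMplus (E : AddSubgroup ℝ) : Set ℝ :=
  {t : ℝ | 0 < t ∧ t ∈ E ∧ t⁻¹ ∈ E ∧ (fun x => t * x) '' (E : Set ℝ) = (E : Set ℝ)}

end Defs

/-- A minimal free `ℤ`-action together with an enumeration of the clopen sets and a base point,
from which Kakutani–Rokhlin towers over shrinking neighbourhoods of the base point are built. -/
structure TowerFrame (X : Type*) [TopologicalSpace X] where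
  φ : X ≃ₜ X
  s : ℕ → Set X
  x₀ : X
  isClopen_s : ∀ n, IsClopen (s n)
  exists_s : ∀ U : Set X, IsClopen U → ∃ n, s n = U
  minimal : IsMinimalRel (orbitRelZ φ)
  free : IsFreeZ φ

namespace TowerFrame

variable {X : Type*} [TopologicalSpace X] (F : TowerFrame X)

/-- The action of an integer on a point. -/
def T (n : ℤ) (x : X) : X := (F.φ ^ n) x

@[simp] lemma T_T (m n : ℤ) (x : X) : F.T m (F.T n x) = F.T (m + n) x := by
  simp only [T, zpow_add]; rfl

@[simp] lemma T_zero (x : X) : F.T 0 x = x := rfl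

lemma T_one (x : X) : F.T 1 x = F.φ x := by simp only [T, zpow_one]

lemma continuous_T (n : ℤ) : Continuous (F.T n) := (F.φ ^ n).continuous

lemma T_ne {n : ℤ} (hn : n ≠ 0) (x : X) : F.T n x ≠ x := F.free n hn x

lemma mem_orbitRel {x y : X} : (x, y) ∈ orbitRelZ F.φ ↔ ∃ n, F.T n x = y := Iff.rfl

/-- Two points lie in the same elements among the first `k` clopen sets. -/
def Agree (k : ℕ) (x y : X) : Prop := ∀ n < k, x ∈ F.s n ↔ y ∈ F.s n

/-- The `k`-th clopen neighbourhood of the base point. -/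
def D (k : ℕ) : Set X := {x | F.Agree k x F.x₀}

variable {F}

lemma Agree.refl (k : ℕ) (x : X) : F.Agree k x x := fun _ _ => Iff.rfl
lemma Agree.symm {k : ℕ} {x y : X} (h : F.Agree k x y) : F.Agree k y x :=
  fun n hn => (h n hn).symm
lemma Agree.trans {k : ℕ} {x y z : X} (h : F.Agree k x y) (h' : F.Agree k y z) : F.Agree k x z :=
  fun n hn => (h n hn).trans (h' n hn)
lemma Agree.mono {k l : ℕ} (hkl : k ≤ l) {x y : X} (h : F.Agree l x y) : F.Agree k x y :=
  fun n hn => h n (hn.trans_le hkl)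

lemma Agree.mem_D_iff {k : ℕ} {x y : X} (h : F.Agree k x y) : x ∈ F.D k ↔ y ∈ F.D k :=
  ⟨fun hx => h.symm.trans hx, fun hy => h.trans hy⟩

variable (F)

lemma D_anti {k l : ℕ} (hkl : k ≤ l) : F.D l ⊆ F.D k := fun _ h => Agree.mono hkl h

@[simp] lemma x₀_mem_D (k : ℕ) : F.x₀ ∈ F.D k := Agree.refl _ _

lemma mem_D_zero (x : X) : x ∈ F.D 0 := fun _ h => absurd h (Nat.not_lt_zero _)

lemma isClopen_agree (k : ℕ) (x : X) : IsClopen {y | F.Agree k y x} := by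
  have : {y | F.Agree k y x} = ⋂ n ∈ Finset.range k, {y | y ∈ F.s n ↔ x ∈ F.s n} := by
    ext y; simp [Agree]
  rw [this]
  refine isClopen_biInter_finset fun n _ => ?_
  by_cases h : x ∈ F.s n
  · simpa [h] using F.isClopen_s n
  · simp only [h, iff_false]
    exact (F.isClopen_s n).compl

lemma isClopen_D (k : ℕ) : IsClopen (F.D k) := F.isClopen_agree k F.x₀

lemma exists_agree_mem {U : Set X} (hU : IsClopen U) :
    ∃ K, ∀ k ≥ K, ∀ x y, F.Agree k x y → (x ∈ U ↔ y ∈ U) := by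
  obtain ⟨n, rfl⟩ := F.exists_s U hU
  exact ⟨n + 1, fun k hk x y h => h n (by omega)⟩

lemma exists_D_subset {U : Set X} (hU : IsClopen U) (h0 : F.x₀ ∈ U) :
    ∃ K, ∀ k ≥ K, F.D k ⊆ U := by
  obtain ⟨K, hK⟩ := F.exists_agree_mem hU
  exact ⟨K, fun k hk x hx => (hK k hk x _ hx).2 h0⟩

section Separation
variable [CompactSpace X] [T2Space X] [TotallyDisconnectedSpace X]

lemma exists_clopen_separating {x y : X} (h : x ≠ y) : ∃ U : Set X, IsClopen U ∧ x ∈ U ∧ y ∉ U := by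
  obtain ⟨U, hU, hx, hy⟩ := exists_isClopen_of_totally_separated h
  exact ⟨U, hU, hx, hy⟩

lemma eq_of_agree {x y : X} (h : ∀ K, ∃ k ≥ K, F.Agree k x y) : x = y := by
  by_contra hne
  obtain ⟨U, hU, hx, hy⟩ := exists_clopen_separating hne
  obtain ⟨K, hK⟩ := F.exists_agree_mem hU
  obtain ⟨k, hk, hxy⟩ := h K
  exact hy ((hK k hk x y hxy).1 hx)

lemma exists_notMem_D {x : X} (h : x ≠ F.x₀) : ∃ K, ∀ k ≥ K, x ∉ F.D k := by
  obtain ⟨U, hU, hx, hy⟩ := exists_clopen_separating h.symm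
  obtain ⟨K, hK⟩ := F.exists_D_subset hU hx
  exact ⟨K, fun k hk hxk => hy (hK k hk hxk)⟩

end Separation

section Recurrence
variable [CompactSpace X]

lemma exists_bound {U : Set X} (hU : IsOpen U) (hne : U.Nonempty) :
    ∃ N : ℕ, ∀ x, ∃ n : ℤ, |n| ≤ N ∧ F.T n x ∈ U := by
  have hcov : (Set.univ : Set X) ⊆ ⋃ n : ℤ, F.T n ⁻¹' U := by
    intro x _
    obtain ⟨y, hyU, n, hn⟩ := (F.minimal x).inter_open_nonempty U hU hne
    exact Set.mem_iUnion.2 ⟨n, by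
      have : F.T n x = y := hn
      simpa [this] using hyU⟩
  obtain ⟨t, ht⟩ := isCompact_univ.elim_finite_subcover _
    (fun n => hU.preimage (F.continuous_T n)) hcov
  refine ⟨t.sup Int.natAbs, fun x => ?_⟩
  obtain ⟨n, hn⟩ := Set.mem_iUnion.1 (ht (Set.mem_univ x))
  obtain ⟨hnt, hx⟩ := Set.mem_iUnion.1 hn
  refine ⟨n, ?_, hx⟩
  rw [Int.abs_eq_natAbs]
  exact_mod_cast Finset.le_sup (f := Int.natAbs) hnt

lemma exists_pos_mem {U : Set X} (hU : IsOpen U) (hne : U.Nonempty) (x : X) :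
    ∃ n : ℕ, 0 < n ∧ F.T n x ∈ U := by
  obtain ⟨N, hN⟩ := F.exists_bound hU hne
  obtain ⟨n, hn, hx⟩ := hN (F.T (N + 1) x)
  rw [abs_le] at hn
  refine ⟨(n + (N + 1)).toNat, by omega, ?_⟩
  rw [Int.toNat_of_nonneg (by omega)]
  simpa using hx

lemma exists_neg_mem {U : Set X} (hU : IsOpen U) (hne : U.Nonempty) (x : X) :
    ∃ n : ℕ, F.T (-n) x ∈ U := by
  obtain ⟨N, hN⟩ := F.exists_bound hU hne
  obtain ⟨n, hn, hx⟩ := hN (F.T (-N) x)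
  rw [abs_le] at hn
  refine ⟨(-(n + -N)).toNat, ?_⟩
  rw [Int.toNat_of_nonneg (by omega)]
  simpa using hx

end Recurrence

/-- Time elapsed since the last visit to `D k`. -/
noncomputable def back (k : ℕ) (x : X) : ℕ := sInf {n : ℕ | F.T (-n) x ∈ F.D k}

/-- Time until the next visit to `D k`. -/
noncomputable def fwd (k : ℕ) (x : X) : ℕ := sInf {n : ℕ | 0 < n ∧ F.T n x ∈ F.D k}

/-- The point of `D k` at the bottom of the tower traversal containing `x`. -/
noncomputable def foot (k : ℕ) (x : X) : X := F.T (-(F.back k x)) x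

/-- Two points have the same position in the same tower of level `k`. -/
def Cell (k : ℕ) (x y : X) : Prop :=
  F.back k x = F.back k y ∧ F.fwd k x = F.fwd k y ∧
    ∀ j : ℤ, -(F.back k x) ≤ j → j < F.fwd k x → F.Agree k (F.T j x) (F.T j y)

/-- The base of the tower of level `k` containing `x`. -/
def vert (k : ℕ) (x : X) : Set X := {y | F.Cell k y (F.foot k x)}

variable [CompactSpace X]

lemma T_back_mem (k : ℕ) (x : X) : F.T (-(F.back k x)) x ∈ F.D k :=
  Nat.sInf_mem (s := {n : ℕ | F.T (-n) x ∈ F.D k})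
    (F.exists_neg_mem (F.isClopen_D k).isOpen ⟨_, F.x₀_mem_D k⟩ x)

lemma foot_mem (k : ℕ) (x : X) : F.foot k x ∈ F.D k := F.T_back_mem k x

lemma fwd_spec (k : ℕ) (x : X) : 0 < F.fwd k x ∧ F.T (F.fwd k x) x ∈ F.D k :=
  Nat.sInf_mem (s := {n : ℕ | 0 < n ∧ F.T n x ∈ F.D k})
    (F.exists_pos_mem (F.isClopen_D k).isOpen ⟨_, F.x₀_mem_D k⟩ x)

lemma fwd_pos (k : ℕ) (x : X) : 0 < F.fwd k x := (F.fwd_spec k x).1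

omit [CompactSpace X] in
lemma back_le {k : ℕ} {x : X} {n : ℕ} (h : F.T (-n) x ∈ F.D k) : F.back k x ≤ n :=
  Nat.sInf_le (s := {n : ℕ | F.T (-n) x ∈ F.D k}) h

omit [CompactSpace X] in
lemma fwd_le {k : ℕ} {x : X} {n : ℕ} (hn : 0 < n) (h : F.T n x ∈ F.D k) : F.fwd k x ≤ n :=
  Nat.sInf_le (s := {n : ℕ | 0 < n ∧ F.T n x ∈ F.D k}) ⟨hn, h⟩

omit [CompactSpace X] in
lemma notMem_of_window {k : ℕ} {x : X} {j : ℤ} (h1 : -(F.back k x : ℤ) < j) (h2 : j < F.fwd k x) :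
    F.T j x ∉ F.D k := by
  intro h
  rcases le_or_gt j 0 with hj | hj
  · have := F.back_le (k := k) (x := x) (n := (-j).toNat) (by
      rw [Int.toNat_of_nonneg (by omega)]; simpa using h)
    omega
  · have := F.fwd_le (k := k) (x := x) (n := j.toNat) (by omega) (by
      rw [Int.toNat_of_nonneg (by omega)]; exact h)
    omega

lemma back_eq_of {k : ℕ} {x : X} {n : ℕ} (h : F.T (-n) x ∈ F.D k)
    (h' : ∀ m < n, F.T (-m) x ∉ F.D k) : F.back k x = n := by
  refine le_antisymm (F.back_le h) ?_
  by_contra hlt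
  exact h' _ (not_le.1 hlt) (F.T_back_mem k x)

lemma fwd_eq_of {k : ℕ} {x : X} {n : ℕ} (hn : 0 < n) (h : F.T n x ∈ F.D k)
    (h' : ∀ m < n, 0 < m → F.T m x ∉ F.D k) : F.fwd k x = n := by
  refine le_antisymm (F.fwd_le hn h) ?_
  by_contra hlt
  exact h' _ (not_le.1 hlt) (F.fwd_pos k x) (F.fwd_spec k x).2

lemma back_eq_zero_iff {k : ℕ} {x : X} : F.back k x = 0 ↔ x ∈ F.D k := by
  constructor
  · intro h
    simpa [h] using F.T_back_mem k x
  · intro h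
    exact Nat.le_zero.1 (F.back_le (by simpa using h))

lemma back_T {k : ℕ} {x : X} {j : ℤ} (h1 : -(F.back k x : ℤ) ≤ j) (h2 : j < F.fwd k x) :
    (F.back k (F.T j x) : ℤ) = F.back k x + j := by
  have : F.back k (F.T j x) = (F.back k x + j).toNat := by
    apply F.back_eq_of
    · rw [Int.toNat_of_nonneg (by omega)]
      have := F.T_back_mem k x
      simpa using this
    · intro m hm
      rw [T_T]
      exact F.notMem_of_window (by omega) (by omega)
  omega

lemma fwd_T {k : ℕ} {x : X} {j : ℤ} (h1 : -(F.back k x : ℤ) ≤ j) (h2 : j < F.fwd k x) :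
    (F.fwd k (F.T j x) : ℤ) = F.fwd k x - j := by
  have : F.fwd k (F.T j x) = (F.fwd k x - j).toNat := by
    apply F.fwd_eq_of
    · omega
    · rw [Int.toNat_of_nonneg (by omega)]
      have := (F.fwd_spec k x).2
      simpa using this
    · intro m hm hm0
      rw [T_T]
      exact F.notMem_of_window (by omega) (by omega)
  omega

lemma foot_T {k : ℕ} {x : X} {j : ℤ} (h1 : -(F.back k x : ℤ) ≤ j) (h2 : j < F.fwd k x) :
    F.foot k (F.T j x) = F.foot k x := by
  simp only [foot, T_T, F.back_T h1 h2]
  congr 1; ring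

lemma vert_T {k : ℕ} {x : X} {j : ℤ} (h1 : -(F.back k x : ℤ) ≤ j) (h2 : j < F.fwd k x) :
    F.vert k (F.T j x) = F.vert k x := by
  simp only [vert, F.foot_T h1 h2]

lemma back_mono {k l : ℕ} (hkl : k ≤ l) (x : X) : F.back k x ≤ F.back l x :=
  F.back_le (F.D_anti hkl (F.T_back_mem l x))

lemma fwd_mono {k l : ℕ} (hkl : k ≤ l) (x : X) : F.fwd k x ≤ F.fwd l x :=
  F.fwd_le (F.fwd_pos l x) (F.D_anti hkl (F.fwd_spec l x).2)

@[simp] lemma back_foot (k : ℕ) (x : X) : F.back k (F.foot k x) = 0 :=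
  F.back_eq_zero_iff.2 (F.foot_mem k x)

lemma fwd_foot (k : ℕ) (x : X) : F.fwd k (F.foot k x) = F.fwd k x + F.back k x := by
  have := F.fwd_T (k := k) (x := x) (j := -(F.back k x)) le_rfl (by have := F.fwd_pos k x; omega)
  simp only [foot]; omega

lemma foot_eq_self {k : ℕ} {x : X} (h : x ∈ F.D k) : F.foot k x = x := by
  simp [foot, F.back_eq_zero_iff.2 h]

@[simp] lemma foot_foot (k : ℕ) (x : X) : F.foot k (F.foot k x) = F.foot k x :=
  F.foot_eq_self (F.foot_mem k x)

@[simp] lemma vert_foot (k : ℕ) (x : X) : F.vert k (F.foot k x) = F.vert k x := by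
  simp [vert]

omit [CompactSpace X] in
@[simp] lemma T_back_foot (k : ℕ) (x : X) : F.T (F.back k x) (F.foot k x) = x := by
  simp [foot]

variable {F}

omit [CompactSpace X] in
lemma Cell.refl (k : ℕ) (x : X) : F.Cell k x x := ⟨rfl, rfl, fun _ _ _ => Agree.refl _ _⟩

omit [CompactSpace X] in
lemma Cell.symm {k : ℕ} {x y : X} (h : F.Cell k x y) : F.Cell k y x :=
  ⟨h.1.symm, h.2.1.symm, fun j h1 h2 => (h.2.2 j (by rw [h.1]; exact h1)
    (by rw [h.2.1]; exact h2)).symm⟩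

omit [CompactSpace X] in
lemma Cell.trans {k : ℕ} {x y z : X} (h : F.Cell k x y) (h' : F.Cell k y z) : F.Cell k x z :=
  ⟨h.1.trans h'.1, h.2.1.trans h'.2.1, fun j h1 h2 => (h.2.2 j h1 h2).trans
    (h'.2.2 j (by rw [← h.1]; exact h1) (by rw [← h.2.1]; exact h2))⟩

lemma Cell.agree {k : ℕ} {x y : X} (h : F.Cell k x y) : F.Agree k x y := by
  have := h.2.2 0 (by omega) (by have := F.fwd_pos k x; omega)
  simpa using this

lemma Cell.shift {k : ℕ} {x y : X} (h : F.Cell k x y) {j : ℤ} (h1 : -(F.back k x : ℤ) ≤ j)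
    (h2 : j < F.fwd k x) : F.Cell k (F.T j x) (F.T j y) := by
  have e1 := F.back_T h1 h2
  have e2 := F.fwd_T h1 h2
  have e3 := F.back_T (k := k) (x := y) (j := j) (by rw [← h.1]; exact h1) (by rw [← h.2.1]; exact h2)
  have e4 := F.fwd_T (k := k) (x := y) (j := j) (by rw [← h.1]; exact h1) (by rw [← h.2.1]; exact h2)
  have := h.1
  have := h.2.1
  refine ⟨by omega, by omega, fun i hi1 hi2 => ?_⟩
  rw [T_T, T_T]
  exact h.2.2 _ (by omega) (by omega)

lemma Cell.mono {k l : ℕ} (hkl : k ≤ l) {x y : X} (h : F.Cell l x y) : F.Cell k x y := by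
  have hb := F.back_mono hkl x
  have hf := F.fwd_mono hkl x
  have key : ∀ j : ℤ, -(F.back l x) ≤ j → j < F.fwd l x → (F.T j x ∈ F.D k ↔ F.T j y ∈ F.D k) :=
    fun j h1 h2 => ((h.2.2 j h1 h2).mono hkl).mem_D_iff
  have e1 : F.back k y = F.back k x := by
    apply F.back_eq_of
    · rw [← key _ (by omega) (by have := F.fwd_pos l x; omega)]
      exact F.T_back_mem k x
    · intro m hm
      rw [← key _ (by omega) (by have := F.fwd_pos l x; omega)]
      exact F.notMem_of_window (by omega) (by have := F.fwd_pos k x; omega)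
  have e2 : F.fwd k y = F.fwd k x := by
    apply F.fwd_eq_of (F.fwd_pos k x)
    · rcases hf.lt_or_eq with hlt | heq
      · rw [← key _ (by omega) (by omega)]
        exact (F.fwd_spec k x).2
      · rw [heq, h.2.1]
        exact F.D_anti hkl (F.fwd_spec l y).2
    · intro m hm hm0
      rw [← key _ (by omega) (by omega)]
      exact F.notMem_of_window (by omega) (by omega)
  exact ⟨e1.symm, e2.symm, fun j h1 h2 => (h.2.2 j (by omega) (by omega)).mono hkl⟩

omit [CompactSpace X] in
lemma vert_eq_iff {k : ℕ} {x y : X} :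
    F.vert k x = F.vert k y ↔ F.Cell k (F.foot k x) (F.foot k y) := by
  constructor
  · intro h
    have : F.foot k x ∈ F.vert k x := Cell.refl _ _
    rw [h] at this
    exact this
  · intro h
    ext z
    exact ⟨fun hz => Cell.trans hz h, fun hz => Cell.trans hz h.symm⟩

lemma Cell.vert_eq {k : ℕ} {x y : X} (h : F.Cell k x y) : F.vert k x = F.vert k y := by
  rw [vert_eq_iff]
  have := h.shift (j := -(F.back k x)) le_rfl (by have := F.fwd_pos k x; omega)
  simp only [foot, ← h.1]
  exact this

lemma cell_iff {k : ℕ} {x y : X} :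
    F.Cell k x y ↔ F.vert k x = F.vert k y ∧ F.back k x = F.back k y := by
  refine ⟨fun h => ⟨h.vert_eq, h.1⟩, fun ⟨h1, h2⟩ => ?_⟩
  rw [vert_eq_iff] at h1
  have := h1.shift (j := F.back k x) (by omega) (by
    have := F.fwd_foot k x; have := F.fwd_pos k x; omega)
  rw [T_back_foot, h2, T_back_foot] at this
  exact this

lemma mem_vert_iff {k : ℕ} {x y : X} : y ∈ F.vert k x ↔ y ∈ F.D k ∧ F.vert k y = F.vert k x := by
  constructor
  · intro h
    have h' : F.Cell k y (F.foot k x) := h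
    refine ⟨?_, by rw [h'.vert_eq, vert_foot]⟩
    rw [← F.back_eq_zero_iff, h'.1, back_foot]
  · rintro ⟨h1, h2⟩
    rw [vert_eq_iff, F.foot_eq_self h1] at h2
    exact h2

variable (F)

lemma isClopen_back (k n : ℕ) : IsClopen {x | F.back k x = n} := by
  have : {x | F.back k x = n} = (F.T (-n) ⁻¹' F.D k) ∩
      ⋂ m ∈ Finset.range n, (F.T (-m) ⁻¹' F.D k)ᶜ := by
    ext x
    simp only [Set.mem_ofPred_eq, Set.mem_inter_iff, Set.mem_preimage, Set.mem_iInter,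
      Finset.mem_range, Set.mem_compl_iff]
    constructor
    · rintro rfl
      exact ⟨F.T_back_mem k x, fun m hm h => absurd (F.back_le h) (not_le.2 hm)⟩
    · rintro ⟨h1, h2⟩
      exact F.back_eq_of h1 h2
  rw [this]
  exact ((F.isClopen_D k).preimage (F.continuous_T _)).inter
    (isClopen_biInter_finset fun m _ => ((F.isClopen_D k).preimage (F.continuous_T _)).compl)

lemma isClopen_fwd (k n : ℕ) (hn : 0 < n) : IsClopen {x | F.fwd k x = n} := by
  have : {x | F.fwd k x = n} = (F.T n ⁻¹' F.D k) ∩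
      ⋂ m ∈ Finset.Ico 1 n, (F.T m ⁻¹' F.D k)ᶜ := by
    ext x
    simp only [Set.mem_ofPred_eq, Set.mem_inter_iff, Set.mem_preimage, Set.mem_iInter,
      Finset.mem_Ico, Set.mem_compl_iff]
    constructor
    · rintro rfl
      exact ⟨(F.fwd_spec k x).2, fun m hm h => absurd (F.fwd_le hm.1 h) (not_le.2 hm.2)⟩
    · rintro ⟨h1, h2⟩
      exact F.fwd_eq_of hn h1 fun m hm hm0 => h2 m ⟨hm0, hm⟩
  rw [this]
  exact ((F.isClopen_D k).preimage (F.continuous_T _)).inter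
    (isClopen_biInter_finset fun m _ => ((F.isClopen_D k).preimage (F.continuous_T _)).compl)

lemma isClopen_cell (k : ℕ) (x : X) : IsClopen {y | F.Cell k y x} := by
  have : {y | F.Cell k y x} = ({y | F.back k y = F.back k x} ∩ {y | F.fwd k y = F.fwd k x}) ∩
      ⋂ j ∈ Finset.Ico (-(F.back k x : ℤ)) (F.fwd k x),
        F.T j ⁻¹' {y | F.Agree k y (F.T j x)} := by
    ext y
    simp only [Cell, Set.mem_ofPred_eq, Set.mem_inter_iff, Set.mem_preimage, Set.mem_iInter,
      Finset.mem_Ico, and_assoc]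
    refine and_congr_right fun h1 => and_congr_right fun h2 => ?_
    rw [h1, h2]
    exact forall_congr' fun j => and_imp.symm
  rw [this]
  exact ((F.isClopen_back k _).inter (F.isClopen_fwd k _ (F.fwd_pos k x))).inter
    (isClopen_biInter_finset fun j _ => (F.isClopen_agree k _).preimage (F.continuous_T _))

lemma isLocallyConstant_of_cell {A : Type*} {k : ℕ} {f : X → A}
    (h : ∀ x y, F.Cell k x y → f x = f y) : IsLocallyConstant f := by
  rw [IsLocallyConstant.iff_exists_open]
  intro x
  exact ⟨_, (F.isClopen_cell k x).isOpen, Cell.refl k x, fun y hy => h _ _ hy⟩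

lemma isLocallyConstant_vert (k : ℕ) : IsLocallyConstant (F.vert k) :=
  F.isLocallyConstant_of_cell fun _ _ h => h.vert_eq

lemma isLocallyConstant_back (k : ℕ) : IsLocallyConstant (F.back k) :=
  F.isLocallyConstant_of_cell fun _ _ h => h.1

lemma finite_range_vert (k : ℕ) : (Set.range (F.vert k)).Finite :=
  (F.isLocallyConstant_vert k).range_finite

lemma isClopen_vert (k : ℕ) (x : X) : IsClopen (F.vert k x) := F.isClopen_cell k _

end TowerFrame

namespace TowerFrame

variable {X : Type*} [TopologicalSpace X] (F : TowerFrame X)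

/-- `o` is the starting position of a traversal of the level `k` tower `t` inside the level `l`
tower `s`. -/
def Edge (k l : ℕ) (t : Set X) (o : ℕ) (s : Set X) : Prop :=
  ∃ x, F.vert k x = t ∧ F.vert l x = s ∧ F.back l x = F.back k x + o

/-- The sum of a function along the traversal of a level `k` tower through a point. -/
noncomputable def towerSum (k : ℕ) (f : X → ℤ) (x : X) : ℤ :=
  ∑ j ∈ Finset.range (F.fwd k (F.foot k x)), f (F.T j (F.foot k x))

/-- Two points are eventually in the same towers with the same relative positions. -/
def Tail (x y : X) : Prop :=
  ∃ K, ∀ k ≥ K, F.vert k x = F.vert k y ∧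
    ∀ l ≥ k, F.back l x + F.back k y = F.back l y + F.back k x

variable {F}

lemma Tail.refl (x : X) : F.Tail x x := ⟨0, fun _ _ => ⟨rfl, fun _ _ => rfl⟩⟩

lemma Tail.symm {x y : X} (h : F.Tail x y) : F.Tail y x := by
  obtain ⟨K, hK⟩ := h
  exact ⟨K, fun k hk => ⟨(hK k hk).1.symm, fun l hl => ((hK k hk).2 l hl).symm⟩⟩

lemma Tail.trans {x y z : X} (h : F.Tail x y) (h' : F.Tail y z) : F.Tail x z := by
  obtain ⟨K, hK⟩ := h
  obtain ⟨K', hK'⟩ := h'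
  refine ⟨max K K', fun k hk => ?_⟩
  have h1 := hK k (le_trans (le_max_left _ _) hk)
  have h2 := hK' k (le_trans (le_max_right _ _) hk)
  refine ⟨h1.1.trans h2.1, fun l hl => ?_⟩
  have := h1.2 l hl
  have := h2.2 l hl
  omega

variable (F)
variable [CompactSpace X]

lemma edge_of {k l : ℕ} (hkl : k ≤ l) (x : X) :
    F.Edge k l (F.vert k x) (F.back l x - F.back k x) (F.vert l x) :=
  ⟨x, rfl, rfl, by have := F.back_mono hkl x; omega⟩

lemma exists_extend {k l : ℕ} (hkl : k ≤ l) {x z : X} (h : F.vert k x = F.vert k z) :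
    ∃ z', F.Cell k z' z ∧ F.vert l z' = F.vert l x ∧
      F.back l z' + F.back k x = F.back k z' + F.back l x := by
  have hc := vert_eq_iff.1 h
  have e1 := F.fwd_foot k x
  have e2 := F.fwd_foot k z
  have e3 := hc.2.1
  have e4 := F.fwd_pos k z
  have e5 := F.back_mono hkl x
  have e6 := F.fwd_mono hkl x
  refine ⟨F.T (F.back k z - F.back k x) x, ?_, F.vert_T (by omega) (by omega), ?_⟩
  · have := hc.shift (j := F.back k z) (by omega) (by omega)
    rw [T_back_foot] at this
    simpa [foot, sub_eq_add_neg] using this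
  · have := F.back_T (k := k) (x := x) (j := F.back k z - F.back k x) (by omega) (by omega)
    have := F.back_T (k := l) (x := x) (j := F.back k z - F.back k x) (by omega) (by omega)
    omega

lemma exists_of_edges {κ : ℕ → ℕ} (hκ : Monotone κ) {t : ℕ → Set X} {o : ℕ → ℕ}
    (h : ∀ l, F.Edge (κ l) (κ (l + 1)) (t l) (o l) (t (l + 1))) :
    ∃ z ∈ F.D (κ 0), ∀ l, F.vert (κ l) z = t l ∧
      F.back (κ (l + 1)) z = F.back (κ l) z + o l := by
  set C : ℕ → Set X := fun n => F.D (κ 0) ∩ ((⋂ l ∈ Finset.range (n + 1), {z | F.vert (κ l) z = t l})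
    ∩ ⋂ l ∈ Finset.range n, {z | F.back (κ (l + 1)) z = F.back (κ l) z + o l}) with hC
  have memC : ∀ n z, z ∈ C n ↔ z ∈ F.D (κ 0) ∧ (∀ l < n + 1, F.vert (κ l) z = t l) ∧
      ∀ l < n, F.back (κ (l + 1)) z = F.back (κ l) z + o l := by
    intro n z
    simp [hC]
  have hclosed : ∀ n, IsClosed (C n) := by
    intro n
    refine (F.isClopen_D _).isClosed.inter (IsClosed.inter ?_ ?_)
    · exact (isClopen_biInter_finset fun l _ =>
        (F.isLocallyConstant_vert _).isClopen_fiber _).isClosed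
    · refine isClosed_biInter fun l _ => ?_
      have := ((F.isLocallyConstant_back (κ (l + 1))).prodMk (F.isLocallyConstant_back (κ l)))
        {p | ¬ p.1 = p.2 + o l}
      rw [← isOpen_compl_iff]
      exact this
  have hne : ∀ n, (C n).Nonempty := by
    intro n
    induction n with
    | zero =>
      obtain ⟨x, hx, -, -⟩ := h 0
      refine ⟨F.foot (κ 0) x, (memC _ _).2 ⟨F.foot_mem _ _, fun l hl => ?_, by simp⟩⟩
      obtain rfl : l = 0 := by omega
      simpa using hx
    | succ n ih =>
      obtain ⟨z, hz⟩ := ih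
      obtain ⟨hz0, hz1, hz2⟩ := (memC _ _).1 hz
      obtain ⟨x, hx1, hx2, hx3⟩ := h n
      obtain ⟨z', h1, h2, h3⟩ := F.exists_extend (hκ (Nat.le_succ n)) (hx1.trans (hz1 n (by omega)).symm)
      have hcell : ∀ l ≤ n, F.Cell (κ l) z' z := fun l hl => h1.mono (hκ hl)
      refine ⟨z', (memC _ _).2 ⟨?_, fun l hl => ?_, fun l hl => ?_⟩⟩
      · rw [← F.back_eq_zero_iff] at hz0 ⊢
        rw [(hcell 0 (by omega)).1, hz0]
      · rcases Nat.lt_succ_iff_lt_or_eq.1 hl with hl | rfl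
        · rw [(hcell l (by omega)).vert_eq]; exact hz1 l hl
        · exact h2.trans hx2
      · rcases Nat.lt_succ_iff_lt_or_eq.1 hl with hl | rfl
        · rw [(hcell l (by omega)).1, (hcell (l + 1) (by omega)).1]; exact hz2 l hl
        · simp only [Nat.succ_eq_add_one] at h3; omega
  have hanti : ∀ n, C (n + 1) ⊆ C n := by
    intro n z hz
    rw [memC] at hz ⊢
    exact ⟨hz.1, fun l hl => hz.2.1 l (by omega), fun l hl => hz.2.2 l (by omega)⟩
  obtain ⟨z, hz⟩ := IsCompact.nonempty_iInter_of_sequence_nonempty_isCompact_isClosed C hanti hne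
    (hclosed 0).isCompact hclosed
  rw [Set.mem_iInter] at hz
  refine ⟨z, ((memC _ _).1 (hz 0)).1, fun l => ⟨?_, ?_⟩⟩
  · exact ((memC _ _).1 (hz l)).2.1 l (by omega)
  · exact ((memC _ _).1 (hz (l + 1))).2.2 l (by omega)

lemma foot_eq_of_tail [T2Space X] [TotallyDisconnectedSpace X] {κ : ℕ → ℕ} (hκ : StrictMono κ)
    {L : ℕ} {x y : X} (hv : ∀ l ≥ L, F.vert (κ l) x = F.vert (κ l) y)
    (hb : ∀ l ≥ L, F.back (κ (l + 1)) x + F.back (κ l) y =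
      F.back (κ (l + 1)) y + F.back (κ l) x) :
    F.foot (κ L) x = F.foot (κ L) y := by
  have hb' : ∀ l ≥ L, F.back (κ l) x + F.back (κ L) y = F.back (κ l) y + F.back (κ L) x := by
    intro l hl
    induction l, hl using Nat.le_induction with
    | base => omega
    | succ l hl ih => have := hb l hl; omega
  refine F.eq_of_agree fun K => ⟨κ (max K L), (le_max_left _ _).trans (hκ.id_le _), ?_⟩
  have hl : L ≤ max K L := le_max_right _ _
  generalize max K L = l at hl
  have hm : κ L ≤ κ l := hκ.monotone hl
  refine (cell_iff.2 ⟨?_, ?_⟩).agree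
  · have e1 := F.back_mono hm x
    have e2 := F.back_mono hm y
    rw [foot, foot, F.vert_T (by omega) (by have := F.fwd_pos (κ l) x; omega),
      F.vert_T (by omega) (by have := F.fwd_pos (κ l) y; omega), hv l hl]
  · have e1 := F.back_mono hm x
    have e2 := F.back_mono hm y
    have e3 := F.back_T (k := κ l) (x := x) (j := -(F.back (κ L) x)) (by omega)
      (by have := F.fwd_pos (κ l) x; omega)
    have e4 := F.back_T (k := κ l) (x := y) (j := -(F.back (κ L) y)) (by omega)
      (by have := F.fwd_pos (κ l) y; omega)
    have := hb' l hl
    simp only [foot]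
    omega

omit [CompactSpace X] in
lemma exists_T_of_foot_eq {k : ℕ} {x y : X} (h : F.foot k x = F.foot k y) :
    (x, y) ∈ orbitRelZ F.φ := by
  refine F.mem_orbitRel.2 ⟨F.back k y + -(F.back k x), ?_⟩
  rw [← T_T]
  change F.T _ (F.foot k x) = y
  rw [h, T_back_foot]

lemma tail_T_one [T2Space X] [TotallyDisconnectedSpace X] {x : X} (h : F.T 1 x ≠ F.x₀) :
    F.Tail x (F.T 1 x) := by
  obtain ⟨K, hK⟩ := F.exists_notMem_D h
  refine ⟨K, fun k hk => ?_⟩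
  have hlt : ∀ k ≥ K, 1 < F.fwd k x := by
    intro k hk
    by_contra hle
    have h0 := F.fwd_spec k x
    have : F.fwd k x = 1 := by omega
    rw [this] at h0
    exact hK k hk h0.2
  have hb : ∀ k ≥ K, F.back k (F.T 1 x) = F.back k x + 1 := fun k hk => by
    have := F.back_T (k := k) (x := x) (j := 1) (by omega) (by exact_mod_cast hlt k hk)
    omega
  refine ⟨(F.vert_T (by omega) (by exact_mod_cast hlt k hk)).symm, fun l hl => ?_⟩
  rw [hb k hk, hb l (le_trans hk hl)]
  omega

lemma tail_or [T2Space X] [TotallyDisconnectedSpace X] (x : X) (n : ℕ) :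
    F.Tail x (F.T n x) ∨ (F.Tail x (F.T (-1) F.x₀) ∧ F.Tail (F.T n x) F.x₀) := by
  induction n with
  | zero => left; simpa using Tail.refl x
  | succ n ih =>
    have hs : F.T ((n + 1 : ℕ) : ℤ) x = F.T 1 (F.T n x) := by
      rw [T_T]; congr 1; push_cast; ring
    rw [hs]
    by_cases h : F.T 1 (F.T n x) = F.x₀
    · right
      have h' : F.T n x = F.T (-1) F.x₀ := by rw [← h, T_T]; simp
      rw [h]
      refine ⟨?_, Tail.refl _⟩
      rcases ih with ih | ih
      · rwa [← h']
      · exact ih.1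
    · have ht := F.tail_T_one h
      rcases ih with ih | ih
      · exact Or.inl (ih.trans ht)
      · exact Or.inr ⟨ih.1, ht.symm.trans ih.2⟩

omit [CompactSpace X] in
lemma orbitRel_symm {x y : X} (h : (x, y) ∈ orbitRelZ F.φ) : (y, x) ∈ orbitRelZ F.φ := by
  obtain ⟨n, rfl⟩ := F.mem_orbitRel.1 h
  exact F.mem_orbitRel.2 ⟨-n, by simp⟩

omit [CompactSpace X] in
lemma orbitRel_trans {x y z : X} (h : (x, y) ∈ orbitRelZ F.φ) (h' : (y, z) ∈ orbitRelZ F.φ) :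
    (x, z) ∈ orbitRelZ F.φ := by
  obtain ⟨n, rfl⟩ := F.mem_orbitRel.1 h
  obtain ⟨m, rfl⟩ := F.mem_orbitRel.1 h'
  exact F.mem_orbitRel.2 ⟨m + n, by simp⟩

/-- The orbit relation is generated by the tail relation and one additional pair. -/
lemma orbitRel_transfer [T2Space X] [TotallyDisconnectedSpace X] {I : Type*} {c d : I → X}
    (h : ∀ a b, F.Tail (c a) (c b) → (d a, d b) ∈ orbitRelZ F.φ) {p q : I}
    (hp : F.Tail (c p) (F.T (-1) F.x₀)) (hq : F.Tail (c q) F.x₀)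
    (hpq : (d p, d q) ∈ orbitRelZ F.φ) {a b : I} (hab : (c a, c b) ∈ orbitRelZ F.φ) :
    (d a, d b) ∈ orbitRelZ F.φ := by
  have key : ∀ a b : I, ∀ n : ℕ, F.T n (c a) = c b → (d a, d b) ∈ orbitRelZ F.φ := by
    intro a b n hn
    rcases F.tail_or (c a) n with h1 | ⟨h1, h2⟩
    · exact h _ _ (hn ▸ h1)
    · exact F.orbitRel_trans (h _ _ (h1.trans hp.symm))
        (F.orbitRel_trans hpq (h _ _ (hq.trans (hn ▸ h2).symm)))
  obtain ⟨n, hn⟩ := F.mem_orbitRel.1 hab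
  obtain ⟨m, rfl | rfl⟩ := Int.eq_nat_or_neg n
  · exact key a b m hn
  · exact F.orbitRel_symm (key b a m (by rw [← hn]; simp))

lemma setOf_edge {k l : ℕ} (hkl : k ≤ l) (z y : X) :
    {o | F.Edge k l (F.vert k z) o (F.vert l y)} =
      {o | o < F.fwd l (F.foot l y) ∧ F.T o (F.foot l y) ∈ F.vert k z} := by
  ext o
  constructor
  · rintro ⟨x, h1, h2, h3⟩
    have hc := vert_eq_iff.1 h2
    have hlt : o < F.fwd l (F.foot l x) := by
      have := F.fwd_foot l x
      have := F.fwd_pos l x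
      omega
    have hs := (hc.shift (j := o) (by omega) (by omega)).mono hkl
    have hx : F.T o (F.foot l x) = F.foot k x := by
      simp only [foot, T_T]
      congr 1
      omega
    refine ⟨by rw [← hc.2.1]; exact hlt, ?_⟩
    rw [← h1, mem_vert_iff, ← hs.vert_eq, hx, vert_foot, ← F.back_eq_zero_iff, ← hs.1, hx, back_foot]
    exact ⟨rfl, rfl⟩
  · rintro ⟨h1, h2⟩
    obtain ⟨h3, h4⟩ := mem_vert_iff.1 h2
    refine ⟨_, h4, ?_, ?_⟩
    · rw [F.vert_T (by omega) (by omega), vert_foot]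
    · rw [F.back_eq_zero_iff.2 h3]
      have := F.back_T (k := l) (x := F.foot l y) (j := o) (by omega) (by omega)
      rw [back_foot] at this
      omega

open Classical in
lemma towerSum_indicator {k l : ℕ} (hkl : k ≤ l) (z y : X) :
    F.towerSum l ((F.vert k z).indicator 1) y =
      {o | F.Edge k l (F.vert k z) o (F.vert l y)}.ncard := by
  rw [F.setOf_edge hkl, towerSum]
  have : {o | o < F.fwd l (F.foot l y) ∧ F.T o (F.foot l y) ∈ F.vert k z} =
      (((Finset.range (F.fwd l (F.foot l y))).filter fun o : ℕ =>
        F.T o (F.foot l y) ∈ F.vert k z : Finset ℕ) : Set ℕ) := by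
    ext o; simp
  rw [this, Set.ncard_coe_finset, Finset.card_filter]
  push_cast
  refine Finset.sum_congr rfl fun j _ => ?_
  simp [Set.indicator_apply]

lemma finite_edge {k l : ℕ} (hkl : k ≤ l) (z y : X) :
    {o | F.Edge k l (F.vert k z) o (F.vert l y)}.Finite := by
  rw [F.setOf_edge hkl]
  exact (Set.finite_lt_nat _).subset fun o ho => ho.1

lemma towerSum_congr {k : ℕ} {f : X → ℤ} (hf : ∀ x y, F.Cell k x y → f x = f y) {x y : X}
    (h : F.vert k x = F.vert k y) : F.towerSum k f x = F.towerSum k f y := by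
  have hc := vert_eq_iff.1 h
  rw [towerSum, towerSum, ← hc.2.1]
  refine Finset.sum_congr rfl fun j hj => ?_
  rw [Finset.mem_range] at hj
  exact hf _ _ (hc.shift (by omega) (by omega))

lemma towerSum_coboundary {k : ℕ} {g : X → ℤ} (hg : ∀ x y, F.Agree k x y → g x = g y) (x : X) :
    F.towerSum k (fun x => g (F.T 1 x) - g x) x = 0 := by
  have h1 : F.towerSum k (fun x => g (F.T 1 x) - g x) x =
      ∑ j ∈ Finset.range (F.fwd k (F.foot k x)),
        (g (F.T (j + 1 : ℕ) (F.foot k x)) - g (F.T j (F.foot k x))) := by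
    refine Finset.sum_congr rfl fun j _ => ?_
    simp only [T_T]
    congr 3
    push_cast; ring
  rw [h1, Finset.sum_range_sub (fun j : ℕ => g (F.T j (F.foot k x)))]
  have e : F.Agree k (F.T (F.fwd k (F.foot k x)) (F.foot k x)) (F.foot k x) :=
    Agree.trans (F.fwd_spec k _).2 (Agree.symm (F.foot_mem k x))
  rw [hg _ _ e]
  simp

/-- A function with vanishing tower sums is a coboundary. -/
lemma eq_coboundary_of_towerSum_eq_zero {k : ℕ} {f : X → ℤ} (hf : ∀ x, F.towerSum k f x = 0)
    (x : X) :
    f x = (∑ j ∈ Finset.range (F.back k (F.T 1 x)), f (F.T j (F.foot k (F.T 1 x)))) -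
      ∑ j ∈ Finset.range (F.back k x), f (F.T j (F.foot k x)) := by
  have hpos := F.fwd_pos k x
  by_cases h : F.T 1 x ∈ F.D k
  · have h1 : F.fwd k x = 1 := le_antisymm (F.fwd_le one_pos (by exact_mod_cast h)) hpos
    have h2 := F.fwd_foot k x
    have h3 := hf x
    rw [towerSum, h2, h1, add_comm 1, Finset.sum_range_succ, T_back_foot] at h3
    rw [F.back_eq_zero_iff.2 h, Finset.range_zero, Finset.sum_empty]
    linarith
  · have h1 : 1 < F.fwd k x := by
      by_contra hle
      have : F.fwd k x = 1 := by omega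
      have h0 := (F.fwd_spec k x).2
      rw [this] at h0
      exact h h0
    have h2 := F.back_T (k := k) (x := x) (j := 1) (by omega) (by omega)
    have h3 : F.back k (F.T 1 x) = F.back k x + 1 := by omega
    rw [h3, F.foot_T (by omega) (by omega), Finset.sum_range_succ, T_back_foot]
    ring

lemma towerSum_indicator_D (k : ℕ) (h : X → ℤ) (x : X) :
    F.towerSum k ((F.D k).indicator h) x = h (F.foot k x) := by
  rw [towerSum, Finset.sum_eq_single 0]
  · simp [F.foot_mem k x]
  · intro j hj hj0
    rw [Finset.mem_range] at hj
    exact Set.indicator_of_notMem (F.notMem_of_window (by omega) (by omega)) _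
  · intro h0
    exact absurd (Finset.mem_range.2 (F.fwd_pos k _)) h0

end TowerFrame

/-- A measurable automorphism acting pointwise through countably many measure-preserving
automorphisms preserves the measure. -/
lemma map_eq_self_of_pointwise {Z ι : Type*} [MeasurableSpace Z] [Countable ι] {ρ : Measure Z}
    (g : ι → Z ≃ᵐ Z) (hg : ∀ i, MeasurePreserving (g i) ρ ρ) (h : Z ≃ᵐ Z)
    (hh : ∀ z, ∃ i, g i z = h z) (hm : ∀ i, MeasurableSet {z | g i z = h z}) :
    Measure.map h ρ = ρ := by
  rcases isEmpty_or_nonempty ι with hι | hι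
  · have : IsEmpty Z := ⟨fun z => (hh z).elim fun i _ => hι.elim i⟩
    exact Measure.ext fun A _ => by simp [Set.eq_empty_of_isEmpty A]
  obtain ⟨e, he⟩ := exists_surjective_nat ι
  set S : ℕ → Set Z := disjointed fun n => {z | g (e n) z = h z} with hS
  have hSm : ∀ n, MeasurableSet (S n) := fun n => MeasurableSet.disjointed (fun n => hm (e n)) n
  have hSd : Pairwise (Function.onFun Disjoint S) := disjoint_disjointed _
  have hSu : ⋃ n, S n = Set.univ := by
    rw [hS, iUnion_disjointed, Set.eq_univ_iff_forall]
    intro z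
    obtain ⟨i, hi⟩ := hh z
    obtain ⟨n, rfl⟩ := he i
    exact Set.mem_iUnion.2 ⟨n, hi⟩
  have hSsub : ∀ n, ∀ z ∈ S n, g (e n) z = h z := fun n z hz => disjointed_subset _ n hz
  refine Measure.ext fun A hA => ?_
  rw [h.map_apply]
  have himg : ∀ n, MeasurableSet (h '' S n) := fun n => h.measurableSet_image.2 (hSm n)
  have e1 : ρ (h ⁻¹' A) = ∑' n, ρ (h ⁻¹' A ∩ S n) := by
    rw [← measure_iUnion (fun i j hij => (hSd hij).mono Set.inter_subset_right
      Set.inter_subset_right) (fun n => (h.measurable hA).inter (hSm n)), ← Set.inter_iUnion, hSu,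
      Set.inter_univ]
  have e2 : ρ A = ∑' n, ρ (A ∩ h '' S n) := by
    rw [← measure_iUnion (fun i j hij => Disjoint.mono Set.inter_subset_right
      Set.inter_subset_right ((Set.disjoint_image_iff h.injective).2 (hSd hij)))
      (fun n => hA.inter (himg n)), ← Set.inter_iUnion, ← Set.image_iUnion, hSu, Set.image_univ,
      h.surjective.range_eq, Set.inter_univ]
  rw [e1, e2]
  refine tsum_congr fun n => ?_
  rw [← (hg (e n)).measure_preimage (hA.inter (himg n)).nullMeasurableSet]
  congr 1
  ext z
  constructor
  · rintro ⟨h1, h2⟩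
    have := hSsub n z h2
    exact ⟨by rw [this]; exact h1, by rw [this]; exact ⟨z, h2, rfl⟩⟩
  · rintro ⟨h1, z', hz', h2⟩
    have h3 := hSsub n z' hz'
    have : z' = z := (g (e n)).injective (h3.trans h2)
    subst this
    exact ⟨by rw [h3] at h1; exact h1, hz'⟩

lemma measurePreserving_zpow {X : Type*} [TopologicalSpace X] [MeasurableSpace X] [BorelSpace X]
    {φ : X ≃ₜ X} {ν : Measure X} (h : Measure.map φ ν = ν) (n : ℤ) :
    MeasurePreserving (φ ^ n) ν ν := by
  have h1 : MeasurePreserving φ ν ν := ⟨φ.continuous.measurable, h⟩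
  have h2 : MeasurePreserving φ.symm ν ν := h1.symm φ.toMeasurableEquiv
  have hp : ∀ n : ℕ, MeasurePreserving (φ ^ n) ν ν := by
    intro n
    induction n with
    | zero => exact MeasurePreserving.id ν
    | succ n ih => rw [pow_succ]; exact ih.comp h1
  have hq : ∀ n : ℕ, MeasurePreserving (φ⁻¹ ^ n) ν ν := by
    intro n
    induction n with
    | zero => exact MeasurePreserving.id ν
    | succ n ih => rw [pow_succ]; exact ih.comp h2
  obtain ⟨m, rfl | rfl⟩ := Int.eq_nat_or_neg n
  · simpa using hp m
  · simpa using hq m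

lemma isInvariantMeasure_of_map_eq {X : Type*} [TopologicalSpace X] [T2Space X]
    [MeasurableSpace X] [BorelSpace X] {φ : X ≃ₜ X} {ν : Measure X} (h : Measure.map φ ν = ν) :
    IsInvariantMeasure (orbitRelZ φ) ν := by
  intro f hf
  refine map_eq_self_of_pointwise (fun n : ℤ => (φ ^ n).toMeasurableEquiv)
    (measurePreserving_zpow h) f.toMeasurableEquiv (fun z => hf z) fun n => ?_
  exact (isClosed_eq (φ ^ n).continuous f.continuous).measurableSet

namespace TowerFrame

variable {X : Type*} [TopologicalSpace X] (F : TowerFrame X)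

lemma exists_height_ge [CompactSpace X] [T2Space X] [TotallyDisconnectedSpace X] (N : ℕ) :
    ∃ K, ∀ k ≥ K, ∀ x, N ≤ F.fwd k (F.foot k x) := by
  have hsep : ∀ j : ℕ, ∃ U : Set X, IsClopen U ∧ F.x₀ ∈ U ∧ (0 < j → F.T j F.x₀ ∉ U) := by
    intro j
    rcases Nat.eq_zero_or_pos j with rfl | hj
    · exact ⟨Set.univ, isClopen_univ, trivial, fun h => absurd h (lt_irrefl _)⟩
    · obtain ⟨U, h1, h2, h3⟩ := exists_clopen_separating (F.T_ne (n := j) (by omega) F.x₀).symm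
      exact ⟨U, h1, h2, fun _ => h3⟩
  choose U hU h0 hT using hsep
  obtain ⟨K, hK⟩ := F.exists_D_subset (U := ⋂ j ∈ Finset.Ico 1 N, U j ∩ F.T j ⁻¹' (U j)ᶜ)
    (isClopen_biInter_finset fun j _ => (hU j).inter ((hU j).compl.preimage (F.continuous_T _)))
    (by
      simp only [Set.mem_iInter, Finset.mem_Ico]
      exact fun j hj => ⟨h0 j, hT j hj.1⟩)
  refine ⟨K, fun k hk x => ?_⟩
  by_contra hlt
  have h1 := F.fwd_spec k (F.foot k x)
  have h2 := hK k hk (F.foot_mem k x)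
  have h3 := hK k hk h1.2
  simp only [Set.mem_iInter, Finset.mem_Ico] at h2 h3
  exact (h2 _ ⟨h1.1, not_le.1 hlt⟩).2 (h3 _ ⟨h1.1, not_le.1 hlt⟩).1

section Measure

variable [CompactSpace X] [T2Space X] [TotallyDisconnectedSpace X] [MeasurableSpace X]
  [BorelSpace X]

/-- The uniform measure on the tower traversal through a point. -/
noncomputable def towerMeasure (k : ℕ) (x : X) : Measure X :=
  (F.fwd k (F.foot k x) : ℝ≥0∞)⁻¹ •
    ∑ j ∈ Finset.range (F.fwd k (F.foot k x)), Measure.dirac (F.T j (F.foot k x))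

omit [T2Space X] [TotallyDisconnectedSpace X] in
omit [BorelSpace X] in
lemma isProbabilityMeasure_towerMeasure (k : ℕ) (x : X) :
    IsProbabilityMeasure (F.towerMeasure k x) := by
  constructor
  have := F.fwd_pos k (F.foot k x)
  simp only [towerMeasure, Measure.smul_apply, Measure.finsetSum_apply, measure_univ,
    Finset.sum_const, Finset.card_range, smul_eq_mul, nsmul_eq_mul, mul_one]
  exact ENNReal.inv_mul_cancel (by exact_mod_cast this.ne') (ENNReal.natCast_ne_top _)

omit [T2Space X] [TotallyDisconnectedSpace X] in
lemma integral_towerMeasure (k : ℕ) (x : X) {g : X → ℝ} (hg : Continuous g) :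
    ∫ y, g y ∂(F.towerMeasure k x) = (F.fwd k (F.foot k x) : ℝ)⁻¹ *
      ∑ j ∈ Finset.range (F.fwd k (F.foot k x)), g (F.T j (F.foot k x)) := by
  have hi : ∀ y, Integrable g (Measure.dirac y) := fun y =>
    hg.integrable_of_hasCompactSupport (HasCompactSupport.of_compactSpace g)
  rw [towerMeasure, integral_smul_measure, integral_finsetSum_measure fun j _ => hi _]
  simp [integral_dirac' _ _ hg.stronglyMeasurable]

lemma eventually_towerSum_ge [TopologicalSpace.MetrizableSpace X] {μ : Measure X}
    (huniq : ∀ ν : Measure X, IsProbabilityMeasure ν → IsInvariantMeasure (orbitRelZ F.φ) ν → ν = μ)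
    {f : X → ℤ} (hf : IsLocallyConstant f) (hpos : 0 < ∫ x, (f x : ℝ) ∂μ) (C : ℤ) :
    ∃ K, ∀ k ≥ K, ∀ x, C ≤ F.towerSum k f x := by
  by_contra! hcon
  choose κ hκ y hy using hcon
  have hcf : Continuous fun x => (f x : ℝ) := (hf.comp (Int.cast : ℤ → ℝ)).continuous
  let ν : ℕ → ProbabilityMeasure X := fun n =>
    ⟨F.towerMeasure (κ n) (y n), F.isProbabilityMeasure_towerMeasure _ _⟩
  let u : Ultrafilter ℕ := Filter.hyperfilter ℕ
  have hu : (u : Filter ℕ) ≤ Filter.atTop := Nat.hyperfilter_le_atTop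
  obtain ⟨ν', -, hν'⟩ := isCompact_univ.ultrafilter_le_nhds (u.map ν) (by simp)
  have hlim : Filter.Tendsto ν u (nhds ν') := hν'
  rw [ProbabilityMeasure.tendsto_iff_forall_integral_tendsto] at hlim
  have hlim' : ∀ g : X → ℝ, Continuous g → Filter.Tendsto
      (fun n => ∫ x, g x ∂(F.towerMeasure (κ n) (y n))) u (nhds (∫ x, g x ∂(ν' : Measure X))) :=
    fun g hg => hlim (BoundedContinuousFunction.mkOfCompact ⟨g, hg⟩)
  set h : ℕ → ℕ := fun n => F.fwd (κ n) (F.foot (κ n) (y n)) with hh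
  have hht : Filter.Tendsto (fun n => ((h n : ℝ))⁻¹) u (nhds 0) := by
    refine Filter.Tendsto.mono_left ?_ hu
    refine tendsto_inv_atTop_zero.comp (tendsto_natCast_atTop_atTop.comp ?_)
    rw [Filter.tendsto_atTop]
    intro N
    obtain ⟨K, hK⟩ := F.exists_height_ge N
    exact Filter.eventually_atTop.2 ⟨K, fun n hn => hK _ (hn.trans (hκ n)) _⟩
  have hpos' : ∀ n, (0 : ℝ) < h n := fun n => by exact_mod_cast F.fwd_pos _ _
  have hinv : Measure.map F.φ (ν' : Measure X) = ν' := by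
    have : IsFiniteMeasure (Measure.map F.φ (ν' : Measure X)) := by infer_instance
    refine ext_of_forall_integral_eq_of_IsFiniteMeasure fun g => ?_
    rw [integral_map F.φ.continuous.measurable.aemeasurable
      g.continuous.stronglyMeasurable.aestronglyMeasurable]
    have t1 := (hlim' _ (g.continuous.comp F.φ.continuous)).sub (hlim' _ g.continuous)
    have t2 : Filter.Tendsto (fun n => ((h n : ℝ))⁻¹ * (2 * ‖g‖)) u (nhds 0) := by
      simpa using hht.mul_const (2 * ‖g‖)
    have t3 := tendsto_nhds_unique t1 (squeeze_zero_norm (fun n => ?_) t2)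
    · exact sub_eq_zero.1 t3
    · rw [F.integral_towerMeasure _ _ (g.continuous.comp F.φ.continuous),
        F.integral_towerMeasure _ _ g.continuous, ← mul_sub, ← Finset.sum_sub_distrib]
      have e : ∑ j ∈ Finset.range (h n), ((g ∘ F.φ) (F.T j (F.foot (κ n) (y n))) -
          g (F.T j (F.foot (κ n) (y n)))) = g (F.T (h n) (F.foot (κ n) (y n))) -
            g (F.T (0 : ℕ) (F.foot (κ n) (y n))) := by
        rw [← Finset.sum_range_sub (fun j : ℕ => g (F.T j (F.foot (κ n) (y n))))]
        refine Finset.sum_congr rfl fun j _ => ?_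
        rw [Function.comp_apply, ← F.T_one, T_T]
        congr 3
        push_cast; ring
      rw [e, norm_mul, norm_inv, Real.norm_of_nonneg (hpos' n).le]
      refine mul_le_mul_of_nonneg_left ?_ (inv_nonneg.2 (hpos' n).le)
      refine (norm_sub_le _ _).trans ?_
      have := g.norm_coe_le_norm (F.T (h n) (F.foot (κ n) (y n)))
      have := g.norm_coe_le_norm (F.T (0 : ℕ) (F.foot (κ n) (y n)))
      linarith
  have hνμ : (ν' : Measure X) = μ :=
    huniq _ ν'.2 (isInvariantMeasure_of_map_eq hinv)
  have t4 := hlim' _ hcf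
  rw [hνμ] at t4
  have t5 : Filter.Tendsto (fun n => ((h n : ℝ))⁻¹ * (C : ℝ)) u (nhds 0) := by
    simpa using hht.mul_const (C : ℝ)
  have := le_of_tendsto_of_tendsto t4 t5 (Filter.Eventually.of_forall fun n => ?_)
  · linarith
  · dsimp only
    rw [F.integral_towerMeasure _ _ hcf]
    refine mul_le_mul_of_nonneg_left ?_ (inv_nonneg.2 (hpos' n).le)
    have := (hy n).le
    rw [towerSum] at this
    exact_mod_cast this

end Measure

end TowerFrame

namespace TowerFrame

variable {X : Type*} [TopologicalSpace X] (F : TowerFrame X)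

/-- The map sending a function to its coboundary. -/
def coboundary : LocallyConstant X ℤ →+ LocallyConstant X ℤ where
  toFun g := ⟨fun x => g (F.T 1 x) - g x,
    (g.isLocallyConstant.comp_continuous (F.continuous_T 1)).sub g.isLocallyConstant⟩
  map_zero' := by ext x; simp
  map_add' g h := by ext x; simp; ring

/-- Locally constant integer functions modulo coboundaries. -/
abbrev Coinvariants : Type _ := LocallyConstant X ℤ ⧸ F.coboundary.range

open Classical in
/-- The class of a locally constant function modulo coboundaries, and zero for other functions. -/
noncomputable def cls (f : X → ℤ) : F.Coinvariants :=
  if h : IsLocallyConstant f then ((⟨f, h⟩ : LocallyConstant X ℤ) : F.Coinvariants) else 0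

variable {F}

lemma cls_coe (f : LocallyConstant X ℤ) : F.cls f = (f : F.Coinvariants) := by
  exact dif_pos f.isLocallyConstant

lemma exists_cls (g : F.Coinvariants) : ∃ f : LocallyConstant X ℤ, F.cls f = g := by
  obtain ⟨f, rfl⟩ := QuotientAddGroup.mk_surjective g
  exact ⟨f, cls_coe f⟩

lemma cls_eq_iff {f g : LocallyConstant X ℤ} :
    F.cls f = F.cls g ↔ ∃ h : LocallyConstant X ℤ, ∀ x, f x - g x = h (F.T 1 x) - h x := by
  rw [cls_coe, cls_coe, eq_comm, QuotientAddGroup.eq]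
  constructor
  · rintro ⟨h, hh⟩
    refine ⟨h, fun x => ?_⟩
    have := DFunLike.congr_fun hh x
    simp only [coboundary, AddMonoidHom.coe_mk, ZeroHom.coe_mk, LocallyConstant.coe_mk,
      LocallyConstant.coe_add, LocallyConstant.coe_neg, Pi.add_apply, Pi.neg_apply] at this
    omega
  · rintro ⟨h, hh⟩
    refine ⟨h, ?_⟩
    ext x
    have := hh x
    simp only [coboundary, AddMonoidHom.coe_mk, ZeroHom.coe_mk, LocallyConstant.coe_mk,
      LocallyConstant.coe_add, LocallyConstant.coe_neg, Pi.add_apply, Pi.neg_apply]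
    omega

lemma cls_sum_smul {ι : Type*} (I : Finset ι) (a : ι → ℤ) (f : ι → LocallyConstant X ℤ) :
    ∑ i ∈ I, a i • F.cls (f i) = F.cls ((∑ i ∈ I, a i • f i : LocallyConstant X ℤ)) := by
  simp only [cls_coe]
  exact (map_sum (QuotientAddGroup.mk' F.coboundary.range) (fun i => a i • f i) I).symm ▸ by
    simp

lemma sum_smul_apply {ι : Type*} (I : Finset ι) (a : ι → ℤ) (f : ι → LocallyConstant X ℤ) (x : X) :
    (∑ i ∈ I, a i • f i : LocallyConstant X ℤ) x = ∑ i ∈ I, a i * f i x := by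
  classical
  induction I using Finset.induction_on with
  | empty => simp
  | insert i I hi ih =>
    rw [Finset.sum_insert hi, Finset.sum_insert hi, LocallyConstant.coe_add, Pi.add_apply, ih]
    rfl

section Trace
variable [CompactSpace X] [MeasurableSpace X] [BorelSpace X] {μ : Measure X}

lemma integrable_locallyConstant [IsFiniteMeasure μ] (f : LocallyConstant X ℤ) :
    Integrable (fun x => (f x : ℝ)) μ := by
  have : Continuous fun x => (f x : ℝ) := (f.isLocallyConstant.comp (Int.cast : ℤ → ℝ)).continuous
  exact this.integrable_of_hasCompactSupport (HasCompactSupport.of_compactSpace _)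

/-- Integration of classes of locally constant functions. -/
noncomputable def trace [IsFiniteMeasure μ] (hμ : Measure.map F.φ μ = μ) : F.Coinvariants →+ ℝ :=
  QuotientAddGroup.lift F.coboundary.range
    { toFun := fun f : LocallyConstant X ℤ => ∫ x, (f x : ℝ) ∂μ
      map_zero' := by simp
      map_add' := fun f g => by
        simp only [LocallyConstant.coe_add, Pi.add_apply, Int.cast_add]
        exact integral_add (integrable_locallyConstant f) (integrable_locallyConstant g) } (by
    rintro _ ⟨g, rfl⟩
    have hc : Continuous fun x => (g x : ℝ) :=
      (g.isLocallyConstant.comp (Int.cast : ℤ → ℝ)).continuous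
    have h1 : ∫ x, (g (F.φ x) : ℝ) ∂μ = ∫ x, (g x : ℝ) ∂μ := by
      conv_rhs => rw [← hμ]
      exact (F.φ.toMeasurableEquiv.measurableEmbedding.integral_map (fun x => (g x : ℝ))).symm
    have hi : Integrable (fun x => (g (F.φ x) : ℝ)) μ :=
      (hc.comp F.φ.continuous).integrable_of_hasCompactSupport (HasCompactSupport.of_compactSpace _)
    simp only [coboundary, AddMonoidHom.mem_ker, AddMonoidHom.coe_mk, ZeroHom.coe_mk,
      LocallyConstant.coe_mk, Int.cast_sub, F.T_one]
    rw [integral_sub hi (integrable_locallyConstant g), h1, sub_self])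

lemma trace_cls [IsFiniteMeasure μ] (hμ : Measure.map F.φ μ = μ) (f : LocallyConstant X ℤ) :
    trace hμ (F.cls f) = ∫ x, (f x : ℝ) ∂μ := by
  rw [cls_coe]; rfl

lemma measure_pos_of_isClopen [IsProbabilityMeasure μ] (hμ : Measure.map F.φ μ = μ) {U : Set X}
    (hU : IsOpen U) (hne : U.Nonempty) : 0 < μ U := by
  rw [pos_iff_ne_zero]
  intro h0
  obtain ⟨N, hN⟩ := F.exists_bound hU hne
  have hcov : (Set.univ : Set X) ⊆ ⋃ n : ℤ, F.T n ⁻¹' U := fun x _ => by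
    obtain ⟨n, -, hn⟩ := hN x
    exact Set.mem_iUnion.2 ⟨n, hn⟩
  have : μ (⋃ n : ℤ, F.T n ⁻¹' U) = 0 := measure_iUnion_null fun n => by
    have := (measurePreserving_zpow hμ n).measure_preimage hU.measurableSet.nullMeasurableSet
    rw [h0] at this
    exact this
  have h1 := measure_mono_null hcov this
  simp at h1

omit [CompactSpace X] in
lemma integral_charFn [IsFiniteMeasure μ] {U : Set X} (hU : IsClopen U) :
    ∫ x, ((LocallyConstant.charFn ℤ hU x : ℤ) : ℝ) ∂μ = (μ U).toReal := by
  have : (fun x => ((LocallyConstant.charFn ℤ hU x : ℤ) : ℝ)) = U.indicator 1 := by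
    ext x
    by_cases h : x ∈ U <;> simp [LocallyConstant.coe_charFn, h]
  rw [this, integral_indicator_one hU.isOpen.measurableSet]; rfl

lemma range_trace [IsFiniteMeasure μ] (hμ : Measure.map F.φ μ = μ) :
    (trace hμ).range = clopenValueGroup μ := by
  apply le_antisymm
  · rintro _ ⟨g, rfl⟩
    obtain ⟨f, rfl⟩ := exists_cls g
    have hfin := f.isLocallyConstant.range_finite
    have hcl : ∀ n : ℤ, IsClopen (f ⁻¹' {n}) := fun n => f.isLocallyConstant.isClopen_fiber n
    have hf : f = (∑ n ∈ hfin.toFinset, n • LocallyConstant.charFn ℤ (hcl n) :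
        LocallyConstant X ℤ) := by
      ext x
      rw [sum_smul_apply, Finset.sum_eq_single (f x)]
      · simp [LocallyConstant.coe_charFn]
      · intro n _ hn
        simp [LocallyConstant.coe_charFn, hn.symm]
      · intro h
        exact absurd (hfin.mem_toFinset.2 ⟨x, rfl⟩) h
    rw [hf, ← cls_sum_smul, map_sum]
    refine AddSubgroup.sum_mem _ fun n _ => ?_
    rw [map_zsmul, trace_cls, integral_charFn]
    have : (μ (f ⁻¹' {n})).toReal ∈ clopenValueGroup μ :=
      AddSubgroup.subset_closure ⟨_, hcl n, rfl⟩
    exact AddSubgroup.zsmul_mem _ this _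
  · rw [clopenValueGroup, AddSubgroup.closure_le]
    rintro _ ⟨V, hV, rfl⟩
    exact AddMonoidHom.mem_range.2
      ⟨F.cls (LocallyConstant.charFn ℤ hV), by rw [trace_cls, integral_charFn]⟩

end Trace

lemma exists_agree_eq [CompactSpace X] {A : Type*} {f : X → A} (hf : IsLocallyConstant f) :
    ∃ K, ∀ k ≥ K, ∀ x y, F.Agree k x y → f x = f y := by
  have hfin := hf.range_finite
  choose K hK using fun a : A => F.exists_agree_mem (hf.isClopen_fiber a)
  refine ⟨hfin.toFinset.sup K, fun k hk x y h => ?_⟩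
  have hx : K (f x) ≤ k := (Finset.le_sup (f := K) (hfin.mem_toFinset.2 ⟨x, rfl⟩)).trans hk
  exact ((hK _ k hx x y h).1 rfl).symm

section Representation
variable [CompactSpace X]
variable (F)

/-- The finite set of towers of level `k`. -/
noncomputable def verts (k : ℕ) : Finset (Set X) := (F.finite_range_vert k).toFinset

variable {F}

lemma mem_verts {k : ℕ} {t : Set X} : t ∈ F.verts k ↔ ∃ x, F.vert k x = t := by
  simp [verts]

lemma vert_mem_verts (k : ℕ) (x : X) : F.vert k x ∈ F.verts k := mem_verts.2 ⟨x, rfl⟩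

lemma isClopen_of_mem_verts {k : ℕ} {t : Set X} (h : t ∈ F.verts k) : IsClopen t := by
  obtain ⟨x, rfl⟩ := mem_verts.1 h
  exact F.isClopen_vert k x

variable (F) in
/-- The class of the indicator function of a set. -/
noncomputable def indClass (t : Set X) : F.Coinvariants := F.cls (t.indicator 1)

omit [CompactSpace X] in
lemma indClass_eq {t : Set X} (h : IsClopen t) :
    F.indClass t = F.cls (LocallyConstant.charFn ℤ h) := rfl

omit [CompactSpace X] in
lemma towerSum_sum_smul {ι : Type*} (I : Finset ι) (a : ι → ℤ) (f : ι → LocallyConstant X ℤ)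
    (k : ℕ) (x : X) : F.towerSum k (∑ i ∈ I, a i • f i : LocallyConstant X ℤ) x =
      ∑ i ∈ I, a i * F.towerSum k (f i) x := by
  simp only [towerSum, sum_smul_apply, Finset.mul_sum]
  exact Finset.sum_comm

lemma towerSum_eq_of_cls_eq {f g : LocallyConstant X ℤ} (h : F.cls f = F.cls g) :
    ∃ K, ∀ k ≥ K, ∀ x, F.towerSum k f x = F.towerSum k g x := by
  obtain ⟨d, hd⟩ := cls_eq_iff.1 h
  obtain ⟨K, hK⟩ := F.exists_agree_eq d.isLocallyConstant
  refine ⟨K, fun k hk x => ?_⟩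
  have := F.towerSum_coboundary (hK k hk) x
  rw [← sub_eq_zero, ← this, towerSum, towerSum, towerSum, ← Finset.sum_sub_distrib]
  exact Finset.sum_congr rfl fun j _ => hd _

lemma cls_eq_sum {k : ℕ} {f : LocallyConstant X ℤ} (hf : ∀ x y, F.Cell k x y → f x = f y)
    {a : Set X → ℤ} (ha : ∀ x, a (F.vert k x) = F.towerSum k f x) :
    F.cls f = ∑ t ∈ F.verts k, a t • F.indClass t := by
  classical
  let e : Set X → LocallyConstant X ℤ := fun t =>
    if h : IsClopen t then LocallyConstant.charFn ℤ h else 0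
  have he : ∀ t ∈ F.verts k, F.indClass t = F.cls (e t) := fun t ht => by
    simp only [e, dif_pos (isClopen_of_mem_verts ht)]; rfl
  rw [Finset.sum_congr rfl fun t ht => by rw [he t ht], cls_sum_smul]
  set g : LocallyConstant X ℤ := ∑ t ∈ F.verts k, a t • e t with hg
  have hgx : ∀ x, g x = (F.D k).indicator (fun x => a (F.vert k x)) x := by
    intro x
    rw [hg, sum_smul_apply, Finset.sum_eq_single (F.vert k x)]
    · simp only [e, dif_pos (F.isClopen_vert k x), LocallyConstant.coe_charFn]
      by_cases hx : x ∈ F.D k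
      · have : x ∈ F.vert k x := mem_vert_iff.2 ⟨hx, rfl⟩
        simp [hx, this]
      · have : x ∉ F.vert k x := fun h => hx (mem_vert_iff.1 h).1
        simp [hx, this]
    · intro t ht hne
      obtain ⟨z, rfl⟩ := mem_verts.1 ht
      have : x ∉ F.vert k z := fun h => hne (mem_vert_iff.1 h).2.symm
      simp [e, F.isClopen_vert k z, LocallyConstant.coe_charFn, this]
    · intro h
      exact absurd (vert_mem_verts k x) h
  have hd : ∀ x, F.towerSum k (f - g : LocallyConstant X ℤ) x = 0 := by
    intro x
    have h1 := F.towerSum_indicator_D k (fun x => a (F.vert k x)) x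
    have h2 : ((F.D k).indicator fun x => a (F.vert k x)) = g := funext fun x => (hgx x).symm
    rw [h2, vert_foot, ha] at h1
    have : F.towerSum k (f - g : LocallyConstant X ℤ) x = F.towerSum k f x - F.towerSum k g x := by
      rw [towerSum, towerSum, towerSum, ← Finset.sum_sub_distrib]; rfl
    rw [this, h1, sub_self]
  have hgc : ∀ x y, F.Cell k x y → g x = g y := by
    intro x y h
    rw [hgx, hgx]
    by_cases hx : x ∈ F.D k
    · rw [Set.indicator_of_mem hx, Set.indicator_of_mem (h.agree.mem_D_iff.1 hx), h.vert_eq]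
    · rw [Set.indicator_of_notMem hx, Set.indicator_of_notMem fun h' => hx (h.agree.mem_D_iff.2 h')]
  have hp : ∀ x y, F.Cell k x y →
      (∑ j ∈ Finset.range (F.back k x), (f - g : LocallyConstant X ℤ) (F.T j (F.foot k x))) =
      ∑ j ∈ Finset.range (F.back k y), (f - g : LocallyConstant X ℤ) (F.T j (F.foot k y)) := by
    intro x y h
    have hc := vert_eq_iff.1 h.vert_eq
    have h1 := F.fwd_foot k x
    have h2 := F.back_foot k x
    rw [← h.1]
    refine Finset.sum_congr rfl fun j hj => ?_
    rw [Finset.mem_range] at hj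
    have := hc.shift (j := j) (by omega) (by omega)
    simp only [LocallyConstant.coe_sub, Pi.sub_apply]
    rw [hf _ _ this, hgc _ _ this]
  refine cls_eq_iff.2 ⟨⟨_, F.isLocallyConstant_of_cell hp⟩, fun x => ?_⟩
  exact F.eq_coboundary_of_towerSum_eq_zero hd x

end Representation

end TowerFrame

/-- Multiplication by `l` on the range of a homomorphism to `ℝ` lifts to an automorphism of the
source as soon as the range is finitely generated. -/
lemma exists_addEquiv_of_range {G : Type*} [AddCommGroup G] (τ : G →+ ℝ) (hfg : τ.range.FG) {l : ℝ}
    (hl : l ≠ 0) (h1 : ∀ x ∈ τ.range, l * x ∈ τ.range) (h2 : ∀ x ∈ τ.range, l⁻¹ * x ∈ τ.range) :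
    ∃ α : G ≃+ G, ∀ g, τ (α g) = l * τ g := by
  have : Module.Finite ℤ τ.range := Module.Finite.iff_addGroup_fg.2
    ((AddGroup.fg_iff_addSubgroup_fg _).2 hfg)
  obtain ⟨s, hs⟩ := Module.projective_lifting_property τ.rangeRestrict.toIntLinearMap LinearMap.id
    τ.rangeRestrict_surjective
  have hs' : ∀ e : τ.range, τ (s e) = e := fun e =>
    congrArg Subtype.val (LinearMap.congr_fun hs e)
  have key : ∀ m : ℝ, (∀ x ∈ τ.range, m * x ∈ τ.range) →
      ∃ f : G →+ G, (∀ g, τ (f g) = m * τ g) ∧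
        ∀ g, ∃ h : m * τ g ∈ τ.range, f g = s ⟨_, h⟩ + (g - s ⟨τ g, g, rfl⟩) := by
    intro m hm
    refine ⟨AddMonoidHom.mk' (fun g => s ⟨m * τ g, hm _ ⟨g, rfl⟩⟩ + (g - s ⟨τ g, g, rfl⟩)) ?_,
      fun g => ?_, fun g => ⟨hm _ ⟨g, rfl⟩, rfl⟩⟩
    · intro a b
      have e1 : (⟨m * τ (a + b), hm _ ⟨_, rfl⟩⟩ : τ.range) =
          ⟨m * τ a, hm _ ⟨_, rfl⟩⟩ + ⟨m * τ b, hm _ ⟨_, rfl⟩⟩ := by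
        ext; simp [mul_add]
      have e2 : (⟨τ (a + b), _, rfl⟩ : τ.range) = ⟨τ a, _, rfl⟩ + ⟨τ b, _, rfl⟩ := by
        ext; simp
      rw [e1, e2, map_add, map_add]
      abel
    · simp [hs']
  obtain ⟨f, hf, hf'⟩ := key l h1
  obtain ⟨g, hg, hg'⟩ := key l⁻¹ h2
  have inv : ∀ (p q : G →+ G) (m n : ℝ), n * m = 1 → (∀ g, τ (p g) = m * τ g) →
      (∀ g, ∃ h : m * τ g ∈ τ.range, p g = s ⟨_, h⟩ + (g - s ⟨τ g, g, rfl⟩)) →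
      (∀ g, ∃ h : n * τ g ∈ τ.range, q g = s ⟨_, h⟩ + (g - s ⟨τ g, g, rfl⟩)) →
      ∀ x, q (p x) = x := by
    intro p q m n hnm hp hp' hq' x
    obtain ⟨h3, h4⟩ := hq' (p x)
    obtain ⟨h5, h6⟩ := hp' x
    have e1 : (⟨n * τ (p x), h3⟩ : τ.range) = ⟨τ x, x, rfl⟩ := by
      ext; simp [hp, ← mul_assoc, hnm]
    have e2 : (⟨τ (p x), p x, rfl⟩ : τ.range) = ⟨m * τ x, h5⟩ := by
      ext; simp [hp]
    rw [h4, e1, e2, h6]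
    abel
  exact ⟨⟨⟨f, g, inv f g _ _ (inv_mul_cancel₀ hl) hf hf' hg',
    inv g f _ _ (mul_inv_cancel₀ hl) hg hg' hf'⟩, f.map_add⟩, hf⟩

namespace TowerFrame

variable {X : Type*} [TopologicalSpace X] {F : TowerFrame X} [CompactSpace X]

lemma vert_zero (x : X) : F.vert 0 x = Set.univ := by
  have hb : ∀ y, F.back 0 y = 0 := fun y => F.back_eq_zero_iff.2 (F.mem_D_zero y)
  have hf : ∀ y, F.fwd 0 y = 1 := fun y =>
    le_antisymm (F.fwd_le one_pos (F.mem_D_zero _)) (F.fwd_pos 0 y)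
  refine Set.eq_univ_of_forall fun y => ?_
  exact ⟨by rw [hb, hb], by rw [hf, hf], fun _ _ _ _ h => absurd h (Nat.not_lt_zero _)⟩

lemma exists_back_lt [T2Space X] [TotallyDisconnectedSpace X] (k : ℕ) :
    ∃ K, ∀ k' ≥ K, F.back k (F.T (-1) F.x₀) < F.back k' (F.T (-1) F.x₀) := by
  obtain ⟨K, hK⟩ := F.exists_height_ge (F.back k (F.T (-1) F.x₀) + 2)
  refine ⟨K, fun k' hk' => ?_⟩
  have h1 := hK k' hk' (F.T (-1) F.x₀)
  have h2 := F.fwd_foot k' (F.T (-1) F.x₀)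
  have h3 : F.fwd k' (F.T (-1) F.x₀) ≤ 1 := F.fwd_le one_pos (by simp)
  omega

variable [T2Space X] [TotallyDisconnectedSpace X] [MeasurableSpace X] [BorelSpace X]
  {μ : Measure X}

/-- The matrix `A` from level `k` to level `l` represents `α` on the classes of tower bases. -/
def Represents (α : F.Coinvariants ≃+ F.Coinvariants) (k l : ℕ) (A : Set X → Set X → ℕ) : Prop :=
  ∀ t ∈ F.verts k, ∑ w ∈ F.verts l, (A t w : ℤ) • F.indClass w = α (F.indClass t)

lemma exists_cls_eq_sum [TopologicalSpace.MetrizableSpace X] [IsProbabilityMeasure μ]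
    (hμ : Measure.map F.φ μ = μ)
    (huniq : ∀ ν : Measure X, IsProbabilityMeasure ν → IsInvariantMeasure (orbitRelZ F.φ) ν → ν = μ)
    (f : LocallyConstant X ℤ) (hf : 0 < trace hμ (F.cls f)) :
    ∃ K, ∀ k ≥ K, ∃ a : Set X → ℕ, (∀ t ∈ F.verts k, 2 ≤ a t) ∧
      (∀ x, (a (F.vert k x) : ℤ) = F.towerSum k f x) ∧
      F.cls f = ∑ t ∈ F.verts k, (a t : ℤ) • F.indClass t := by
  rw [trace_cls] at hf
  obtain ⟨K₁, hK₁⟩ := F.eventually_towerSum_ge huniq f.isLocallyConstant hf 2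
  obtain ⟨K₂, hK₂⟩ := exists_agree_eq (F := F) f.isLocallyConstant
  refine ⟨max K₁ K₂, fun k hk => ?_⟩
  have hc : ∀ x y, F.Cell k x y → f x = f y := fun x y h =>
    hK₂ k (le_trans (le_max_right _ _) hk) x y h.agree
  have h2 : ∀ x, 2 ≤ F.towerSum k f x := hK₁ k (le_trans (le_max_left _ _) hk)
  have hex : ∃ a : Set X → ℕ, ∀ x, (a (F.vert k x) : ℤ) = F.towerSum k f x := by
    have : ∀ t : Set X, ∃ n : ℕ, ∀ x, F.vert k x = t → (n : ℤ) = F.towerSum k f x := by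
      intro t
      by_cases ht : ∃ x, F.vert k x = t
      · obtain ⟨x, rfl⟩ := ht
        refine ⟨(F.towerSum k f x).toNat, fun y hy => ?_⟩
        rw [Int.toNat_of_nonneg (by have := h2 x; omega), F.towerSum_congr hc hy]
      · exact ⟨0, fun x hx => absurd ⟨x, hx⟩ ht⟩
    choose a ha using this
    exact ⟨a, fun x => ha _ x rfl⟩
  obtain ⟨a, ha⟩ := hex
  refine ⟨a, fun t ht => ?_, ha, cls_eq_sum hc ha⟩
  obtain ⟨x, rfl⟩ := mem_verts.1 ht
  have := h2 x
  rw [← ha] at this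
  exact_mod_cast this

omit [T2Space X] [TotallyDisconnectedSpace X] in
lemma trace_indClass_pos [IsProbabilityMeasure μ] (hμ : Measure.map F.φ μ = μ) {k : ℕ} {t : Set X}
    (ht : t ∈ F.verts k) : 0 < trace hμ (F.indClass t) := by
  have hcl := isClopen_of_mem_verts ht
  obtain ⟨x, rfl⟩ := mem_verts.1 ht
  rw [indClass_eq hcl, trace_cls, integral_charFn]
  refine ENNReal.toReal_pos (measure_pos_of_isClopen hμ hcl.isOpen ?_).ne' (measure_ne_top _ _)
  exact ⟨F.foot k x, mem_vert_iff.2 ⟨F.foot_mem k x, F.vert_foot k x⟩⟩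

lemma exists_represents [TopologicalSpace.MetrizableSpace X] [IsProbabilityMeasure μ]
    (hμ : Measure.map F.φ μ = μ)
    (huniq : ∀ ν : Measure X, IsProbabilityMeasure ν → IsInvariantMeasure (orbitRelZ F.φ) ν → ν = μ)
    {α : F.Coinvariants ≃+ F.Coinvariants} {r : ℝ} (hr : 0 < r)
    (hα : ∀ g, trace hμ (α g) = r * trace hμ g) (k : ℕ) :
    ∃ f : Set X → LocallyConstant X ℤ, (∀ t, F.cls (f t) = α (F.indClass t)) ∧
      ∃ K, ∀ l ≥ K, ∃ A, Represents α k l A ∧ (∀ t ∈ F.verts k, ∀ w ∈ F.verts l, 2 ≤ A t w) ∧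
        ∀ t ∈ F.verts k, ∀ x, (A t (F.vert l x) : ℤ) = F.towerSum l (f t) x := by
  choose f hf using fun t : Set X => exists_cls (α (F.indClass t))
  have h1 : ∀ t, ∃ K, t ∈ F.verts k → ∀ l ≥ K, ∃ a : Set X → ℕ, (∀ w ∈ F.verts l, 2 ≤ a w) ∧
      (∀ x, (a (F.vert l x) : ℤ) = F.towerSum l (f t) x) ∧
      F.cls (f t) = ∑ w ∈ F.verts l, (a w : ℤ) • F.indClass w := by
    intro t
    by_cases ht : t ∈ F.verts k
    · obtain ⟨K, hK⟩ := exists_cls_eq_sum hμ huniq (f t)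
        (by rw [hf, hα]; exact mul_pos hr (trace_indClass_pos hμ ht))
      exact ⟨K, fun _ => hK⟩
    · exact ⟨0, fun h => absurd h ht⟩
  choose K hK using h1
  refine ⟨f, hf, (F.verts k).sup K, fun l hl => ?_⟩
  have h2 : ∀ t, ∃ a : Set X → ℕ, t ∈ F.verts k → (∀ w ∈ F.verts l, 2 ≤ a w) ∧
      (∀ x, (a (F.vert l x) : ℤ) = F.towerSum l (f t) x) ∧
      F.cls (f t) = ∑ w ∈ F.verts l, (a w : ℤ) • F.indClass w := by
    intro t
    by_cases ht : t ∈ F.verts k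
    · obtain ⟨a, ha⟩ := hK t ht l ((Finset.le_sup ht).trans hl)
      exact ⟨a, fun _ => ha⟩
    · exact ⟨0, fun h => absurd h ht⟩
  choose A hA using h2
  exact ⟨A, fun t ht => by rw [← hf, (hA t ht).2.2], fun t ht => (hA t ht).1,
    fun t ht => (hA t ht).2.1⟩

lemma Represents.exists_next [TopologicalSpace.MetrizableSpace X] [IsProbabilityMeasure μ]
    (hμ : Measure.map F.φ μ = μ)
    (huniq : ∀ ν : Measure X, IsProbabilityMeasure ν → IsInvariantMeasure (orbitRelZ F.φ) ν → ν = μ)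
    {α : F.Coinvariants ≃+ F.Coinvariants} {r : ℝ} (hr : 0 < r)
    (hα : ∀ g, trace hμ (α g) = r * trace hμ g) {k l : ℕ} {A : Set X → Set X → ℕ}
    (hA : Represents α k l A) :
    ∃ K, ∀ m ≥ K, ∃ B, Represents α.symm l m B ∧ (∀ t ∈ F.verts l, ∀ w ∈ F.verts m, 2 ≤ B t w) ∧
      ∀ t ∈ F.verts k, ∀ s ∈ F.verts m,
        ∑ w ∈ F.verts l, A t w * B w s = {o | F.Edge k m t o s}.ncard := by
  have hα' : ∀ g, trace hμ (α.symm g) = r⁻¹ * trace hμ g := fun g => by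
    have := hα (α.symm g)
    rw [AddEquiv.apply_symm_apply] at this
    rw [this, inv_mul_cancel_left₀ hr.ne']
  obtain ⟨f, hf, K₁, hK₁⟩ := exists_represents hμ huniq (inv_pos.2 hr) hα' l
  have h1 : ∀ t, ∃ K, t ∈ F.verts k → ∀ m ≥ K, ∀ x, F.towerSum m
      (∑ w ∈ F.verts l, (A t w : ℤ) • f w : LocallyConstant X ℤ) x =
        F.towerSum m (t.indicator 1) x := by
    intro t
    by_cases ht : t ∈ F.verts k
    · have hcl := isClopen_of_mem_verts ht
      have : F.cls (∑ w ∈ F.verts l, (A t w : ℤ) • f w : LocallyConstant X ℤ) =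
          F.cls (LocallyConstant.charFn ℤ hcl) := by
        rw [← cls_sum_smul, ← indClass_eq hcl]
        have := congrArg α.symm (hA t ht)
        rw [AddEquiv.symm_apply_apply, map_sum] at this
        rw [← this]
        exact Finset.sum_congr rfl fun w _ => by rw [hf, map_zsmul]
      obtain ⟨K, hK⟩ := towerSum_eq_of_cls_eq this
      exact ⟨K, fun _ => hK⟩
    · exact ⟨0, fun h => absurd h ht⟩
  choose K hK using h1
  refine ⟨max (max k l) (max K₁ ((F.verts k).sup K)), fun m hm => ?_⟩
  simp only [ge_iff_le, max_le_iff] at hm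
  obtain ⟨B, hB, hB2, hBf⟩ := hK₁ m hm.2.1
  refine ⟨B, hB, hB2, fun t ht s hs => ?_⟩
  have h2 := hK t ht m ((Finset.le_sup ht).trans hm.2.2)
  obtain ⟨z, rfl⟩ := mem_verts.1 ht
  obtain ⟨y, rfl⟩ := mem_verts.1 hs
  have h3 := h2 y
  rw [F.towerSum_indicator hm.1.1, towerSum_sum_smul] at h3
  have h4 : ((∑ w ∈ F.verts l, A (F.vert k z) w * B w (F.vert m y) : ℕ) : ℤ) =
      ({o | F.Edge k m (F.vert k z) o (F.vert m y)}.ncard : ℤ) := by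
    rw [← h3]
    push_cast
    exact Finset.sum_congr rfl fun w hw => by rw [hBf w hw]
  exact_mod_cast h4

/-- An automorphism of the group of coinvariants scaling the trace factors the telescoped tower
incidence matrices. -/
lemma exists_factorization [TopologicalSpace.MetrizableSpace X] [IsProbabilityMeasure μ]
    (hμ : Measure.map F.φ μ = μ)
    (huniq : ∀ ν : Measure X, IsProbabilityMeasure ν → IsInvariantMeasure (orbitRelZ F.φ) ν → ν = μ)
    {α : F.Coinvariants ≃+ F.Coinvariants} {r : ℝ} (hr : 0 < r)
    (hα : ∀ g, trace hμ (α g) = r * trace hμ g) :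
    ∃ (κ : ℕ → ℕ) (N : ℕ → Set X → Set X → ℕ), κ 0 = 0 ∧ StrictMono κ ∧
      (∀ l, F.back (κ l) (F.T (-1) F.x₀) < F.back (κ (l + 1)) (F.T (-1) F.x₀)) ∧
      (∀ l, ∀ t ∈ F.verts (κ l), ∀ w ∈ F.verts (κ (l + 1)), 2 ≤ N l t w) ∧
      (∀ l, ∀ t ∈ F.verts (κ l), ∀ s ∈ F.verts (κ (l + 2)),
        ∑ w ∈ F.verts (κ (l + 1)), N l t w * N (l + 1) w s =
          {o | F.Edge (κ l) (κ (l + 2)) t o s}.ncard) ∧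
      ∑ w ∈ F.verts (κ 1), (N 0 Set.univ w : ℝ) * (μ w).toReal = r := by
  let P : ℕ × ℕ × (Set X → Set X → ℕ) × (F.Coinvariants ≃+ F.Coinvariants) → Prop := fun p =>
    p.1 < p.2.1 ∧ F.back p.1 (F.T (-1) F.x₀) < F.back p.2.1 (F.T (-1) F.x₀) ∧
    Represents p.2.2.2 p.1 p.2.1 p.2.2.1 ∧
    (∀ t ∈ F.verts p.1, ∀ w ∈ F.verts p.2.1, 2 ≤ p.2.2.1 t w) ∧
    ∃ q : ℝ, 0 < q ∧ ∀ g, trace hμ (p.2.2.2 g) = q * trace hμ g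
  have step : ∀ p : Subtype P, ∃ p' : Subtype P, p'.1.1 = p.1.2.1 ∧
      ∀ t ∈ F.verts p.1.1, ∀ s ∈ F.verts p'.1.2.1,
        ∑ w ∈ F.verts p.1.2.1, p.1.2.2.1 t w * p'.1.2.2.1 w s =
          {o | F.Edge p.1.1 p'.1.2.1 t o s}.ncard := by
    rintro ⟨⟨k, l, A, β⟩, h1, h2, h3, h4, q, hq, hβ⟩
    dsimp only at h1 h2 h3 h4 hβ
    obtain ⟨K₁, hK₁⟩ := h3.exists_next hμ huniq hq hβ
    obtain ⟨K₂, hK₂⟩ := exists_back_lt (F := F) l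
    set m := max K₁ (max K₂ (l + 1)) with hm
    obtain ⟨B, hB, hB2, hBN⟩ := hK₁ m (le_max_left _ _)
    refine ⟨⟨⟨l, m, B, β.symm⟩, ?_, hK₂ m ((le_max_left _ _).trans (le_max_right _ _)), hB, hB2,
      q⁻¹, inv_pos.2 hq, fun g => ?_⟩, rfl, hBN⟩
    · exact lt_of_lt_of_le (Nat.lt_succ_self l) ((le_max_right _ _).trans (le_max_right _ _))
    · have := hβ (β.symm g)
      rw [AddEquiv.apply_symm_apply] at this
      rw [this, inv_mul_cancel_left₀ hq.ne']
  choose nxt hn1 hn2 using step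
  obtain ⟨f, -, K₁, hK₁⟩ := exists_represents hμ huniq hr hα 0
  obtain ⟨K₂, hK₂⟩ := exists_back_lt (F := F) 0
  set m := max K₁ (max K₂ 1) with hm
  obtain ⟨A, hA, hA2, -⟩ := hK₁ m (le_max_left _ _)
  let p₀ : Subtype P := ⟨⟨0, m, A, α⟩,
    lt_of_lt_of_le one_pos ((le_max_right _ _).trans (le_max_right _ _)),
    hK₂ m ((le_max_left _ _).trans (le_max_right _ _)), hA, hA2, r, hr, hα⟩
  let p : ℕ → Subtype P := fun n => nxt^[n] p₀
  have hps : ∀ n, p (n + 1) = nxt (p n) := fun n => Function.iterate_succ_apply' _ _ _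
  have hk : ∀ n, (p (n + 1)).1.1 = (p n).1.2.1 := fun n => by rw [hps, hn1]
  refine ⟨fun n => (p n).1.1, fun n => (p n).1.2.2.1, rfl, strictMono_nat_of_lt_succ fun n => ?_,
    fun n => ?_, fun n => ?_, fun n t ht s hs => ?_, ?_⟩
  · rw [hk]; exact (p n).2.1
  · dsimp only; rw [hk]; exact (p n).2.2.1
  · dsimp only; rw [hk]; exact (p n).2.2.2.2.1
  · dsimp only at hs ⊢
    rw [hk (n + 1)] at hs ⊢
    rw [hk n]
    have := hn2 (p n) t ht
    rw [← hps] at this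
    exact this s hs
  · dsimp only
    rw [hk]
    have hu : Set.univ ∈ F.verts 0 := mem_verts.2 ⟨F.x₀, vert_zero _⟩
    have h1 := congrArg (trace hμ) (hA _ hu)
    rw [hα, indClass_eq isClopen_univ, trace_cls, integral_charFn, measure_univ, map_sum] at h1
    rw [ENNReal.toReal_one, mul_one] at h1
    rw [← h1]
    refine Finset.sum_congr rfl fun w hw => ?_
    rw [map_zsmul, indClass_eq (isClopen_of_mem_verts hw), trace_cls, integral_charFn]
    simp [p, p₀]

end TowerFrame

lemma exists_bijOn_prescribed {α β : Type*} {S : Finset α} {T : Finset β} (h : S.card = T.card)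
    {a₁ a₂ : α} {b₁ b₂ : β} (ha : a₁ ≠ a₂) (hb : b₁ ≠ b₂) {C₁ C₂ : Prop}
    (h₁ : C₁ → a₁ ∈ S ∧ b₁ ∈ T) (h₂ : C₂ → a₂ ∈ S ∧ b₂ ∈ T) :
    ∃ f : α → β, Set.BijOn f S T ∧ (C₁ → f a₁ = b₁) ∧ (C₂ → f a₂ = b₂) := by
  classical
  let P : Finset S := Finset.univ.filter fun o => (C₁ ∧ o.1 = a₁) ∨ (C₂ ∧ o.1 = a₂)
  let g : S → β := fun o => if o.1 = a₁ then b₁ else b₂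
  obtain ⟨e, he⟩ := Finset.exists_equiv_extend_of_card_eq (α := S) (t := T) (by simpa using h)
    (s := P) (f := g) (by
      intro b hb
      obtain ⟨o, ho, rfl⟩ := Finset.mem_image.1 hb
      rcases (Finset.mem_filter.1 ho).2 with ⟨hC, h⟩ | ⟨hC, h⟩
      · simp only [g, if_pos h]; exact (h₁ hC).2
      · have : o.1 ≠ a₁ := fun h' => ha (h'.symm.trans h)
        simp only [g, if_neg this]; exact (h₂ hC).2)
    (by
      intro o ho o' ho' hoo
      rw [Subtype.ext_iff]
      have q := (Finset.mem_filter.1 ho).2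
      have q' := (Finset.mem_filter.1 ho').2
      by_cases h : o.1 = a₁ <;> by_cases h' : o'.1 = a₁
      · rw [h, h']
      · simp only [g, if_pos h, if_neg h'] at hoo
        exact absurd hoo hb
      · simp only [g, if_neg h, if_pos h'] at hoo
        exact absurd hoo hb.symm
      · rw [(q.resolve_left fun c => h c.2).2, (q'.resolve_left fun c => h' c.2).2])
  refine ⟨fun o => if ho : o ∈ S then e ⟨o, ho⟩ else b₁, ⟨?_, ?_, ?_⟩, fun hC => ?_, fun hC => ?_⟩
  · intro o ho
    rw [Finset.mem_coe] at ho
    simp [ho]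
  · intro o ho o' ho' hoo
    rw [Finset.mem_coe] at ho ho'
    simp only [dif_pos ho, dif_pos ho'] at hoo
    exact congrArg Subtype.val (e.injective (Subtype.ext hoo))
  · intro b hb
    obtain ⟨o, ho⟩ := e.surjective ⟨b, hb⟩
    exact ⟨o.1, o.2, by simp [ho]⟩
  · have hm := (h₁ hC).1
    simp only [dif_pos hm]
    rw [he ⟨a₁, hm⟩ (Finset.mem_filter.2 ⟨Finset.mem_univ _, Or.inl ⟨hC, rfl⟩⟩)]
    simp [g]
  · have hm := (h₂ hC).1
    simp only [dif_pos hm]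
    rw [he ⟨a₂, hm⟩ (Finset.mem_filter.2 ⟨Finset.mem_univ _, Or.inr ⟨hC, rfl⟩⟩)]
    simp [g, ha.symm]

namespace TowerFrame

variable {X : Type*} [TopologicalSpace X] {F : TowerFrame X} [CompactSpace X]

lemma tail_foot (k : ℕ) (x : X) : F.Tail x (F.foot k x) := by
  have key : ∀ l ≥ k, F.vert l (F.foot k x) = F.vert l x ∧
      (F.back l (F.foot k x) : ℤ) = F.back l x - F.back k x := by
    intro l hl
    have h1 := F.back_mono hl x
    have h2 := F.fwd_pos l x
    exact ⟨F.vert_T (by omega) (by omega), by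
      rw [foot, F.back_T (by omega) (by omega)]; ring⟩
  refine ⟨k, fun l hl => ⟨(key l hl).1.symm, fun m hm => ?_⟩⟩
  have h1 := (key l hl).2
  have h2 := (key m (hl.trans hm)).2
  omega

variable [T2Space X] [TotallyDisconnectedSpace X]

lemma tail_of_strictMono {κ : ℕ → ℕ} (hκ : StrictMono κ)
    {L : ℕ} {x y : X} (hv : ∀ l ≥ L, F.vert (κ l) x = F.vert (κ l) y)
    (hb : ∀ l ≥ L, F.back (κ (l + 1)) x + F.back (κ l) y =
      F.back (κ (l + 1)) y + F.back (κ l) x) : F.Tail x y :=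
  (tail_foot (κ L) x).trans (F.foot_eq_of_tail hκ hv hb ▸ (tail_foot (κ L) y).symm)

lemma Tail.mem_orbitRel {x y : X} (h : F.Tail x y) : (x, y) ∈ orbitRelZ F.φ := by
  obtain ⟨K, hK⟩ := h
  exact F.exists_T_of_foot_eq (F.foot_eq_of_tail strictMono_id (L := K) (fun l hl => (hK l hl).1)
    fun l hl => (hK l hl).2 _ (Nat.le_succ l))

/-- If `N` factors the incidence matrices between every second level, then points can be coded by
paths whose edges are counted by `N`. -/
lemma exists_code {κ : ℕ → ℕ} (hκ : StrictMono κ) {N : ℕ → Set X → Set X → ℕ}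
    (hback : ∀ l, F.back (κ l) (F.T (-1) F.x₀) < F.back (κ (l + 1)) (F.T (-1) F.x₀))
    (hN : ∀ l, ∀ t ∈ F.verts (κ l), ∀ w ∈ F.verts (κ (l + 1)), 2 ≤ N l t w)
    (hfac : ∀ l, ∀ t ∈ F.verts (κ l), ∀ s ∈ F.verts (κ (l + 2)),
      ∑ w ∈ F.verts (κ (l + 1)), N l t w * N (l + 1) w s =
        {o | F.Edge (κ l) (κ (l + 2)) t o s}.ncard) :
    ∃ code : X → ℕ → Set X × ℕ,
      (∀ x j, (code x j).1 ∈ F.verts (κ j) ∧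
        (code x j).2 < N j (code x j).1 (code x (j + 1)).1) ∧
      (∀ x, (code x 0).1 = F.vert (κ 0) x) ∧
      (∀ c : ℕ → Set X × ℕ, (∀ j, (c j).1 ∈ F.verts (κ j) ∧ (c j).2 < N j (c j).1 (c (j + 1)).1) →
        ∃ z ∈ F.D (κ 0), code z = c) ∧
      (∀ x ∈ F.D (κ 0), ∀ y ∈ F.D (κ 0), code x = code y → x = y) ∧
      (∀ x y, F.Tail x y ↔ ∃ L, ∀ j ≥ L, code x j = code y j) ∧
      (∀ j, IsLocallyConstant fun x => code x j) ∧
      (∀ j, code F.x₀ j = (F.vert (κ j) F.x₀, 0)) ∧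
      (∀ j, code (F.T (-1) F.x₀) j = (F.vert (κ j) (F.T (-1) F.x₀), 1)) := by
  have hmono := hκ.monotone
  have hβ : ∀ (l : ℕ) (t s : Set X), ∃ β : ℕ → (_ : Set X) × (ℕ × ℕ),
      (t ∈ F.verts (κ (2 * l)) → s ∈ F.verts (κ (2 * l + 2)) →
        Set.BijOn β {o | F.Edge (κ (2 * l)) (κ (2 * l + 2)) t o s}
          ((F.verts (κ (2 * l + 1))).sigma fun w => Finset.range (N (2 * l) t w) ×ˢ
            Finset.range (N (2 * l + 1) w s) : Finset _)) ∧
      (t = F.vert (κ (2 * l)) F.x₀ → s = F.vert (κ (2 * l + 2)) F.x₀ →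
        β 0 = ⟨F.vert (κ (2 * l + 1)) F.x₀, (0, 0)⟩) ∧
      (t = F.vert (κ (2 * l)) (F.T (-1) F.x₀) → s = F.vert (κ (2 * l + 2)) (F.T (-1) F.x₀) →
        β (F.back (κ (2 * l + 2)) (F.T (-1) F.x₀) - F.back (κ (2 * l)) (F.T (-1) F.x₀)) =
          ⟨F.vert (κ (2 * l + 1)) (F.T (-1) F.x₀), (1, 1)⟩) := by
    intro l t s
    have hk : κ (2 * l) ≤ κ (2 * l + 2) := hmono (by omega)
    by_cases hts : t ∈ F.verts (κ (2 * l)) ∧ s ∈ F.verts (κ (2 * l + 2))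
    · obtain ⟨ht, hs⟩ := hts
      have hfac' := hfac (2 * l) t ht s hs
      have hfin : {o | F.Edge (κ (2 * l)) (κ (2 * l + 2)) t o s}.Finite := by
        obtain ⟨z, rfl⟩ := mem_verts.1 ht
        obtain ⟨y, rfl⟩ := mem_verts.1 hs
        exact F.finite_edge hk z y
      have hedge := fun x => F.edge_of hk x
      have mem : ∀ x, ∀ i < 2, t = F.vert (κ (2 * l)) x → s = F.vert (κ (2 * l + 2)) x →
          (⟨F.vert (κ (2 * l + 1)) x, (i, i)⟩ : (_ : Set X) × (ℕ × ℕ)) ∈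
          ((F.verts (κ (2 * l + 1))).sigma fun w => Finset.range (N (2 * l) t w) ×ˢ
            Finset.range (N (2 * l + 1) w s) : Finset _) := by
        intro x i hi _ _
        have h1 := hN _ t ht _ (vert_mem_verts (κ (2 * l + 1)) x)
        have h2 := hN _ _ (vert_mem_verts (κ (2 * l + 1)) x) s hs
        simp only [Finset.mem_sigma, Finset.mem_product, Finset.mem_range]
        exact ⟨vert_mem_verts _ _, by omega, by omega⟩
      have hb : F.back (κ (2 * l)) (F.T (-1) F.x₀) < F.back (κ (2 * l + 2)) (F.T (-1) F.x₀) :=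
        (hback (2 * l)).trans (hback (2 * l + 1))
      obtain ⟨β, h1, h2, h3⟩ := exists_bijOn_prescribed (S := hfin.toFinset)
        (T := (F.verts (κ (2 * l + 1))).sigma fun w => Finset.range (N (2 * l) t w) ×ˢ
            Finset.range (N (2 * l + 1) w s))
        (by
          rw [← Set.ncard_eq_toFinset_card _ hfin, ← hfac', Finset.card_sigma]
          simp)
        (a₁ := 0)
        (a₂ := F.back (κ (2 * l + 2)) (F.T (-1) F.x₀) - F.back (κ (2 * l)) (F.T (-1) F.x₀))
        (b₁ := ⟨F.vert (κ (2 * l + 1)) F.x₀, (0, 0)⟩)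
        (b₂ := ⟨F.vert (κ (2 * l + 1)) (F.T (-1) F.x₀), (1, 1)⟩)
        (C₁ := t = F.vert (κ (2 * l)) F.x₀ ∧ s = F.vert (κ (2 * l + 2)) F.x₀)
        (C₂ := t = F.vert (κ (2 * l)) (F.T (-1) F.x₀) ∧ s = F.vert (κ (2 * l + 2)) (F.T (-1) F.x₀))
        (by omega) (by intro h; simp at h)
        (fun h => ⟨by
          rw [Set.Finite.mem_toFinset, Set.mem_ofPred_eq, h.1, h.2]
          have := hedge F.x₀
          rwa [F.back_eq_zero_iff.2 (F.x₀_mem_D _), Nat.zero_sub] at this, mem _ 0 (by omega) h.1 h.2⟩)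
        (fun h => ⟨by
          rw [Set.Finite.mem_toFinset, Set.mem_ofPred_eq, h.1, h.2]
          exact hedge _, mem _ 1 (by omega) h.1 h.2⟩)
      rw [Set.Finite.coe_toFinset] at h1
      exact ⟨β, fun _ _ => h1, fun a b => h2 ⟨a, b⟩, fun a b => h3 ⟨a, b⟩⟩
    · refine ⟨fun _ => ⟨∅, (0, 0)⟩, fun a b => absurd ⟨a, b⟩ hts, fun a b => ?_, fun a b => ?_⟩
      · exact absurd ⟨a ▸ vert_mem_verts _ _, b ▸ vert_mem_verts _ _⟩ hts
      · exact absurd ⟨a ▸ vert_mem_verts _ _, b ▸ vert_mem_verts _ _⟩ hts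
  choose β hβ1 hβ2 hβ3 using hβ
  let e : X → ℕ → (_ : Set X) × (ℕ × ℕ) := fun x l =>
    β l (F.vert (κ (2 * l)) x) (F.vert (κ (2 * l + 2)) x)
      (F.back (κ (2 * l + 2)) x - F.back (κ (2 * l)) x)
  let code : X → ℕ → Set X × ℕ := fun x j =>
    if j % 2 = 0 then (F.vert (κ j) x, (e x (j / 2)).2.1) else ((e x (j / 2)).1, (e x (j / 2)).2.2)
  have code_even : ∀ x l, code x (2 * l) = (F.vert (κ (2 * l)) x, (e x l).2.1) := by
    intro x l
    have h1 : 2 * l % 2 = 0 := by omega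
    have h2 : 2 * l / 2 = l := by omega
    simp only [code, h1, h2, if_true]
  have code_odd : ∀ x l, code x (2 * l + 1) = ((e x l).1, (e x l).2.2) := by
    intro x l
    have h1 : ¬ (2 * l + 1) % 2 = 0 := by omega
    have h2 : (2 * l + 1) / 2 = l := by omega
    simp only [code, h1, h2, if_false]
  have parity : ∀ j : ℕ, (∃ l, j = 2 * l) ∨ ∃ l, j = 2 * l + 1 := fun j => by
    rcases Nat.even_or_odd' j with ⟨l, h | h⟩
    exacts [Or.inl ⟨l, h⟩, Or.inr ⟨l, h⟩]
  have hbij := fun x l => hβ1 l _ _ (vert_mem_verts (κ (2 * l)) x) (vert_mem_verts (κ (2 * l + 2)) x)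
  have hedge : ∀ x l, F.Edge (κ (2 * l)) (κ (2 * l + 2)) (F.vert (κ (2 * l)) x)
      (F.back (κ (2 * l + 2)) x - F.back (κ (2 * l)) x) (F.vert (κ (2 * l + 2)) x) := fun x l =>
    F.edge_of (hmono (by omega)) x
  have hemem : ∀ x l, (e x l).1 ∈ F.verts (κ (2 * l + 1)) ∧
      (e x l).2.1 < N (2 * l) (F.vert (κ (2 * l)) x) (e x l).1 ∧
      (e x l).2.2 < N (2 * l + 1) (e x l).1 (F.vert (κ (2 * l + 2)) x) := by
    intro x l
    have := (hbij x l).mapsTo (hedge x l)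
    rw [Finset.mem_coe, Finset.mem_sigma, Finset.mem_product, Finset.mem_range,
      Finset.mem_range] at this
    exact this
  have hback' : ∀ x l, F.back (κ (2 * l)) x ≤ F.back (κ (2 * l + 2)) x := fun x l =>
    F.back_mono (hmono (by omega)) x
  have eq_of : ∀ x y L, (∀ j ≥ L, code x j = code y j) → ∀ l ≥ L,
      F.vert (κ (2 * l)) x = F.vert (κ (2 * l)) y ∧
      F.back (κ (2 * (l + 1))) x + F.back (κ (2 * l)) y =
      F.back (κ (2 * (l + 1))) y + F.back (κ (2 * l)) x := by
    intro x y L h l hl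
    have hv : ∀ l ≥ L, F.vert (κ (2 * l)) x = F.vert (κ (2 * l)) y := fun l hl => by
      have := h (2 * l) (by omega)
      rw [code_even, code_even] at this
      exact congrArg Prod.fst this
    refine ⟨hv l hl, ?_⟩
    have h1 := h (2 * l) (by omega)
    have h2 := h (2 * l + 1) (by omega)
    rw [code_even, code_even] at h1
    rw [code_odd, code_odd] at h2
    rw [Prod.mk.injEq] at h1 h2
    have he : e x l = e y l := Sigma.ext h2.1 (heq_of_eq (Prod.ext h1.2 h2.2))
    have hvl := hv l hl
    have hvl' : F.vert (κ (2 * l + 2)) x = F.vert (κ (2 * l + 2)) y := hv (l + 1) (by omega)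
    have h3 := hedge y l
    simp only [e] at he
    rw [← hvl, ← hvl'] at he h3
    have := (hbij x l).injOn (hedge x l) h3 he
    have h4 := hback' x l
    have h5 := hback' y l
    have h6 : 2 * (l + 1) = 2 * l + 2 := by ring
    rw [h6]
    omega
  have hκ2 : StrictMono fun l => κ (2 * l) := hκ.comp fun a b h => by simpa using h
  refine ⟨code, fun x j => ?_, fun x => ?_, fun c hc => ?_, fun x hx y hy h => ?_, fun x y => ⟨?_, ?_⟩,
    fun j => ?_, fun j => ?_, fun j => ?_⟩
  · obtain ⟨l, rfl⟩ | ⟨l, rfl⟩ := parity j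
    · rw [code_even, code_odd]
      exact ⟨vert_mem_verts _ _, (hemem x l).2.1⟩
    · have := code_even x (l + 1)
      rw [code_odd, show 2 * l + 1 + 1 = 2 * (l + 1) by ring, this]
      exact ⟨(hemem x l).1, (hemem x l).2.2⟩
  · exact congrArg Prod.fst (code_even x 0)
  · have h1 : ∀ l, ∃ o, F.Edge (κ (2 * l)) (κ (2 * (l + 1))) (c (2 * l)).1 o (c (2 * (l + 1))).1 ∧
        β l (c (2 * l)).1 (c (2 * (l + 1))).1 o =
          ⟨(c (2 * l + 1)).1, ((c (2 * l)).2, (c (2 * l + 1)).2)⟩ := by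
      intro l
      obtain ⟨o, ho1, ho2⟩ := (hβ1 l _ _ (hc (2 * l)).1 (hc (2 * l + 2)).1).surjOn
        (a := ⟨(c (2 * l + 1)).1, ((c (2 * l)).2, (c (2 * l + 1)).2)⟩) (by
          simp only [Finset.mem_coe, Finset.mem_sigma, Finset.mem_product, Finset.mem_range]
          exact ⟨(hc (2 * l + 1)).1, (hc (2 * l)).2, (hc (2 * l + 1)).2⟩)
      exact ⟨o, ho1, ho2⟩
    choose o ho1 ho2 using h1
    obtain ⟨z, hz, hz'⟩ := F.exists_of_edges hκ2.monotone (t := fun l => (c (2 * l)).1) ho1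
    refine ⟨z, hz, funext fun j => ?_⟩
    have he : ∀ l, e z l = ⟨(c (2 * l + 1)).1, ((c (2 * l)).2, (c (2 * l + 1)).2)⟩ := by
      intro l
      rw [← ho2]
      have h2 : F.back (κ (2 * l + 2)) z = F.back (κ (2 * l)) z + o l := (hz' l).2
      have h3 : F.vert (κ (2 * l + 2)) z = (c (2 * (l + 1))).1 := (hz' (l + 1)).1
      simp only [e]
      rw [(hz' l).1, h3, h2, Nat.add_sub_cancel_left]
    obtain ⟨l, rfl⟩ | ⟨l, rfl⟩ := parity j
    · rw [code_even, he, (hz' l).1]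
    · rw [code_odd, he]
  · have h1 := F.foot_eq_of_tail hκ2 (L := 0)
      (fun l hl => (eq_of x y 0 (fun j _ => congrFun h j) l hl).1)
      fun l hl => (eq_of x y 0 (fun j _ => congrFun h j) l hl).2
    rwa [F.foot_eq_self hx, F.foot_eq_self hy] at h1
  · rintro ⟨K, hK⟩
    have he : ∀ l ≥ K, e x l = e y l := by
      intro l hl
      have h1 := hK (κ (2 * l)) (hl.le.trans (hκ2.le_apply (x := l)))
      have h2 := hK (κ (2 * l + 2)) (hl.le.trans ((hκ2.le_apply (x := l)).trans (hmono (by omega))))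
      have h3 := h1.2 (κ (2 * l + 2)) (hmono (by omega))
      have h4 := hback' x l
      have h5 := hback' y l
      simp only [e]
      rw [h1.1, h2.1]
      congr 1
      omega
    refine ⟨2 * K, fun j hj => ?_⟩
    obtain ⟨l, rfl⟩ | ⟨l, rfl⟩ := parity j
    · have hl : K ≤ l := by omega
      rw [code_even, code_even, he l hl, (hK (κ (2 * l)) (hl.trans (hκ2.le_apply (x := l)))).1]
    · rw [code_odd, code_odd, he l (by omega)]
  · rintro ⟨L, hL⟩
    exact tail_of_strictMono hκ2 (L := L) (fun l hl => (eq_of x y L hL l hl).1)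
      fun l hl => (eq_of x y L hL l hl).2
  · refine F.isLocallyConstant_of_cell (k := κ (j + 2)) fun x y h => ?_
    have hc : ∀ i ≤ j + 2, F.vert (κ i) x = F.vert (κ i) y ∧ F.back (κ i) x = F.back (κ i) y :=
      fun i hi => cell_iff.1 (h.mono (hmono hi))
    obtain ⟨l, rfl⟩ | ⟨l, rfl⟩ := parity j
    · have h1 := hc (2 * l) (by omega)
      have h2 := hc (2 * l + 2) (by omega)
      simp only [code_even, e, h1, h2]
    · have h1 := hc (2 * l) (by omega)
      have h2 := hc (2 * l + 2) (by omega)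
      simp only [code_odd, e, h1, h2]
  · have he : ∀ l, e F.x₀ l = ⟨F.vert (κ (2 * l + 1)) F.x₀, (0, 0)⟩ := by
      intro l
      have := hβ2 l _ _ rfl rfl
      simpa only [e, F.back_eq_zero_iff.2 (F.x₀_mem_D _)] using this
    obtain ⟨l, rfl⟩ | ⟨l, rfl⟩ := parity j
    · rw [code_even, he]
    · rw [code_odd, he]
  · have he : ∀ l, e (F.T (-1) F.x₀) l = ⟨F.vert (κ (2 * l + 1)) (F.T (-1) F.x₀), (1, 1)⟩ :=
      fun l => hβ3 l _ _ rfl rfl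
    obtain ⟨l, rfl⟩ | ⟨l, rfl⟩ := parity j
    · rw [code_even, he]
    · rw [code_odd, he]

end TowerFrame

lemma exists_homeomorph_of_codes {X Y ι A : Type*} [TopologicalSpace X] [TopologicalSpace Y]
    [CompactSpace X] [CompactSpace Y] [T2Space Y] {f : X → ι → A} {g : Y → ι → A}
    (hf : ∀ i, IsLocallyConstant fun x => f x i) (hg : ∀ i, IsLocallyConstant fun y => g y i)
    (hfi : Function.Injective f) (hgi : Function.Injective g) (h : Set.range f = Set.range g) :
    ∃ Φ : X ≃ₜ Y, ∀ x, g (Φ x) = f x := by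
  let _ : TopologicalSpace A := ⊥
  have : DiscreteTopology A := ⟨rfl⟩
  have hfc : Continuous f := continuous_pi fun i => (hf i).continuous
  have hgc : Continuous g := continuous_pi fun i => (hg i).continuous
  let e : X ≃ Y := (Equiv.ofInjective f hfi).trans
    ((Equiv.setCongr h).trans (Equiv.ofInjective g hgi).symm)
  have he : ∀ x, g (e x) = f x := fun x => by
    exact Equiv.apply_ofInjective_symm hgi (Equiv.setCongr h (Equiv.ofInjective f hfi x))
  have hec : Continuous e := by
    rw [(hgc.isClosedEmbedding hgi).isInducing.continuous_iff]
    exact (funext he : g ∘ e = f) ▸ hfc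
  exact ⟨hec.homeoOfEquivCompactToT2, he⟩

lemma prod_count_apply {X : Type*} [MeasurableSpace X] (μ : Measure X) [IsFiniteMeasure μ] {n : ℕ}
    {U : Set (X × Fin n)} (hU : MeasurableSet U) :
    (μ.prod Measure.count) U = ∑ i, μ {x | (x, i) ∈ U} := by
  rw [Measure.prod_apply_symm hU, lintegral_count, tsum_fintype]
  rfl

namespace TowerFrame

variable {X : Type*} [TopologicalSpace X] {F : TowerFrame X} [CompactSpace X]

lemma measure_setOf_vert [MeasurableSpace X] [BorelSpace X] (μ : Measure X) (k : ℕ)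
    (p : Set X → Prop) [DecidablePred p] :
    μ {x | x ∈ F.D k ∧ p (F.vert k x)} = ∑ w ∈ F.verts k, if p w then μ w else 0 := by
  have : {x | x ∈ F.D k ∧ p (F.vert k x)} = ⋃ w ∈ (F.verts k).filter p, w := by
    ext x
    simp only [Set.mem_ofPred_eq, Set.mem_iUnion, Finset.mem_filter, exists_prop]
    constructor
    · rintro ⟨h1, h2⟩
      exact ⟨_, ⟨vert_mem_verts k x, h2⟩, mem_vert_iff.2 ⟨h1, rfl⟩⟩
    · rintro ⟨w, ⟨hw, h2⟩, h1⟩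
      obtain ⟨z, rfl⟩ := mem_verts.1 hw
      rw [mem_vert_iff] at h1
      exact ⟨h1.1, by rwa [h1.2]⟩
  rw [this, measure_biUnion_finset, Finset.sum_filter]
  · intro w hw w' hw' hne
    obtain ⟨z, rfl⟩ := mem_verts.1 (Finset.mem_filter.1 hw).1
    obtain ⟨z', rfl⟩ := mem_verts.1 (Finset.mem_filter.1 hw').1
    refine Set.disjoint_left.2 fun x hx hx' => hne ?_
    rw [← (mem_vert_iff.1 hx).2, ← (mem_vert_iff.1 hx').2]
  · intro w hw
    exact (isClopen_of_mem_verts (Finset.mem_filter.1 hw).1).isOpen.measurableSet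

variable [T2Space X] [TotallyDisconnectedSpace X] [MeasurableSpace X] [BorelSpace X]

lemma mem_fundGroup [TopologicalSpace.MetrizableSpace X] {μ : Measure X} [IsProbabilityMeasure μ]
    (hμ : Measure.map F.φ μ = μ)
    (huniq : ∀ ν : Measure X, IsProbabilityMeasure ν → IsInvariantMeasure (orbitRelZ F.φ) ν → ν = μ)
    (hfg : (clopenValueGroup μ).FG) {r : ℝ} (hr : 0 < r)
    (h1 : ∀ x ∈ clopenValueGroup μ, r * x ∈ clopenValueGroup μ)
    (h2 : ∀ x ∈ clopenValueGroup μ, r⁻¹ * x ∈ clopenValueGroup μ) :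
    r ∈ fundGroup (orbitRelZ F.φ) μ := by
  rw [← range_trace hμ] at hfg h1 h2
  obtain ⟨α, hα⟩ := exists_addEquiv_of_range (trace hμ) hfg hr.ne' h1 h2
  obtain ⟨κ, N, hκ0, hκ, hback, hN, hfac, hsum⟩ := exists_factorization hμ huniq hr hα
  have hzero : ∀ x, F.vert (κ 0) x = Set.univ := fun x => by rw [hκ0, vert_zero]
  have hD : ∀ x, x ∈ F.D (κ 0) := fun x => by rw [hκ0]; exact F.mem_D_zero x
  obtain ⟨f, hf1, hf0, hf2, hf3, hf4, hf5, hf6, hf7⟩ := exists_code hκ hback hN hfac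
  obtain ⟨g, hg1, hg0, hg2, hg3, hg4, hg5, hg6, hg7⟩ :=
    exists_code (F := F) (κ := fun j => κ (j + 1)) (fun a b h => hκ (Nat.succ_lt_succ h))
      (N := fun j => N (j + 1)) (fun l => hback (l + 1)) (fun l => hN (l + 1))
      (fun l => hfac (l + 1))
  simp only [zero_add] at hg0 hg2 hg3
  set n : ℕ := (F.verts (κ 1)).sup (N 0 Set.univ) with hn
  have hNn : ∀ x, N 0 Set.univ (F.vert (κ 1) x) ≤ n := fun x =>
    Finset.le_sup (f := N 0 Set.univ) (vert_mem_verts _ x)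
  let U : Set (X × Fin n) := {p | p.1 ∈ F.D (κ 1) ∧ (p.2 : ℕ) < N 0 Set.univ (F.vert (κ 1) p.1)}
  have hU : IsClopen U := by
    have hlc : IsLocallyConstant fun p : X × Fin n =>
        ((p.2 : ℕ) < N 0 Set.univ (F.vert (κ 1) p.1)) :=
      (((F.isLocallyConstant_vert (κ 1)).comp_continuous continuous_fst).prodMk
        ((IsLocallyConstant.of_discrete (id : Fin n → Fin n)).comp_continuous
          continuous_snd)).comp fun q : Set X × Fin n => ((q.2 : ℕ) < N 0 Set.univ q.1)
    have h3 := ((F.isClopen_D (κ 1)).preimage (continuous_fst (Y := Fin n))).inter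
      (hlc.isClopen_fiber True)
    convert h3 using 1
    ext p
    simp [U]
  have hcU : CompactSpace U := isCompact_iff_compactSpace.1 hU.isClosed.isCompact
  let g' : U → ℕ → Set X × ℕ := fun u j => Nat.casesOn j (Set.univ, (u.1.2 : ℕ)) fun j => g u.1.1 j
  have hfU : ∀ x, (f x 0).1 = Set.univ := fun x => by rw [hf0, hzero]
  have hrange : Set.range f = Set.range g' := by
    apply Set.Subset.antisymm
    · rintro _ ⟨x, rfl⟩
      obtain ⟨z, hz, hz'⟩ := hg2 (fun j => f x (j + 1)) fun j => hf1 x (j + 1)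
      have h3 := (hf1 x 0).2
      have h4 : (f x (0 + 1)).1 = F.vert (κ 1) z := by rw [← hg0, hz']
      rw [hfU, h4] at h3
      refine ⟨⟨(z, ⟨_, h3.trans_le (hNn z)⟩), hz, h3⟩, funext fun j => ?_⟩
      cases j with
      | zero => exact Prod.ext (hfU x).symm rfl
      | succ j => exact congrFun hz' j
    · rintro _ ⟨⟨⟨z, i⟩, hz, hi⟩, rfl⟩
      obtain ⟨x, -, hx⟩ := hf2 (g' ⟨(z, i), hz, hi⟩) fun j => by
        cases j with
        | zero =>
          refine ⟨?_, ?_⟩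
          · have := vert_mem_verts (F := F) (κ 0) z
            rwa [hzero] at this
          · change (i : ℕ) < N 0 Set.univ (g z 0).1
            rw [hg0]; exact hi
        | succ j => exact hg1 z j
      exact ⟨x, hx⟩
  have hfi : Function.Injective f := fun x y h => hf3 x (hD x) y (hD y) h
  have hgi : Function.Injective g' := by
    rintro ⟨⟨z, i⟩, hz, hi⟩ ⟨⟨z', i'⟩, hz', hi'⟩ h
    have h3 : z = z' := hg3 z hz z' hz' (funext fun j => congrFun h (j + 1))
    have h4 : (i : ℕ) = i' := congrArg Prod.snd (congrFun h 0)
    rw [← Fin.ext_iff] at h4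
    subst h3 h4
    rfl
  have hglc : ∀ j, IsLocallyConstant fun u => g' u j := by
    intro j
    cases j with
    | zero =>
      exact ((IsLocallyConstant.of_discrete (id : Fin n → Fin n)).comp_continuous
        (continuous_snd.comp continuous_subtype_val)).comp fun i : Fin n => (Set.univ, (i : ℕ))
    | succ j => exact (hg5 j).comp_continuous (continuous_fst.comp continuous_subtype_val)
  obtain ⟨Φ, hΦ⟩ := exists_homeomorph_of_codes hf5 hglc hfi hgi hrange
  have hVx : ∀ x, ∀ i < 2, i < N 0 Set.univ (F.vert (κ 1) x) := fun x i hi => by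
    have := hN 0 _ (vert_mem_verts (κ 0) x) _ (vert_mem_verts (κ 1) x)
    rw [hzero] at this
    omega
  have hΦ0 : (Φ F.x₀).1.1 = F.x₀ := by
    let y : U := ⟨(F.x₀, ⟨0, (hVx F.x₀ 0 (by omega)).trans_le (hNn _)⟩), F.x₀_mem_D _,
      hVx F.x₀ 0 (by omega)⟩
    have : Φ F.x₀ = y := hgi (by
      rw [hΦ]
      funext j
      cases j with
      | zero => rw [hf6, hzero]; rfl
      | succ j => rw [hf6]; exact (hg6 j).symm)
    rw [this]
  have hΦ1 : F.Tail (Φ (F.T (-1) F.x₀)).1.1 (F.T (-1) F.x₀) := by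
    refine (hg4 _ _).2 ⟨0, fun j _ => ?_⟩
    have := congrFun (hΦ (F.T (-1) F.x₀)) (j + 1)
    rw [hg7]
    rw [hf7] at this
    exact this
  have h01 : (F.T (-1) F.x₀, F.x₀) ∈ orbitRelZ F.φ := F.mem_orbitRel.2 ⟨1, by simp⟩
  have htail : ∀ x y : X, F.Tail x y ↔ F.Tail (Φ x).1.1 (Φ y).1.1 := by
    intro x y
    rw [hf4, hg4]
    have hΦ' : ∀ x j, f x (j + 1) = g (Φ x).1.1 j := fun x j => (congrFun (hΦ x) (j + 1)).symm
    constructor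
    · rintro ⟨L, hL⟩
      exact ⟨L, fun j hj => by rw [← hΦ', ← hΦ', hL _ (by omega)]⟩
    · rintro ⟨L, hL⟩
      refine ⟨L + 1, fun j hj => ?_⟩
      obtain ⟨i, rfl⟩ : ∃ i, j = i + 1 := ⟨j - 1, by omega⟩
      rw [hΦ', hΦ', hL i (by omega)]
  refine ⟨n, U, hU, ⟨Φ, fun x y => ⟨fun h => ?_, fun h => ?_⟩⟩, ?_⟩
  · refine F.orbitRel_transfer (c := id) (d := fun x => (Φ x).1.1)
      (fun a b hab => ((htail a b).1 hab).mem_orbitRel) (p := F.T (-1) F.x₀) (q := F.x₀)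
      (Tail.refl _) (Tail.refl _) ?_ h
    rw [hΦ0]
    exact F.orbitRel_trans hΦ1.mem_orbitRel h01
  · refine F.orbitRel_transfer (c := fun x => (Φ x).1.1) (d := id)
      (fun a b hab => ((htail a b).2 hab).mem_orbitRel) (p := F.T (-1) F.x₀) (q := F.x₀)
      hΦ1 (by rw [hΦ0]; exact Tail.refl _) h01 h
  · rw [prod_count_apply μ hU.isOpen.measurableSet,
      ENNReal.toReal_sum fun _ _ => measure_ne_top _ _, ← hsum]
    have h3 : ∀ i : Fin n, (μ {x | (x, i) ∈ U}).toReal =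
        ∑ w ∈ F.verts (κ 1), if (i : ℕ) < N 0 Set.univ w then (μ w).toReal else 0 := by
      intro i
      have := F.measure_setOf_vert μ (κ 1) fun w => (i : ℕ) < N 0 Set.univ w
      change (μ {x | x ∈ F.D (κ 1) ∧ (i : ℕ) < N 0 Set.univ (F.vert (κ 1) x)}).toReal = _
      rw [this, ENNReal.toReal_sum fun w _ => by split_ifs <;> simp]
      exact Finset.sum_congr rfl fun w _ => by split_ifs <;> simp
    simp only [h3]
    rw [Finset.sum_comm]
    refine Finset.sum_congr rfl fun w hw => ?_
    have h4 : N 0 Set.univ w ≤ n := Finset.le_sup (f := N 0 Set.univ) hw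
    rw [← Finset.sum_filter, Finset.sum_const, nsmul_eq_mul, Fin.card_filter_val_lt, min_eq_right h4]

end TowerFrame

lemma exists_towerFrame {X : Type*} [TopologicalSpace X] [CompactSpace X]
    [TopologicalSpace.MetrizableSpace X] [TotallyDisconnectedSpace X] [Nonempty X] {φ : X ≃ₜ X}
    (hfree : IsFreeZ φ) (hmin : IsMinimalRel (orbitRelZ φ)) : ∃ F : TowerFrame X, F.φ = φ := by
  have : Countable (TopologicalSpace.Clopens X) :=
    TopologicalSpace.Clopens.countable_iff_secondCountable.2 inferInstance
  obtain ⟨e, he⟩ := exists_surjective_nat (TopologicalSpace.Clopens X)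
  refine ⟨⟨φ, fun n => e n, Classical.arbitrary X, fun n => (e n).isClopen, fun U hU => ?_, hmin,
    hfree⟩, rfl⟩
  obtain ⟨n, hn⟩ := he ⟨U, hU⟩
  exact ⟨n, by rw [hn]; rfl⟩

lemma measurePreserving_equiv_count {α β : Type*} [MeasurableSpace α] [MeasurableSpace β]
    (σ : α ≃ᵐ β) : MeasurePreserving σ Measure.count Measure.count := by
  refine ⟨σ.measurable, Measure.ext fun s hs => ?_⟩
  rw [σ.map_apply, Measure.count_apply hs, Measure.count_apply (σ.measurable hs),
    Set.encard_preimage_of_bijective σ.bijective]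

section RestrictedSystem

variable {X : Type*} [TopologicalSpace X] [CompactSpace X] [TopologicalSpace.MetrizableSpace X]
  [MeasurableSpace X] [BorelSpace X] {φ : X ≃ₜ X} {μ : Measure X} [IsProbabilityMeasure μ] {n : ℕ}
  {U : Set (X × Fin n)}

lemma prod_count_image_preimage (hμ : Measure.map φ μ = μ) (hU : IsClopen U) (h : U ≃ₜ U)
    (hh : ∀ u, (u, h u) ∈ restrictRel (finProdRel (orbitRelZ φ) n) U) {A : Set U}
    (hA : MeasurableSet A) :
    (μ.prod Measure.count) (Subtype.val '' (h ⁻¹' A)) =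
      (μ.prod Measure.count) (Subtype.val '' A) := by
  classical
  have hUm : MeasurableSet U := hU.isOpen.measurableSet
  have hmeas : ∀ f : U ≃ₜ U, Measurable (Equiv.Perm.ofSubtype (p := (· ∈ U)) f.toEquiv) := by
    intro f
    refine measurable_of_restrict_of_restrict_compl hUm ?_ ?_
    · convert measurable_subtype_coe.comp f.continuous.measurable using 1
      ext u : 1
      exact Equiv.Perm.ofSubtype_apply_of_mem (p := (· ∈ U)) f.toEquiv u.2
    · convert measurable_subtype_coe using 1
      ext u : 1
      exact Equiv.Perm.ofSubtype_apply_of_not_mem (p := (· ∈ U)) f.toEquiv u.2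
  let H : X × Fin n ≃ᵐ X × Fin n := ⟨Equiv.Perm.ofSubtype (p := (· ∈ U)) h.toEquiv, hmeas h, by
    have := hmeas h.symm
    convert this using 2
    exact (map_inv (Equiv.Perm.ofSubtype (p := (· ∈ U))) h.toEquiv).symm⟩
  have hHU : ∀ u : U, H u = h u := fun u =>
    Equiv.Perm.ofSubtype_apply_of_mem (p := (· ∈ U)) h.toEquiv u.2
  have hHc : ∀ z, z ∉ U → H z = z := fun z hz =>
    Equiv.Perm.ofSubtype_apply_of_not_mem (p := (· ∈ U)) h.toEquiv hz
  have key : Measure.map H (μ.prod Measure.count) = μ.prod Measure.count := by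
    refine map_eq_self_of_pointwise (ι := ℤ × Equiv.Perm (Fin n))
      (fun i => (φ ^ i.1).toMeasurableEquiv.prodCongr ⟨i.2, measurable_from_top, measurable_from_top⟩)
      (fun i => (measurePreserving_zpow hμ i.1).prod (measurePreserving_equiv_count _)) H ?_ ?_
    · intro z
      by_cases hz : z ∈ U
      · obtain ⟨k, hk⟩ := hh ⟨z, hz⟩
        refine ⟨(k, Equiv.swap z.2 (h ⟨z, hz⟩).1.2), ?_⟩
        rw [hHU ⟨z, hz⟩]
        exact Prod.ext hk (Equiv.swap_apply_left _ _)
      · exact ⟨(0, 1), (hHc z hz).symm⟩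
    · exact fun i => measurableSet_eq_fun (MeasurableEquiv.measurable _) H.measurable
  have hA' : MeasurableSet (Subtype.val '' A : Set (X × Fin n)) := hUm.subtype_image hA
  conv_rhs => rw [← key, H.map_apply]
  congr 1
  ext z
  constructor
  · rintro ⟨u, hu, rfl⟩
    exact ⟨h u, hu, (hHU u).symm⟩
  · rintro ⟨u, hu, huz⟩
    by_cases hz : z ∈ U
    · rw [hHU ⟨z, hz⟩] at huz
      refine ⟨⟨z, hz⟩, ?_, rfl⟩
      rwa [Set.mem_preimage, ← Subtype.ext huz]
    · rw [hHc z hz] at huz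
      exact absurd (huz ▸ u.2) hz

lemma prod_count_image_eq (hμ : Measure.map φ μ = μ)
    (huniq : ∀ ν : Measure X, IsProbabilityMeasure ν → IsInvariantMeasure (orbitRelZ φ) ν → ν = μ)
    (hU : IsClopen U) (h0 : (μ.prod Measure.count) U ≠ 0) (Φ : X ≃ₜ U)
    (hΦ : ∀ x y, (x, y) ∈ orbitRelZ φ ↔ (Φ x, Φ y) ∈ restrictRel (finProdRel (orbitRelZ φ) n) U)
    {V : Set X} (hV : MeasurableSet V) :
    (μ.prod Measure.count) (Subtype.val '' (Φ '' V)) = (μ.prod Measure.count) U * μ V := by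
  set ρ := μ.prod (Measure.count : Measure (Fin n)) with hρ
  have hUm : MeasurableSet U := hU.isOpen.measurableSet
  have htop : ρ U ≠ ∞ := measure_ne_top _ _
  let ν : Measure X := (ρ U)⁻¹ • Measure.map Φ.symm (Measure.comap Subtype.val ρ)
  have hν : ∀ W : Set X, MeasurableSet W → ν W = (ρ U)⁻¹ * ρ (Subtype.val '' (Φ '' W)) := by
    intro W hW
    rw [Measure.smul_apply, smul_eq_mul, Measure.map_apply Φ.symm.continuous.measurable hW,
      comap_subtype_coe_apply hUm, ← Φ.image_eq_preimage_symm]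
  have hprob : IsProbabilityMeasure ν := by
    constructor
    rw [hν _ MeasurableSet.univ, Set.image_univ, Φ.surjective.range_eq, Set.image_univ,
      Subtype.range_coe, ENNReal.inv_mul_cancel h0 htop]
  have hinv : Measure.map φ ν = ν := by
    refine Measure.ext fun W hW => ?_
    rw [Measure.map_apply φ.continuous.measurable hW, hν _ hW,
      hν _ (φ.continuous.measurable hW)]
    congr 1
    have h1 := prod_count_image_preimage hμ hU ((Φ.symm.trans φ).trans Φ)
      (fun u => by
        have := (hΦ (Φ.symm u) (φ (Φ.symm u))).1 ⟨1, by simp⟩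
        rwa [Φ.apply_symm_apply] at this)
      (A := Φ '' W) (Φ.toMeasurableEquiv.measurableSet_image.2 hW)
    rw [← h1]
    congr 2
    ext u
    simp only [Set.mem_image, Set.mem_preimage, Homeomorph.trans_apply]
    constructor
    · rintro ⟨x, hx, rfl⟩
      exact ⟨φ x, hx, by simp⟩
    · rintro ⟨y, hy, hyu⟩
      exact ⟨Φ.symm u, by rwa [← Φ.injective hyu], by simp⟩
  rw [← huniq ν hprob (isInvariantMeasure_of_map_eq hinv), hν _ hV, ← mul_assoc,
    ENNReal.mul_inv_cancel h0 htop, one_mul]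

end RestrictedSystem

section FundGroup

variable {X : Type*} [TopologicalSpace X] [CompactSpace X] [TopologicalSpace.MetrizableSpace X]
  [TotallyDisconnectedSpace X] [Nonempty X] [MeasurableSpace X] [BorelSpace X]
  {φ : X ≃ₜ X} {μ : Measure X} [IsProbabilityMeasure μ]

lemma measure_mem_clopenValueGroup {X : Type*} [TopologicalSpace X] [MeasurableSpace X]
    (μ : Measure X) {V : Set X} (hV : IsClopen V) : (μ V).toReal ∈ clopenValueGroup μ :=
  AddSubgroup.subset_closure ⟨V, hV, rfl⟩

lemma mul_mem_clopenValueGroup {X : Type*} [TopologicalSpace X] [MeasurableSpace X]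
    {μ : Measure X} {r : ℝ} (h : ∀ V : Set X, IsClopen V → r * (μ V).toReal ∈ clopenValueGroup μ)
    {x : ℝ} (hx : x ∈ clopenValueGroup μ) : r * x ∈ clopenValueGroup μ := by
  have : clopenValueGroup μ ≤ (clopenValueGroup μ).comap (AddMonoidHom.mulLeft r) :=
    (AddSubgroup.closure_le _).2 (by rintro _ ⟨V, hV, rfl⟩; exact h V hV)
  exact this hx

lemma exists_clopen_induction {X : Type*} [TopologicalSpace X] [CompactSpace X]
    {P : Set X → Prop} (h0 : P ∅) (hdisj : ∀ A B, IsClopen A → IsClopen B → Disjoint A B → P A →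
      P B → P (A ∪ B))
    (hloc : ∀ x : X, ∃ A, IsClopen A ∧ x ∈ A ∧ ∀ B ⊆ A, IsClopen B → P B) {V : Set X}
    (hV : IsClopen V) : P V := by
  have : ∃ A, IsClopen A ∧ Set.univ ⊆ A ∧ ∀ B ⊆ A, IsClopen B → P B := by
    refine isCompact_univ.induction_on (p := fun s => ∃ A, IsClopen A ∧ s ⊆ A ∧
      ∀ B ⊆ A, IsClopen B → P B) ?_ ?_ ?_ ?_
    · exact ⟨∅, isClopen_empty, subset_rfl, fun B hB _ => by rwa [Set.subset_empty_iff.1 hB]⟩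
    · rintro s t hst ⟨A, hA, htA, h⟩
      exact ⟨A, hA, hst.trans htA, h⟩
    · rintro s t ⟨A, hA, hsA, hPA⟩ ⟨B, hB, htB, hPB⟩
      refine ⟨A ∪ B, hA.union hB, Set.union_subset_union hsA htB, fun C hC hC' => ?_⟩
      rw [← Set.inter_union_sdiff C A]
      exact hdisj _ _ (hC'.inter hA) (hC'.diff hA) Set.disjoint_sdiff_inter.symm
        (hPA _ Set.inter_subset_right (hC'.inter hA))
        (hPB _ (fun x hx => (hC hx.1).resolve_left hx.2) (hC'.diff hA))
    · intro x _
      obtain ⟨A, hA, hx, h⟩ := hloc x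
      exact ⟨A, mem_nhdsWithin_of_mem_nhds (hA.isOpen.mem_nhds hx), A, hA, subset_rfl, h⟩
  obtain ⟨A, -, hA, h⟩ := this
  exact h V ((Set.subset_univ V).trans hA) hV

lemma mul_mem_of_mem_fundGroup (hfree : IsFreeZ φ) (hmin : IsMinimalRel (orbitRelZ φ))
    (hμ : Measure.map φ μ = μ)
    (huniq : ∀ ν : Measure X, IsProbabilityMeasure ν → IsInvariantMeasure (orbitRelZ φ) ν → ν = μ)
    {r : ℝ} (hr : r ∈ fundGroup (orbitRelZ φ) μ) :
    0 < r ∧ (∀ x ∈ clopenValueGroup μ, r * x ∈ clopenValueGroup μ) ∧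
      ∀ x ∈ clopenValueGroup μ, r⁻¹ * x ∈ clopenValueGroup μ := by
  obtain ⟨n, U, hU, ⟨Φ, hΦ⟩, rfl⟩ := hr
  obtain ⟨F, rfl⟩ := exists_towerFrame hfree hmin
  set ρ := μ.prod (Measure.count : Measure (Fin n)) with hρ
  have hslice : ∀ {W : Set (X × Fin n)}, IsClopen W → ∀ i, IsClopen {x | (x, i) ∈ W} :=
    fun hW i => hW.preimage (continuous_id.prodMk continuous_const)
  obtain ⟨⟨⟨y, i⟩, hyi⟩⟩ : Nonempty U := ⟨Φ (Classical.arbitrary X)⟩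
  have hpos : 0 < ρ U := by
    rw [hρ, prod_count_apply μ hU.isOpen.measurableSet]
    exact (F.measure_pos_of_isClopen hμ (hslice hU i).isOpen ⟨y, hyi⟩).trans_le
      (Finset.single_le_sum (f := fun i => μ {x | (x, i) ∈ U}) (fun _ _ => zero_le)
        (Finset.mem_univ i))
  have hr0 : 0 < (ρ U).toReal := ENNReal.toReal_pos hpos.ne' (measure_ne_top _ _)
  have himg : ∀ {V : Set X}, IsClopen V →
      (ρ (Subtype.val '' (Φ '' V))).toReal = (ρ U).toReal * (μ V).toReal := fun {V} hV => by
    rw [hρ, prod_count_image_eq hμ huniq hU hpos.ne' Φ hΦ hV.isOpen.measurableSet,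
      ENNReal.toReal_mul]
  refine ⟨hr0, fun x hx => mul_mem_clopenValueGroup (fun V hV => ?_) hx,
    fun x hx => mul_mem_clopenValueGroup (fun V hV => ?_) hx⟩
  · have hW : IsClopen (Subtype.val '' (Φ '' V) : Set (X × Fin n)) := by
      have h1 : IsClopen (Φ '' V) := ⟨Φ.isClosed_image.2 hV.isClosed, Φ.isOpen_image.2 hV.isOpen⟩
      exact ⟨hU.isClosed.isClosedEmbedding_subtypeVal.isClosedMap _ h1.isClosed,
        hU.isOpen.isOpenEmbedding_subtypeVal.isOpenMap _ h1.isOpen⟩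
    rw [← himg hV, hρ, prod_count_apply μ hW.isOpen.measurableSet,
      ENNReal.toReal_sum fun _ _ => measure_ne_top _ _]
    exact sum_mem fun i _ => measure_mem_clopenValueGroup μ (hslice hW i)
  · refine exists_clopen_induction (P := fun V => (ρ U).toReal⁻¹ * (μ V).toReal ∈
      clopenValueGroup μ) (by simp) (fun A B hA hB hAB h1 h2 => ?_) (fun x => ?_) hV
    · rw [measure_union hAB hB.isOpen.measurableSet,
        ENNReal.toReal_add (measure_ne_top _ _) (measure_ne_top _ _), mul_add]
      exact add_mem h1 h2
    · obtain ⟨z, hz, k, hk⟩ := (hmin x).inter_open_nonempty _ (hslice hU i).isOpen ⟨y, hyi⟩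
      change (F.φ ^ k) x = z at hk
      subst hk
      refine ⟨(F.φ ^ k) ⁻¹' {x | (x, i) ∈ U}, (hslice hU i).preimage (F.φ ^ k).continuous, hz,
        fun B hB hBc => ?_⟩
      have hUB : ∀ b ∈ B, ((F.φ ^ k) b, i) ∈ U := fun b hb => hB hb
      let W : Set X := Φ ⁻¹' {u | u.1.2 = i ∧ (F.φ ^ k).symm u.1.1 ∈ B}
      have hWc : IsClopen W := by
        refine IsClopen.preimage (IsClopen.inter ?_ ?_) Φ.continuous
        · exact (isClopen_discrete {i}).preimage (continuous_snd.comp continuous_subtype_val)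
        · exact hBc.preimage ((F.φ ^ k).symm.continuous.comp
            (continuous_fst.comp continuous_subtype_val))
      have hW : Subtype.val '' (Φ '' W) = ((F.φ ^ k) '' B) ×ˢ {i} := by
        rw [Φ.image_preimage]
        ext ⟨x, j⟩
        constructor
        · rintro ⟨u, ⟨h1, h2⟩, h3⟩
          rw [h3] at h1 h2
          exact ⟨⟨_, h2, by simp⟩, h1⟩
        · rintro ⟨⟨b, hb, hbx⟩, hj⟩
          obtain rfl : j = i := hj
          obtain rfl : (F.φ ^ k) b = x := hbx
          exact ⟨⟨_, hUB b hb⟩, ⟨rfl, by simpa using hb⟩, rfl⟩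
      have h2 := himg hWc
      rw [hW, hρ, Measure.prod_prod, Measure.count_singleton, mul_one,
        ← (measurePreserving_zpow hμ k).measure_preimage_emb
          (F.φ ^ k).measurableEmbedding, Set.preimage_image_eq _ (F.φ ^ k).injective] at h2
      rw [h2, ← mul_assoc, inv_mul_cancel₀ hr0.ne', one_mul]
      exact measure_mem_clopenValueGroup μ hWc

end FundGroup

/-- The positive reals whose multiplication action preserves the additive group `E`. -/
def unitMultipliers (E : AddSubgroup ℝ) : Set ℝ :=
  {r | 0 < r ∧ (∀ x ∈ E, r * x ∈ E) ∧ ∀ x ∈ E, r⁻¹ * x ∈ E}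

lemma mul_mem_unitMultipliers {E : AddSubgroup ℝ} {r s : ℝ} (hr : r ∈ unitMultipliers E)
    (hs : s ∈ unitMultipliers E) : r * s ∈ unitMultipliers E :=
  ⟨mul_pos hr.1 hs.1, fun x hx => by rw [mul_assoc]; exact hr.2.1 _ (hs.2.1 _ hx),
    fun x hx => by rw [mul_inv, mul_assoc]; exact hr.2.2 _ (hs.2.2 _ hx)⟩

lemma inv_mem_unitMultipliers {E : AddSubgroup ℝ} {r : ℝ} (hr : r ∈ unitMultipliers E) :
    r⁻¹ ∈ unitMultipliers E :=
  ⟨inv_pos.2 hr.1, hr.2.2, by rw [inv_inv]; exact hr.2.1⟩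

lemma zpow_mem_unitMultipliers {E : AddSubgroup ℝ} {r : ℝ} (hr : r ∈ unitMultipliers E) (n : ℤ) :
    r ^ n ∈ unitMultipliers E := by
  have hp : ∀ n : ℕ, r ^ n ∈ unitMultipliers E := fun n => by
    induction n with
    | zero => exact ⟨by simp, by simp, by simp⟩
    | succ n ih => rw [pow_succ]; exact mul_mem_unitMultipliers ih hr
  obtain ⟨m, rfl | rfl⟩ := Int.eq_nat_or_neg n
  · simpa using hp m
  · simpa using inv_mem_unitMultipliers (hp m)

lemma Irrational.intCast_add_mul_inj {s : ℝ} (hs : Irrational s) {p q p' q' : ℤ}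
    (h : (p : ℝ) + q * s = p' + q' * s) : p = p' ∧ q = q' := by
  have hq : q = q' := by
    by_contra hne
    refine hs ⟨((p' - p : ℤ) : ℚ) / ((q - q' : ℤ) : ℚ), ?_⟩
    have : (q : ℝ) - q' ≠ 0 := sub_ne_zero.2 (by exact_mod_cast hne)
    push_cast
    rw [div_eq_iff this]
    linarith
  subst hq
  exact ⟨by exact_mod_cast add_right_cancel h, rfl⟩

section Quadratic

variable {θ s : ℝ} {a b c D t u : ℤ}

/-- Solutions `(t, u)` of one of the equations `t² - D u² = ±4`. -/
def IsPellPair (D t u : ℤ) : Prop :=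
  t ^ 2 - D * u ^ 2 = 4 ∨ t ^ 2 - D * u ^ 2 = -4

lemma IsPellPair.neg_right (h : IsPellPair D t u) : IsPellPair D t (-u) := by
  simpa [IsPellPair] using h

lemma IsPellPair.neg_left (h : IsPellPair D t u) : IsPellPair D (-t) u := by
  simpa [IsPellPair] using h

lemma IsPellPair.exists_inv (h : IsPellPair D t u) (hs : s ^ 2 = D) :
    ∃ t' u' : ℤ, IsPellPair D t' u' ∧ (((t : ℝ) + u * s) / 2)⁻¹ = ((t' : ℝ) + u' * s) / 2 := by
  rcases id h with h1 | h1
  · refine ⟨t, -u, h.neg_right, inv_eq_of_mul_eq_one_right ?_⟩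
    have : (t : ℝ) ^ 2 - D * u ^ 2 = 4 := by exact_mod_cast h1
    push_cast
    linear_combination this / 4 - u ^ 2 * hs / 4
  · refine ⟨-t, u, h.neg_left, inv_eq_of_mul_eq_one_right ?_⟩
    have : (t : ℝ) ^ 2 - D * u ^ 2 = -4 := by exact_mod_cast h1
    push_cast
    linear_combination - this / 4 + u ^ 2 * hs / 4

lemma IsPellPair.pos_of_one_lt (h : IsPellPair D t u) (hs : s ^ 2 = D) (hs0 : 0 < s)
    (h1 : 1 < ((t : ℝ) + u * s) / 2) : 0 < t ∧ 0 < u := by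
  have hn : |((t : ℝ) + u * s) / 2| * |((t : ℝ) - u * s) / 2| = 1 := by
    rw [← abs_mul]
    rcases h with h | h
    · have : (t : ℝ) ^ 2 - D * u ^ 2 = 4 := by exact_mod_cast h
      rw [show ((t : ℝ) + u * s) / 2 * ((t - u * s) / 2) = 1 by
        linear_combination this / 4 - u ^ 2 * hs / 4, abs_one]
    · have : (t : ℝ) ^ 2 - D * u ^ 2 = -4 := by exact_mod_cast h
      rw [show ((t : ℝ) + u * s) / 2 * ((t - u * s) / 2) = -1 by
        linear_combination this / 4 - u ^ 2 * hs / 4, abs_neg, abs_one]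
  rw [abs_of_pos (by linarith)] at hn
  have h2 : |((t : ℝ) - u * s) / 2| < 1 := by
    by_contra! h3
    nlinarith
  obtain ⟨h3, h4⟩ := abs_lt.1 h2
  have ht : (0 : ℝ) < t := by linarith
  have hu : (0 : ℝ) < u := pos_of_mul_pos_left (by linarith : 0 < (u : ℝ) * s) hs0.le
  exact ⟨by exact_mod_cast ht, by exact_mod_cast hu⟩

lemma exists_least_pell (hD : 0 < D) (hsq : ¬ IsSquare D) (hs0 : 0 < s) :
    ∃ t u : ℤ, 0 < t ∧ 0 < u ∧ IsPellPair D t u ∧ ∀ t' u' : ℤ, 0 < t' → 0 < u' →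
      IsPellPair D t' u' → ((t : ℝ) + u * s) / 2 ≤ (t' + u' * s) / 2 := by
  obtain ⟨x, y, hxy, hy⟩ := Pell.exists_of_not_isSquare hD hsq
  have hx : x ≠ 0 := by
    rintro rfl
    nlinarith [mul_nonneg hD.le (sq_nonneg y)]
  have hp : IsPellPair D (2 * |x|) (2 * |y|) :=
    Or.inl (by rw [mul_pow, mul_pow, sq_abs, sq_abs]; linear_combination 4 * hxy)
  set v : ℤ × ℤ → ℝ := fun q => ((q.1 : ℝ) + q.2 * s) / 2 with hv
  set S : Set (ℤ × ℤ) := {q | 0 < q.1 ∧ 0 < q.2 ∧ IsPellPair D q.1 q.2 ∧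
    v q ≤ v (2 * |x|, 2 * |y|)} with hS
  have hfin : S.Finite := by
    set B := v (2 * |x|, 2 * |y|)
    refine ((Set.finite_Icc 0 ⌊2 * B⌋).prod (Set.finite_Icc 0 ⌊2 * B / s⌋)).subset ?_
    rintro ⟨t, u⟩ ⟨ht, hu, -, hB⟩
    have hB' : (t : ℝ) + u * s ≤ 2 * B := by
      have : ((t : ℝ) + u * s) / 2 ≤ B := hB
      linarith
    have ht' : (0 : ℝ) < t := by exact_mod_cast ht
    have hu' : (0 : ℝ) < u := by exact_mod_cast hu
    have := mul_pos hu' hs0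
    exact ⟨⟨ht.le, Int.le_floor.2 (by linarith)⟩, ⟨hu.le, Int.le_floor.2
      ((le_div_iff₀ hs0).2 (by linarith))⟩⟩
  have hmem : (2 * |x|, 2 * |y|) ∈ S := ⟨by positivity, by positivity, hp, le_rfl⟩
  obtain ⟨⟨t, u⟩, ⟨ht, hu, htu, hle⟩, hmin⟩ := Set.exists_min_image S v hfin ⟨_, hmem⟩
  refine ⟨t, u, ht, hu, htu, fun t' u' ht' hu' htu' => ?_⟩
  rcases le_total (v (t', u')) (v (2 * |x|, 2 * |y|)) with h | h
  · exact hmin (t', u') ⟨ht', hu', htu', h⟩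
  · exact hle.trans h

lemma mul_mem_closure_of_pell (hroot : (a : ℝ) * θ ^ 2 + b * θ + c = 0)
    (hD : D = b ^ 2 - 4 * a * c) (hs : s = 2 * a * θ + b) (h : IsPellPair D t u) {x : ℝ}
    (hx : x ∈ AddSubgroup.closure {1, θ}) :
    ((t : ℝ) + u * s) / 2 * x ∈ AddSubgroup.closure {1, θ} := by
  have hpar : (2 : ℤ) ∣ t + u * b := by
    have h4 : (2 : ℤ) ∣ t ^ 2 - (u * b) ^ 2 := by
      subst hD
      rcases h with h | h
      · exact ⟨2 - 2 * a * c * u ^ 2, by linear_combination h⟩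
      · exact ⟨-2 - 2 * a * c * u ^ 2, by linear_combination h⟩
    have h5 : Even (t ^ 2 - (u * b) ^ 2) := even_iff_two_dvd.2 h4
    rw [← even_iff_two_dvd, Int.even_add]
    rwa [Int.even_sub, Int.even_pow' two_ne_zero, Int.even_pow' two_ne_zero] at h5
  obtain ⟨p, hp⟩ := hpar
  have hp' : (t : ℝ) + u * b = 2 * p := by exact_mod_cast hp
  obtain ⟨m, k, rfl⟩ := AddSubgroup.mem_closure_pair.1 hx
  refine AddSubgroup.mem_closure_pair.2 ⟨m * p - k * u * c, m * u * a + k * (p - u * b), ?_⟩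
  simp only [zsmul_eq_mul, hs]
  push_cast
  linear_combination (-(m : ℝ) / 2 - k * θ / 2) * hp' - k * u * hroot

lemma exists_norm_of_mul_mem (hgcd : Int.gcd (Int.gcd a b) c = 1)
    (hroot : (a : ℝ) * θ ^ 2 + b * θ + c = 0) (hθ : Irrational θ)
    (hD : D = b ^ 2 - 4 * a * c) (hs : s = 2 * a * θ + b) {r : ℝ}
    (h : ∀ x ∈ AddSubgroup.closure {1, θ}, r * x ∈ AddSubgroup.closure {1, θ}) :
    ∃ t u N : ℤ, r = ((t : ℝ) + u * s) / 2 ∧ t ^ 2 - D * u ^ 2 = 4 * N := by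
  obtain ⟨p, q, hpq⟩ := AddSubgroup.mem_closure_pair.1
    (h 1 (AddSubgroup.subset_closure (by simp)))
  obtain ⟨m, k, hmk⟩ := AddSubgroup.mem_closure_pair.1
    (h θ (AddSubgroup.subset_closure (by simp)))
  simp only [zsmul_eq_mul, mul_one] at hpq hmk
  have hlin : ((-(q * c) : ℤ) : ℝ) + ((-(q * b) : ℤ) : ℝ) * θ =
      ((a * m : ℤ) : ℝ) + ((a * (k - p) : ℤ) : ℝ) * θ := by
    push_cast
    linear_combination (-(a : ℝ)) * hmk - q * hroot + a * θ * hpq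
  obtain ⟨h1, h2⟩ := hθ.intCast_add_mul_inj hlin
  have hqa : a ∣ q * Int.gcd (Int.gcd a b) c := by
    obtain ⟨x1, x2, h12⟩ : ∃ x y, (Int.gcd a b : ℤ) = a * x + b * y :=
      ⟨_, _, Int.gcd_eq_gcd_ab a b⟩
    obtain ⟨x3, x4, h34⟩ : ∃ x y, (Int.gcd (Int.gcd a b) c : ℤ) = Int.gcd a b * x + c * y :=
      ⟨_, _, Int.gcd_eq_gcd_ab _ c⟩
    have e1 : a ∣ q * a := dvd_mul_left _ _
    have e2 : a ∣ q * b := (dvd_neg.1 ⟨_, h2⟩)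
    have e3 : a ∣ q * c := (dvd_neg.1 ⟨_, h1⟩)
    rw [h34, h12, show q * ((a * x1 + b * x2) * x3 + c * x4) =
      q * a * (x1 * x3) + q * b * (x2 * x3) + q * c * x4 by ring]
    exact ((e1.mul_right _).add (e2.mul_right _)).add (e3.mul_right _)
  rw [hgcd, Nat.cast_one, mul_one] at hqa
  obtain ⟨v, rfl⟩ := hqa
  refine ⟨2 * p - v * b, v, p ^ 2 - p * v * b + v ^ 2 * a * c, ?_, ?_⟩
  · rw [← hpq, hs]
    push_cast
    ring
  · rw [hD]; ring

lemma exists_pell_of_mem_unitMultipliers (hgcd : Int.gcd (Int.gcd a b) c = 1)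
    (hroot : (a : ℝ) * θ ^ 2 + b * θ + c = 0) (hθ : Irrational θ) (hsi : Irrational s)
    (hD : D = b ^ 2 - 4 * a * c) (hs : s = 2 * a * θ + b) {r : ℝ}
    (h : r ∈ unitMultipliers (AddSubgroup.closure {1, θ})) :
    ∃ t u : ℤ, IsPellPair D t u ∧ r = ((t : ℝ) + u * s) / 2 := by
  have hs2 : s ^ 2 = D := by
    rw [hs, hD]; push_cast; linear_combination 4 * a * hroot
  obtain ⟨t, u, N, hr, hN⟩ := exists_norm_of_mul_mem hgcd hroot hθ hD hs h.2.1
  obtain ⟨t', u', N', hr', hN'⟩ := exists_norm_of_mul_mem hgcd hroot hθ hD hs h.2.2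
  have h1 := mul_inv_cancel₀ h.1.ne'
  rw [hr', hr] at h1
  have h2 : ((t * t' + D * u * u' : ℤ) : ℝ) + ((t * u' + u * t' : ℤ) : ℝ) * s =
      ((4 : ℤ) : ℝ) + ((0 : ℤ) : ℝ) * s := by
    push_cast
    linear_combination 4 * h1 - u * u' * hs2
  obtain ⟨h3, h4⟩ := hsi.intCast_add_mul_inj h2
  have h5 : N * N' = 1 := by
    have : 16 * (N * N') = 16 := by
      linear_combination (-4 * N') * hN - (t ^ 2 - D * u ^ 2) * hN' +
        (t * t' + D * u * u' + 4) * h3 - D * (t * u' + u * t') * h4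
    linarith
  refine ⟨t, u, ?_, hr⟩
  rcases Int.eq_one_or_neg_one_of_mul_eq_one h5 with rfl | rfl
  · exact Or.inl hN
  · exact Or.inr hN

lemma mem_unitMultipliers_of_pell (hroot : (a : ℝ) * θ ^ 2 + b * θ + c = 0)
    (hD : D = b ^ 2 - 4 * a * c) (hs : s = 2 * a * θ + b) (h : IsPellPair D t u)
    (h0 : 0 < ((t : ℝ) + u * s) / 2) :
    ((t : ℝ) + u * s) / 2 ∈ unitMultipliers (AddSubgroup.closure {1, θ}) := by
  refine ⟨h0, fun x hx => mul_mem_closure_of_pell hroot hD hs h hx, fun x hx => ?_⟩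
  have hs2 : s ^ 2 = D := by
    rw [hs, hD]; push_cast; linear_combination 4 * a * hroot
  obtain ⟨t', u', h', e⟩ := h.exists_inv hs2
  rw [e]
  exact mul_mem_closure_of_pell hroot hD hs h' hx

lemma mem_unitMultipliers_iff (hgcd : Int.gcd (Int.gcd a b) c = 1)
    (hroot : (a : ℝ) * θ ^ 2 + b * θ + c = 0) (hD : D = b ^ 2 - 4 * a * c) (hsi : Irrational s)
    (hs : s ^ 2 = D) {r : ℝ} :
    r ∈ unitMultipliers (AddSubgroup.closure {1, θ}) ↔
      0 < r ∧ ∃ t u : ℤ, IsPellPair D t u ∧ r = ((t : ℝ) + u * s) / 2 := by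
  have key : ∀ s' : ℝ, Irrational s' → s' = 2 * a * θ + b →
      (r ∈ unitMultipliers (AddSubgroup.closure {1, θ}) ↔
        0 < r ∧ ∃ t u : ℤ, IsPellPair D t u ∧ r = ((t : ℝ) + u * s') / 2) := by
    intro s' hsi' hs'
    have hθ : Irrational θ := by
      rintro ⟨q, rfl⟩
      exact hsi' ⟨2 * a * q + b, by rw [hs']; push_cast; rfl⟩
    refine ⟨fun h => ⟨h.1, exists_pell_of_mem_unitMultipliers hgcd hroot hθ hsi' hD hs' h⟩, ?_⟩
    rintro ⟨h0, t, u, h, rfl⟩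
    exact mem_unitMultipliers_of_pell hroot hD hs' h h0
  have hsq : s ^ 2 = (2 * a * θ + b) ^ 2 := by
    rw [hs, hD]; push_cast; linear_combination -4 * a * hroot
  rcases sq_eq_sq_iff_eq_or_eq_neg.1 hsq with h | h
  · exact key s hsi h
  · rw [key (-s) hsi.neg (by rw [h, neg_neg])]
    refine and_congr_right fun _ => ⟨?_, ?_⟩
    · rintro ⟨t, u, htu, rfl⟩
      exact ⟨t, -u, htu.neg_right, by push_cast; ring⟩
    · rintro ⟨t, u, htu, rfl⟩
      exact ⟨t, -u, htu.neg_right, by push_cast; ring⟩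

end Quadratic

lemma fundGroup_eq_unitMultipliers {X : Type*} [TopologicalSpace X] [CompactSpace X]
    [TopologicalSpace.MetrizableSpace X] [TotallyDisconnectedSpace X] [Nonempty X]
    [MeasurableSpace X] [BorelSpace X] {φ : X ≃ₜ X} (hfree : IsFreeZ φ)
    (hmin : IsMinimalRel (orbitRelZ φ)) {μ : Measure X} [IsProbabilityMeasure μ]
    (hinv : IsInvariantMeasure (orbitRelZ φ) μ)
    (huniq : ∀ ν : Measure X, IsProbabilityMeasure ν → IsInvariantMeasure (orbitRelZ φ) ν → ν = μ)
    (hfg : (clopenValueGroup μ).FG) :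
    fundGroup (orbitRelZ φ) μ = unitMultipliers (clopenValueGroup μ) := by
  have hμ : Measure.map φ μ = μ := hinv φ fun x => ⟨1, by simp⟩
  obtain ⟨F, rfl⟩ := exists_towerFrame hfree hmin
  refine Set.Subset.antisymm (fun r hr => mul_mem_of_mem_fundGroup hfree hmin hμ huniq hr) ?_
  exact fun r hr => TowerFrame.mem_fundGroup hμ huniq hfg hr.1 hr.2.1 hr.2.2

/-- If `θ` is a quadratic irrational with discriminant `D_θ = b² − 4ac > 0`
not a perfect square, any uniquely ergodic Cantor minimal `ℤ`-system whose unique invariant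
measure satisfies `E_μ = ℤ + ℤθ` has fundamental group `{ε₀^n : n ∈ ℤ}`, where
`ε₀ = (t + u√D_θ)/2 > 1` is least with `t, u` positive integers solving `t² − D_θ u² = ±4`. -/
theorem statement15 (θ : ℝ) (a b c : ℤ) (ha : 0 < a) (hgcd : Int.gcd (Int.gcd a b) c = 1)
    (hroot : (a : ℝ) * θ ^ 2 + (b : ℝ) * θ + (c : ℝ) = 0)
    (hD : 0 < b ^ 2 - 4 * a * c) (hnsq : ¬ ∃ d : ℤ, d ^ 2 = b ^ 2 - 4 * a * c)
    {X : Type*} [TopologicalSpace X] [CompactSpace X]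
    [TopologicalSpace.MetrizableSpace X] [TotallyDisconnectedSpace X] [Nonempty X]
    [MeasurableSpace X] [BorelSpace X]
    (hperf : Perfect (Set.univ : Set X))
    (φ : X ≃ₜ X) (hfree : IsFreeZ φ) (hmin : IsMinimalRel (orbitRelZ φ))
    (μ : Measure X) [IsProbabilityMeasure μ] (hinv : IsInvariantMeasure (orbitRelZ φ) μ)
    (huniq : ∀ ν : Measure X, IsProbabilityMeasure ν → IsInvariantMeasure (orbitRelZ φ) ν → ν = μ)
    (hE : clopenValueGroup μ = AddSubgroup.closure {1, θ}) :
    ∃ ε₀ : ℝ,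
      (∃ t u : ℤ, 0 < t ∧ 0 < u ∧
        (t ^ 2 - (b ^ 2 - 4 * a * c) * u ^ 2 = 4 ∨
          t ^ 2 - (b ^ 2 - 4 * a * c) * u ^ 2 = -4) ∧
        ε₀ = ((t : ℝ) + (u : ℝ) * Real.sqrt ((b : ℝ) ^ 2 - 4 * (a : ℝ) * (c : ℝ))) / 2) ∧
      1 < ε₀ ∧
      (∀ x : ℝ, (∃ t u : ℤ, 0 < t ∧ 0 < u ∧
        (t ^ 2 - (b ^ 2 - 4 * a * c) * u ^ 2 = 4 ∨
          t ^ 2 - (b ^ 2 - 4 * a * c) * u ^ 2 = -4) ∧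
        x = ((t : ℝ) + (u : ℝ) * Real.sqrt ((b : ℝ) ^ 2 - 4 * (a : ℝ) * (c : ℝ))) / 2) →
        1 < x → ε₀ ≤ x) ∧
      fundGroup (orbitRelZ φ) μ = {x : ℝ | ∃ n : ℤ, x = ε₀ ^ n} := by
  set D : ℤ := b ^ 2 - 4 * a * c with hDdef
  have hcast : (b : ℝ) ^ 2 - 4 * (a : ℝ) * (c : ℝ) = (D : ℝ) := by rw [hDdef]; push_cast; ring
  rw [hcast]
  have hsq : ¬ IsSquare D := by
    rintro ⟨d, hd⟩
    exact hnsq ⟨d, by rw [hd, sq]⟩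
  set s := Real.sqrt (D : ℝ) with hs
  have hsi : Irrational s := (irrational_sqrt_intCast_iff_of_nonneg hD.le).2 hsq
  have hs2 : s ^ 2 = D := Real.sq_sqrt (by exact_mod_cast hD.le)
  have hs1 : 1 < s := by
    have : D ≠ 1 := fun h => hsq (h ▸ IsSquare.one)
    exact Real.lt_sqrt_of_sq_lt (by rw [one_pow]; exact_mod_cast (by omega : 1 < D))
  have hs0 : 0 < s := one_pos.trans hs1
  have hfg : (clopenValueGroup μ).FG := by
    rw [hE]
    exact ⟨{1, θ}, by push_cast; rfl⟩
  have hmem : ∀ {r : ℝ}, r ∈ unitMultipliers (AddSubgroup.closure {1, θ}) ↔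
      0 < r ∧ ∃ t u : ℤ, IsPellPair D t u ∧ r = ((t : ℝ) + u * s) / 2 :=
    mem_unitMultipliers_iff hgcd hroot hDdef hsi hs2
  obtain ⟨t, u, ht, hu, htu, hleast⟩ := exists_least_pell hD hsq hs0
  have h1 : 1 < ((t : ℝ) + u * s) / 2 := by
    have ht1 : (1 : ℝ) ≤ t := by exact_mod_cast ht
    have hu1 : (1 : ℝ) ≤ u := by exact_mod_cast hu
    nlinarith
  refine ⟨((t : ℝ) + u * s) / 2, ⟨t, u, ht, hu, htu, rfl⟩, h1, ?_, ?_⟩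
  · rintro _ ⟨t₁, u₁, ht₁, hu₁, htu₁, rfl⟩ -
    exact hleast t₁ u₁ ht₁ hu₁ htu₁
  rw [fundGroup_eq_unitMultipliers hfree hmin hinv huniq hfg, hE]
  set ε := ((t : ℝ) + u * s) / 2 with hε
  have hε0 : 0 < ε := one_pos.trans h1
  have hεmem : ε ∈ unitMultipliers (AddSubgroup.closure {1, θ}) := hmem.2 ⟨hε0, t, u, htu, rfl⟩
  ext r
  constructor
  · intro hr
    obtain ⟨n, hn1, hn2⟩ := exists_mem_Ico_zpow hr.1 h1
    have hpos : 0 < ε ^ n := zpow_pos hε0 n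
    have hq : r * (ε ^ n)⁻¹ ∈ unitMultipliers (AddSubgroup.closure {1, θ}) :=
      mul_mem_unitMultipliers hr (inv_mem_unitMultipliers (zpow_mem_unitMultipliers hεmem n))
    obtain ⟨-, t₁, u₁, htu₁, he⟩ := hmem.1 hq
    refine ⟨n, hn1.antisymm' (not_lt.1 fun hlt => ?_)⟩
    have hgt : 1 < r * (ε ^ n)⁻¹ := by rwa [← div_eq_mul_inv, one_lt_div hpos]
    rw [he] at hgt
    obtain ⟨ht₁, hu₁⟩ := htu₁.pos_of_one_lt hs2 hs0 hgt
    have hle := hleast t₁ u₁ ht₁ hu₁ htu₁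
    rw [← he, ← div_eq_mul_inv, le_div_iff₀ hpos, ← zpow_one_add₀ hε0.ne', add_comm] at hle
    exact hn2.not_ge hle
  · rintro ⟨n, rfl⟩
    exact zpow_mem_unitMultipliers hεmem n
end

section
/- Let p be a prime and let ℤ act freely on the compact topological ring ℤ_p of p-adic integers by n·x = x + n. Then the resulting system R_{ℤ,φ} is a uniquely ergodic Cantor minimal ℤ-system, with unique invariant probability measure the normalized Haar measure μ on ℤ_p, the additive subgroup of ℝ generated by {μ(V) : V clopen in ℤ_p} equals ℤ[1/p], and F(R_{ℤ,φ}) = {p^n : n ∈ ℤ}. -/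
open MeasureTheory
open scoped ENNReal

/-- The orbit relation of the translation action `n·x = x + n` of `ℤ` on `ℤ_p`. -/
def padicTranslationRel (p : ℕ) [Fact p.Prime] : Set (ℤ_[p] × ℤ_[p]) :=
  {q | ∃ n : ℤ, q.2 = q.1 + (n : ℤ_[p])}

section

variable {X Y : Type*} [MeasurableSpace X] [MeasurableSpace Y]

/-- If two measurable embeddings differ pointwise by elements of a countable family of
measure-preserving transformations, then they pull the measure back to the same measure. -/
theorem comap_eq_comap_of_forall_exists {ι : Type*} [Countable ι] {ρ : Measure Y}
    (T : ι → Y ≃ᵐ Y) (hT : ∀ k, MeasurePreserving (T k) ρ ρ) {f g : X → Y}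
    (hf : MeasurableEmbedding f) (hg : MeasurableEmbedding g)
    (h : ∀ x, ∃ k, g x = T k (f x)) : Measure.comap f ρ = Measure.comap g ρ := by
  have hcover : ⋃ k, {x | g x = T k (f x)} = Set.univ := by
    ext x
    simpa using h x
  rw [Measure.ext_iff_of_iUnion_eq_univ hcover]
  intro k
  ext A hA
  rw [Measure.restrict_apply hA, Measure.restrict_apply hA, hf.comap_apply, hg.comap_apply]
  have : g '' (A ∩ {x | g x = T k (f x)}) = T k '' (f '' (A ∩ {x | g x = T k (f x)})) := by
    rw [Set.image_image]
    exact Set.image_congr fun x hx => hx.2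
  rw [this, ← (hT k).measure_preimage_equiv (T k '' _), Set.preimage_image_eq _ (T k).injective]

theorem map_eq_of_comap_eq {μ : Measure X} {h : X → X} (hh : MeasurableEmbedding h)
    (hs : Function.Surjective h) (hc : Measure.comap h μ = μ) : Measure.map h μ = μ := by
  conv_lhs => rw [← hc]
  rw [hh.map_comap, hs.range_eq, Measure.restrict_univ]

end

namespace PadicInt

variable {p : ℕ} [hp : Fact p.Prime]

theorem toZModPow_eq_iff_norm_le {n : ℕ} {x y : ℤ_[p]} :
    toZModPow n x = toZModPow n y ↔ ‖x - y‖ ≤ (p : ℝ) ^ (-n : ℤ) := by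
  rw [norm_le_pow_iff_mem_span_pow, ← ker_toZModPow, RingHom.mem_ker, map_sub, sub_eq_zero]

theorem isLocallyConstant_toZModPow (n : ℕ) :
    IsLocallyConstant (toZModPow n : ℤ_[p] → ZMod (p ^ n)) := by
  rw [IsLocallyConstant.iff_eventually_eq]
  intro x
  have hpos : (0 : ℝ) < (p : ℝ) ^ (-n : ℤ) := zpow_pos (by exact_mod_cast hp.out.pos) _
  filter_upwards [Metric.ball_mem_nhds x hpos] with y hy
  rw [toZModPow_eq_iff_norm_le, ← dist_eq_norm]
  exact (Metric.mem_ball.1 hy).le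

theorem isClopen_toZModPow_preimage (n : ℕ) (S : Set (ZMod (p ^ n))) :
    IsClopen ((toZModPow n : ℤ_[p] → ZMod (p ^ n)) ⁻¹' S) :=
  ⟨⟨isLocallyConstant_toZModPow n Sᶜ⟩, isLocallyConstant_toZModPow n S⟩

theorem exists_toZModPow_preimage_subset {V : Set ℤ_[p]} (hV : IsClopen V) :
    ∃ n : ℕ, ∀ x ∈ V, ∀ y, toZModPow n y = toZModPow n x → y ∈ V := by
  obtain ⟨δ, hδ, hsub⟩ := hV.isClosed.isCompact.exists_thickening_subset_open hV.isOpen subset_rfl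
  obtain ⟨n, hn⟩ := exists_pow_neg_lt p hδ
  refine ⟨n, fun x hx y hxy => hsub ?_⟩
  rw [Metric.mem_thickening_iff]
  rw [toZModPow_eq_iff_norm_le] at hxy
  exact ⟨x, hx, by rw [dist_eq_norm]; exact hxy.trans_lt hn⟩

theorem exists_eq_toZModPow_preimage {V : Set ℤ_[p]} (hV : IsClopen V) :
    ∃ (n : ℕ) (S : Set (ZMod (p ^ n))), V = toZModPow n ⁻¹' S := by
  obtain ⟨n, hn⟩ := exists_toZModPow_preimage_subset hV
  refine ⟨n, toZModPow n '' V, (Set.subset_preimage_image _ _).antisymm ?_⟩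
  rintro y ⟨x, hx, hxy⟩
  exact hn x hx y hxy.symm

theorem perfect_univ : Perfect (Set.univ : Set ℤ_[p]) := by
  have : PerfectSpace ℤ_[p] := by
    rw [perfectSpace_iff_forall_not_isolated]
    intro x
    rw [← mem_closure_iff_nhdsWithin_neBot, Metric.mem_closure_iff]
    intro ε hε
    obtain ⟨n, hn⟩ := exists_pow_neg_lt p hε
    refine ⟨x + (p : ℤ_[p]) ^ n, ?_, ?_⟩
    · simp [hp.out.ne_zero]
    · simpa [dist_eq_norm] using hn
  exact PerfectSpace.univ_perfect _

section Measure

variable [MeasurableSpace ℤ_[p]] [BorelSpace ℤ_[p]]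

theorem measure_toZModPow_fiber {ν : Measure ℤ_[p]}
    (hν : ∀ m : ℤ, Measure.map (· + (m : ℤ_[p])) ν = ν) (n : ℕ) (z : ZMod (p ^ n)) :
    ν (toZModPow n ⁻¹' {z}) = ν (toZModPow n ⁻¹' {0}) := by
  obtain ⟨m, rfl⟩ := ZMod.intCast_surjective z
  have hm := (isClopen_toZModPow_preimage (p := p) n {(m : ZMod (p ^ n))}).isOpen.measurableSet
  conv_lhs => rw [← hν m, Measure.map_apply (measurable_add_const _) hm]
  congr 1
  ext x
  simp

theorem measure_toZModPow_preimage {ν : Measure ℤ_[p]}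
    (hν : ∀ m : ℤ, Measure.map (· + (m : ℤ_[p])) ν = ν) (n : ℕ) (S : Set (ZMod (p ^ n))) :
    ν (toZModPow n ⁻¹' S) = Nat.card S * ν (toZModPow n ⁻¹' {0}) := by
  have : NeZero (p ^ n) := ⟨pow_ne_zero _ hp.out.ne_zero⟩
  classical
  have hfin : S = S.toFinset := by simp
  have hun : (toZModPow n : ℤ_[p] → ZMod (p ^ n)) ⁻¹' S
      = ⋃ z ∈ S.toFinset, toZModPow n ⁻¹' {z} := by
    ext; simp
  rw [hun, measure_biUnion_finset]
  · simp [measure_toZModPow_fiber hν]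
  · intro z _ w _ hzw
    exact Disjoint.preimage _ (by simpa using hzw)
  · exact fun z _ => (isClopen_toZModPow_preimage n {z}).isOpen.measurableSet

theorem pow_mul_measure_toZModPow_preimage {ν : Measure ℤ_[p]}
    (hν : ∀ m : ℤ, Measure.map (· + (m : ℤ_[p])) ν = ν) (n : ℕ) (S : Set (ZMod (p ^ n))) :
    (p : ℝ≥0∞) ^ n * ν (toZModPow n ⁻¹' S) = Nat.card S * ν Set.univ := by
  rw [measure_toZModPow_preimage hν n S, ← Set.preimage_univ (f := toZModPow n),
    measure_toZModPow_preimage hν n Set.univ]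
  simp only [Nat.card_coe_set_eq, Set.ncard_univ, Nat.card_zmod, Nat.cast_pow]
  ring

/-- A Borel probability measure invariant under integer translations is unique. -/
theorem measure_ext_of_invariant {ν μ : Measure ℤ_[p]} [IsProbabilityMeasure ν]
    [IsProbabilityMeasure μ] (hν : ∀ m : ℤ, Measure.map (· + (m : ℤ_[p])) ν = ν)
    (hμ : ∀ m : ℤ, Measure.map (· + (m : ℤ_[p])) μ = μ) : ν = μ := by
  refine ext_of_generate_finite {s | IsClopen s} ?_ (fun s hs t ht _ => hs.inter ht) ?_ (by simp)
  · rw [BorelSpace.measurable_eq (α := ℤ_[p])]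
    exact isTopologicalBasis_isClopen.borel_eq_generateFrom
  · intro V hV
    obtain ⟨n, S, rfl⟩ := exists_eq_toZModPow_preimage hV
    have h := (pow_mul_measure_toZModPow_preimage hν n S).trans
      (by simpa using (pow_mul_measure_toZModPow_preimage hμ n S).symm)
    exact (ENNReal.mul_right_inj (by simp [hp.out.ne_zero]) (by simp)).1 h

theorem exists_pow_mul_measure_eq {V : Set ℤ_[p]} (hV : IsClopen V) :
    ∃ n k : ℕ, ∀ ν : Measure ℤ_[p], (∀ m : ℤ, Measure.map (· + (m : ℤ_[p])) ν = ν) →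
      (p : ℝ≥0∞) ^ n * ν V = k * ν Set.univ := by
  obtain ⟨n, S, rfl⟩ := exists_eq_toZModPow_preimage hV
  exact ⟨n, Nat.card S, fun ν hν => pow_mul_measure_toZModPow_preimage hν n S⟩

theorem pow_mul_measure_toZModPow_fiber {μ : Measure ℤ_[p]} [IsProbabilityMeasure μ]
    (hμ : ∀ m : ℤ, Measure.map (· + (m : ℤ_[p])) μ = μ) (n : ℕ) (z : ZMod (p ^ n)) :
    (p : ℝ≥0∞) ^ n * μ (toZModPow n ⁻¹' {z}) = 1 := by
  simpa using pow_mul_measure_toZModPow_preimage hμ n {z}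

theorem isInvariantMeasure_of_map_add_intCast {μ : Measure ℤ_[p]}
    (hμ : ∀ m : ℤ, Measure.map (· + (m : ℤ_[p])) μ = μ) :
    IsInvariantMeasure (padicTranslationRel p) μ := by
  intro h hh
  refine map_eq_of_comap_eq h.measurableEmbedding h.surjective ?_
  have := comap_eq_comap_of_forall_exists (ρ := μ)
    (fun m : ℤ => MeasurableEquiv.addRight (m : ℤ_[p]))
    (fun m => ⟨(MeasurableEquiv.addRight (m : ℤ_[p])).measurable, hμ m⟩)
    MeasurableEmbedding.id h.measurableEmbedding (fun x => hh x)
  exact this.symm.trans (Measure.comap_id μ)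

theorem clopenValueGroup_eq {μ : Measure ℤ_[p]} [IsProbabilityMeasure μ]
    (hμ : ∀ m : ℤ, Measure.map (· + (m : ℤ_[p])) μ = μ) :
    clopenValueGroup μ = AddSubgroup.closure (Set.range fun n : ℕ => ((p : ℝ) ^ n)⁻¹) := by
  have hp0 : (p : ℝ) ≠ 0 := by exact_mod_cast hp.out.ne_zero
  apply le_antisymm
  · refine (AddSubgroup.closure_le _).2 ?_
    rintro _ ⟨V, hV, rfl⟩
    obtain ⟨n, k, h⟩ := exists_pow_mul_measure_eq hV
    have h' := congrArg ENNReal.toReal (h μ hμ)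
    simp only [measure_univ, mul_one, ENNReal.toReal_mul, ENNReal.toReal_pow,
      ENNReal.toReal_natCast] at h'
    have : (μ V).toReal = k • ((p : ℝ) ^ n)⁻¹ := by
      rw [nsmul_eq_mul, ← h']
      field_simp
    rw [this]
    exact nsmul_mem (AddSubgroup.subset_closure (Set.mem_range_self n)) k
  · refine (AddSubgroup.closure_le _).2 ?_
    rintro _ ⟨n, rfl⟩
    apply AddSubgroup.subset_closure
    refine ⟨toZModPow n ⁻¹' {0}, isClopen_toZModPow_preimage n {0}, ?_⟩
    have h' := congrArg ENNReal.toReal (pow_mul_measure_toZModPow_fiber hμ n 0)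
    simp only [ENNReal.toReal_mul, ENNReal.toReal_pow, ENNReal.toReal_natCast,
      ENNReal.toReal_one] at h'
    exact (eq_inv_of_mul_eq_one_right h').symm

end Measure

theorem map_add_intCast_of_isInvariantMeasure [MeasurableSpace ℤ_[p]] {ν : Measure ℤ_[p]}
    (hν : IsInvariantMeasure (padicTranslationRel p) ν) (m : ℤ) :
    Measure.map (· + (m : ℤ_[p])) ν = ν :=
  hν (Homeomorph.addRight (m : ℤ_[p])) fun _ => ⟨m, rfl⟩

theorem isClopen_slice {n : ℕ} {U : Set (ℤ_[p] × Fin n)} (hU : IsClopen U) (i : Fin n) :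
    IsClopen {x | (x, i) ∈ U} :=
  hU.preimage (f := fun x => (x, i)) (by fun_prop)

section FundGroup

variable [MeasurableSpace ℤ_[p]] [BorelSpace ℤ_[p]] {μ : Measure ℤ_[p]} [IsProbabilityMeasure μ]

theorem exists_pow_mul_prod_count_eq
    (hμ : ∀ m : ℤ, Measure.map (· + (m : ℤ_[p])) μ = μ)
    {n : ℕ} {U : Set (ℤ_[p] × Fin n)} (hU : IsClopen U) :
    ∃ c a : ℕ, (p : ℝ≥0∞) ^ c * (μ.prod Measure.count) U = a := by
  have hun : U = ⋃ i ∈ (Finset.univ : Finset (Fin n)), {x | (x, i) ∈ U} ×ˢ {i} := by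
    ext ⟨x, i⟩
    simp
  rw [hun, measure_biUnion_finset]
  · refine Finset.sum_induction _ (fun v => ∃ c a : ℕ, (p : ℝ≥0∞) ^ c * v = a) ?_
      ⟨0, 0, by simp⟩ ?_
    · rintro v w ⟨c, a, hv⟩ ⟨d, b, hw⟩
      refine ⟨c + d, p ^ d * a + p ^ c * b, ?_⟩
      push_cast
      rw [← hv, ← hw]
      ring
    · intro i _
      obtain ⟨c, a, h⟩ := exists_pow_mul_measure_eq (isClopen_slice hU i)
      exact ⟨c, a, by simpa [Measure.prod_prod] using h μ hμ⟩
  · intro i _ j _ hij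
    exact Set.disjoint_prod.2 (Or.inr (by simpa using hij))
  · exact fun i _ => (isClopen_slice hU i).isOpen.measurableSet.prod (measurableSet_singleton i)

theorem exists_eq_zpow_of_mem_fundGroup
    (hμ : ∀ m : ℤ, Measure.map (· + (m : ℤ_[p])) μ = μ)
    {l : ℝ} (hl : l ∈ fundGroup (padicTranslationRel p) μ) :
    ∃ n : ℤ, l = (p : ℝ) ^ n := by
  obtain ⟨N, U, hU, ⟨F, hF⟩, rfl⟩ := hl
  set ρ := μ.prod (Measure.count : Measure (Fin N)) with hρ
  let f : ℤ_[p] → ℤ_[p] × Fin N := fun x => F x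
  have hf : MeasurableEmbedding f :=
    (MeasurableEmbedding.subtype_coe hU.isOpen.measurableSet).comp F.measurableEmbedding
  have hfc : Continuous f := continuous_subtype_val.comp F.continuous
  have hfr : Set.range f = U := by
    rw [show f = Subtype.val ∘ F from rfl, F.surjective.range_comp, Subtype.range_coe]
  have hinv : ∀ m : ℤ, Measure.map (· + (m : ℤ_[p])) (Measure.comap f ρ) = Measure.comap f ρ := by
    intro m
    have hm : MeasurableEmbedding (· + (m : ℤ_[p])) :=
      (Homeomorph.addRight (m : ℤ_[p])).measurableEmbedding
    refine map_eq_of_comap_eq hm (Homeomorph.addRight (m : ℤ_[p])).surjective ?_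
    rw [Measure.comap_comap (fun s hs => hm.measurableSet_image.2 hs) hf.injective
      (fun s hs => hf.measurableSet_image.2 hs)]
    refine (comap_eq_comap_of_forall_exists (ι := ℤ × Equiv.Perm (Fin N))
      (fun k => (MeasurableEquiv.addRight (k.1 : ℤ_[p])).prodCongr
        ⟨k.2, measurable_of_finite _, measurable_of_finite _⟩) ?_ hf (hf.comp hm) ?_).symm
    · intro k
      refine MeasurePreserving.prod (μa := μ) (μb := μ) ⟨measurable_add_const _, hμ k.1⟩
        ⟨measurable_of_finite _, ?_⟩
      ext s hs
      rw [Measure.map_apply (measurable_of_finite _) hs]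
      rw [← Equiv.image_symm_eq_preimage]
      exact Measure.count_injective_image k.2.symm.injective s
    · intro x
      obtain ⟨k, hk⟩ := (hF x (x + m)).1 ⟨m, rfl⟩
      exact ⟨(k, Equiv.swap (f x).2 (f (x + m)).2),
        Prod.ext hk (Equiv.swap_apply_left (f x).2 (f (x + m)).2).symm⟩
  obtain ⟨m, hm⟩ := exists_toZModPow_preimage_subset (isClopen_slice hU (f 0).2)
  set W : Set (ℤ_[p] × Fin N) := (toZModPow m ⁻¹' {toZModPow m (f 0).1}) ×ˢ {(f 0).2} with hW
  have hWU : W ⊆ U := by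
    rintro ⟨x, i⟩ ⟨hx, rfl⟩
    exact hm (f 0).1 (F 0).2 x hx
  have hWc : IsClopen W := (isClopen_toZModPow_preimage m _).prod (isClopen_discrete _)
  obtain ⟨n, k, hk⟩ := exists_pow_mul_measure_eq (hWc.preimage hfc)
  have hk := hk _ hinv
  rw [hf.comap_apply, hf.comap_apply, Set.image_univ, hfr, Set.image_preimage_eq_of_subset
    (hWU.trans hfr.ge)] at hk
  have hρW : (p : ℝ≥0∞) ^ m * ρ W = 1 := by
    rw [hρ, hW, Measure.prod_prod, Measure.count_singleton, mul_one]
    exact pow_mul_measure_toZModPow_fiber hμ m _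
  obtain ⟨c, a, ha⟩ := exists_pow_mul_prod_count_eq hμ hU
  have key : (p : ℝ≥0∞) ^ (n + c) = p ^ m * k * a := by
    calc (p : ℝ≥0∞) ^ (n + c) = p ^ c * (p ^ n * (p ^ m * ρ W)) := by rw [hρW]; ring
      _ = p ^ c * (p ^ m * (p ^ n * ρ W)) := by ring
      _ = p ^ m * k * (p ^ c * ρ U) := by rw [hk]; ring
      _ = p ^ m * k * a := by rw [ha]
  have key' : p ^ (n + c) = p ^ m * k * a := by exact_mod_cast key
  obtain ⟨j, -, rfl⟩ := (Nat.dvd_prime_pow hp.out).1 (Dvd.intro_left _ key'.symm)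
  refine ⟨(j : ℤ) - c, ?_⟩
  have hp0 : (p : ℝ) ≠ 0 := by exact_mod_cast hp.out.ne_zero
  have ha' := congrArg ENNReal.toReal ha
  simp only [ENNReal.toReal_mul, ENNReal.toReal_pow, ENNReal.toReal_natCast, Nat.cast_pow] at ha'
  rw [zpow_sub₀ hp0, zpow_natCast, zpow_natCast, ← ha', mul_div_cancel_left₀ _ (pow_ne_zero c hp0)]

end FundGroup

theorem pow_mul_eq_intCast_iff (m : ℕ) (z : ℤ_[p]) :
    (∃ k : ℤ, (p : ℤ_[p]) ^ m * z = k) ↔ ∃ k : ℤ, z = k := by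
  have hp0 : (p : ℤ_[p]) ^ m ≠ 0 := pow_ne_zero _ (by exact_mod_cast hp.out.ne_zero)
  constructor
  · rintro ⟨k, hk⟩
    have h0 : toZModPow m (k : ℤ_[p]) = 0 := by
      rw [← RingHom.mem_ker, ker_toZModPow, Ideal.mem_span_singleton]
      exact ⟨z, hk.symm⟩
    rw [map_intCast, ZMod.intCast_zmod_eq_zero_iff_dvd] at h0
    obtain ⟨j, rfl⟩ := h0
    refine ⟨j, mul_left_cancel₀ hp0 ?_⟩
    rw [hk]
    push_cast
    rfl
  · rintro ⟨k, rfl⟩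
    exact ⟨p ^ m * k, by push_cast; rfl⟩

theorem mem_padicTranslationRel_iff {x y : ℤ_[p]} :
    (x, y) ∈ padicTranslationRel p ↔ ∃ k : ℤ, y - x = k := by
  simp only [padicTranslationRel, Set.mem_ofPred_eq, sub_eq_iff_eq_add']

theorem bijective_natCast_add_pow_mul (m : ℕ) :
    Function.Bijective fun u : ℤ_[p] × Fin (p ^ m) =>
      ((u.2 : ℕ) : ℤ_[p]) + (p : ℤ_[p]) ^ m * u.1 := by
  have hp0 : (p : ℤ_[p]) ^ m ≠ 0 := pow_ne_zero _ (by exact_mod_cast hp.out.ne_zero)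
  have hz : ∀ z : ℤ_[p], toZModPow m ((p : ℤ_[p]) ^ m * z) = 0 := fun z => by
    rw [← RingHom.mem_ker, ker_toZModPow, Ideal.mem_span_singleton]
    exact ⟨z, rfl⟩
  have : NeZero (p ^ m) := ⟨pow_ne_zero _ hp.out.ne_zero⟩
  constructor
  · rintro ⟨y, r⟩ ⟨y', r'⟩ h
    have h1 := congrArg (toZModPow m) h
    simp only [map_add, hz, map_natCast, add_zero, ZMod.natCast_eq_natCast_iff'] at h1
    rw [Nat.mod_eq_of_lt r.2, Nat.mod_eq_of_lt r'.2] at h1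
    obtain rfl : r = r' := Fin.ext h1
    exact Prod.ext (mul_left_cancel₀ hp0 (add_left_cancel h)) rfl
  · intro x
    have hx : x - ((toZModPow m x).val : ℕ) ∈ RingHom.ker (toZModPow (p := p) m) := by
      rw [RingHom.mem_ker]
      simp
    rw [ker_toZModPow, Ideal.mem_span_singleton] at hx
    obtain ⟨y, hy⟩ := hx
    exact ⟨(y, ⟨(toZModPow m x).val, ZMod.val_lt _⟩), by simp [← hy]⟩

theorem pow_mem_fundGroup [MeasurableSpace ℤ_[p]] [BorelSpace ℤ_[p]] {μ : Measure ℤ_[p]}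
    [IsProbabilityMeasure μ] (m : ℕ) : (p : ℝ) ^ m ∈ fundGroup (padicTranslationRel p) μ := by
  let e := Equiv.ofBijective _ (bijective_natCast_add_pow_mul (p := p) m)
  have he : Continuous e := by
    change Continuous fun u : ℤ_[p] × Fin (p ^ m) =>
      ((u.2 : ℕ) : ℤ_[p]) + (p : ℤ_[p]) ^ m * u.1
    have : Continuous fun i : Fin (p ^ m) => ((i : ℕ) : ℤ_[p]) := continuous_of_discreteTopology
    fun_prop
  refine ⟨p ^ m, Set.univ, isClopen_univ,
    ⟨he.homeoOfEquivCompactToT2.symm.trans (Homeomorph.Set.univ _).symm, fun x y => ?_⟩, ?_⟩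
  · obtain ⟨⟨x, i⟩, rfl⟩ := e.surjective x
    obtain ⟨⟨y, j⟩, rfl⟩ := e.surjective y
    have : ((e (x, i), e (y, j)) ∈ padicTranslationRel p ↔ (x, y) ∈ padicTranslationRel p) := by
      rw [mem_padicTranslationRel_iff, mem_padicTranslationRel_iff,
        ← pow_mul_eq_intCast_iff m (y - x)]
      change (∃ k : ℤ, ((j : ℕ) + (p : ℤ_[p]) ^ m * y) - ((i : ℕ) + (p : ℤ_[p]) ^ m * x) = k) ↔ _
      constructor
      · rintro ⟨k, hk⟩
        refine ⟨k - (j : ℕ) + (i : ℕ), ?_⟩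
        push_cast
        rw [← hk]
        ring
      · rintro ⟨k, hk⟩
        refine ⟨k + (j : ℕ) - (i : ℕ), ?_⟩
        push_cast
        rw [← hk]
        ring
    rw [this]
    change _ ↔ ((e.symm (e (x, i))).1, (e.symm (e (y, j))).1) ∈ padicTranslationRel p
    simp
  · rw [← Set.univ_prod_univ, Measure.prod_prod]
    simp [Measure.count_univ]

theorem bijective_pow_mul (m : ℕ) :
    Function.Bijective fun x : ℤ_[p] =>
      (⟨((p : ℤ_[p]) ^ m * x, 0), by
        rw [Set.mem_prod, Set.mem_preimage, Set.mem_singleton_iff, ← RingHom.mem_ker,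
          ker_toZModPow, Ideal.mem_span_singleton]
        exact ⟨⟨x, rfl⟩, trivial⟩⟩ :
        ((toZModPow m ⁻¹' {0}) ×ˢ Set.univ : Set (ℤ_[p] × Fin 1))) := by
  have hp0 : (p : ℤ_[p]) ^ m ≠ 0 := pow_ne_zero _ (by exact_mod_cast hp.out.ne_zero)
  constructor
  · intro x y h
    exact mul_left_cancel₀ hp0 (congrArg (fun u => u.1.1) h)
  · rintro ⟨⟨x, i⟩, hx, -⟩
    rw [Set.mem_preimage, Set.mem_singleton_iff, ← RingHom.mem_ker,
      ker_toZModPow, Ideal.mem_span_singleton] at hx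
    obtain ⟨y, hy⟩ := hx
    exact ⟨y, Subtype.ext (Prod.ext hy.symm (Subsingleton.elim _ _))⟩

theorem inv_pow_mem_fundGroup [MeasurableSpace ℤ_[p]] [BorelSpace ℤ_[p]] {μ : Measure ℤ_[p]}
    [IsProbabilityMeasure μ] (hμ : ∀ m : ℤ, Measure.map (· + (m : ℤ_[p])) μ = μ) (m : ℕ) :
    ((p : ℝ) ^ m)⁻¹ ∈ fundGroup (padicTranslationRel p) μ := by
  let e := Equiv.ofBijective _ (bijective_pow_mul (p := p) m)
  have he : Continuous e := by
    refine Continuous.subtype_mk ?_ _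
    fun_prop
  refine ⟨1, (toZModPow m ⁻¹' {0}) ×ˢ Set.univ,
    (isClopen_toZModPow_preimage m {0}).prod isClopen_univ,
    ⟨he.homeoOfEquivCompactToT2, fun x y => ?_⟩, ?_⟩
  · change _ ↔ ((p : ℤ_[p]) ^ m * x, (p : ℤ_[p]) ^ m * y) ∈ padicTranslationRel p
    rw [mem_padicTranslationRel_iff, mem_padicTranslationRel_iff, ← pow_mul_eq_intCast_iff m,
      mul_sub]
  · have h' := congrArg ENNReal.toReal (pow_mul_measure_toZModPow_fiber hμ m 0)
    simp only [ENNReal.toReal_mul, ENNReal.toReal_pow, ENNReal.toReal_natCast,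
      ENNReal.toReal_one] at h'
    rw [Measure.prod_prod]
    simpa [Measure.count_univ] using (eq_inv_of_mul_eq_one_right h').symm

theorem isMinimalRel_padicTranslationRel : IsMinimalRel (padicTranslationRel p) := by
  intro x
  have h := (Homeomorph.addLeft x).surjective.denseRange.comp (denseRange_intCast (p := p))
    (Homeomorph.addLeft x).continuous
  refine Dense.mono ?_ h
  rintro _ ⟨n, rfl⟩
  exact ⟨n, rfl⟩

end PadicInt

/-- The translation action of `ℤ` on `ℤ_p` is a uniquely ergodic Cantor
minimal `ℤ`-system; its unique invariant probability measure is the normalized Haar measure,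
`E_μ = ℤ[1/p]`, and `F(R) = {p^n : n ∈ ℤ}`. -/
theorem statement16 (p : ℕ) [Fact p.Prime] [MeasurableSpace ℤ_[p]] [BorelSpace ℤ_[p]] :
    (∀ n : ℤ, n ≠ 0 → ∀ x : ℤ_[p], x + (n : ℤ_[p]) ≠ x) ∧
    (CompactSpace ℤ_[p] ∧ TopologicalSpace.MetrizableSpace ℤ_[p] ∧
      TotallyDisconnectedSpace ℤ_[p] ∧ Nonempty ℤ_[p] ∧ Perfect (Set.univ : Set ℤ_[p])) ∧
    IsMinimalRel (padicTranslationRel p) ∧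
    ∃ μ : Measure ℤ_[p], IsProbabilityMeasure μ ∧
      IsInvariantMeasure (padicTranslationRel p) μ ∧
      (∀ ν : Measure ℤ_[p], IsProbabilityMeasure ν →
        IsInvariantMeasure (padicTranslationRel p) ν → ν = μ) ∧
      (∀ a : ℤ_[p], Measure.map (fun x => a + x) μ = μ) ∧
      clopenValueGroup μ = AddSubgroup.closure (Set.range fun n : ℕ => ((p : ℝ) ^ n)⁻¹) ∧
      fundGroup (padicTranslationRel p) μ = {x : ℝ | ∃ n : ℤ, x = (p : ℝ) ^ n} := by
  have hfree : ∀ n : ℤ, n ≠ 0 → ∀ x : ℤ_[p], x + (n : ℤ_[p]) ≠ x := by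
    intro n hn x
    simpa using hn
  let μ : Measure ℤ_[p] := Measure.addHaarMeasure ⊤
  have hprob : IsProbabilityMeasure μ :=
    ⟨by simpa using Measure.addHaarMeasure_self (K₀ := (⊤ : TopologicalSpace.PositiveCompacts ℤ_[p]))⟩
  have hμ : ∀ m : ℤ, Measure.map (· + (m : ℤ_[p])) μ = μ := fun m => map_add_right_eq_self μ _
  refine ⟨hfree, ⟨inferInstance, inferInstance, inferInstance, inferInstance,
    PadicInt.perfect_univ⟩, PadicInt.isMinimalRel_padicTranslationRel, μ, hprob,
    PadicInt.isInvariantMeasure_of_map_add_intCast hμ, ?_, fun a => map_add_left_eq_self μ a,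
    PadicInt.clopenValueGroup_eq hμ, Set.Subset.antisymm
      (fun l hl => PadicInt.exists_eq_zpow_of_mem_fundGroup hμ hl) ?_⟩
  · intro ν _ hν
    exact PadicInt.measure_ext_of_invariant
      (PadicInt.map_add_intCast_of_isInvariantMeasure hν) hμ
  · rintro _ ⟨n, rfl⟩
    obtain ⟨m, rfl | rfl⟩ := n.eq_nat_or_neg
    · rw [zpow_natCast]
      exact PadicInt.pow_mem_fundGroup m
    · rw [zpow_neg, zpow_natCast]
      exact PadicInt.inv_pow_mem_fundGroup hμ m
end

section
/- Let p be a prime, let R denote the orbit equivalence relation of the free ℤ-action n·x = x + n on ℤ_p, and let U = pℤ_p, a clopen subset of ℤ_p. Then the map h(x) = px is a homeomorphism of ℤ_p onto U satisfying: (x, y) ∈ R if and only if (h(x), h(y)) ∈ R|_U. Hence R|_U is orbit equivalent to R, and the normalized Haar measure μ on ℤ_p satisfies μ(U) = 1/p. -/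
open MeasureTheory
open scoped ENNReal

namespace PadicInt

variable (p : ℕ) [Fact p.Prime]

theorem mul_left_prime_injective : Function.Injective fun x : ℤ_[p] => (p : ℤ_[p]) * x :=
  mul_right_injective₀ prime_p.ne_zero

theorem range_mul_prime_eq_ball :
    (Set.range fun x : ℤ_[p] => (p : ℤ_[p]) * x) = Metric.ball 0 1 := by
  ext x
  rw [mem_ball_zero_iff, norm_lt_one_iff_dvd]
  exact ⟨fun ⟨y, hy⟩ => ⟨y, hy.symm⟩, fun ⟨y, hy⟩ => ⟨y, hy.symm⟩⟩

theorem isClopen_range_mul_prime :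
    IsClopen (Set.range fun x : ℤ_[p] => (p : ℤ_[p]) * x) := by
  rw [range_mul_prime_eq_ball]
  exact IsUltrametricDist.isClopen_ball 0 1

/-- Multiplication by `p`, as a homeomorphism of `ℤ_[p]` onto its image. -/
noncomputable def mulPrimeHomeomorph :
    ℤ_[p] ≃ₜ ↥(Set.range fun x : ℤ_[p] => (p : ℤ_[p]) * x) :=
  Continuous.homeoOfEquivCompactToT2 (f := Equiv.ofInjective _ (mul_left_prime_injective p))
    (Continuous.subtype_mk (continuous_const.mul continuous_id) _)

theorem mul_prime_mem_padicTranslationRel_iff (x y : ℤ_[p]) :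
    ((p : ℤ_[p]) * x, (p : ℤ_[p]) * y) ∈ padicTranslationRel p ↔
      (x, y) ∈ padicTranslationRel p := by
  constructor
  · rintro ⟨n, hn : (p : ℤ_[p]) * y = p * x + n⟩
    obtain ⟨m, rfl⟩ : (p : ℤ) ∣ n := by
      rw [← norm_int_lt_one_iff_dvd, norm_lt_one_iff_dvd]
      exact ⟨y - x, by linear_combination -hn⟩
    refine ⟨m, mul_left_prime_injective p ?_⟩
    push_cast at hn
    linear_combination hn
  · rintro ⟨n, hn : y = x + n⟩
    refine ⟨p * n, ?_⟩
    push_cast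
    linear_combination (p : ℤ_[p]) * hn

theorem ker_toZMod_toAddMonoidHom_coe :
    ((toZMod (p := p)).toAddMonoidHom.ker : Set ℤ_[p]) =
      Set.range fun x : ℤ_[p] => (p : ℤ_[p]) * x := by
  ext x
  have h : toZMod x = 0 ↔ (p : ℤ_[p]) ∣ x := by
    rw [← RingHom.mem_ker, ker_toZMod, maximalIdeal_eq_span_p, Ideal.mem_span_singleton]
  exact h.trans ⟨fun ⟨y, hy⟩ => ⟨y, hy.symm⟩, fun ⟨y, hy⟩ => ⟨y, hy.symm⟩⟩

theorem index_ker_toZMod : (toZMod (p := p)).toAddMonoidHom.ker.index = p := by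
  rw [AddSubgroup.index_ker, AddMonoidHom.range_eq_top.mpr (ZMod.ringHom_surjective toZMod)]
  simp

theorem measure_range_mul_prime [MeasurableSpace ℤ_[p]] [BorelSpace ℤ_[p]]
    (μ : Measure ℤ_[p]) [IsProbabilityMeasure μ] [μ.IsAddLeftInvariant] :
    μ (Set.range fun x : ℤ_[p] => (p : ℤ_[p]) * x) = (p : ℝ≥0∞)⁻¹ := by
  have hp : p ≠ 0 := (Fact.out : p.Prime).ne_zero
  have : (toZMod (p := p)).toAddMonoidHom.ker.FiniteIndex :=
    ⟨by rwa [index_ker_toZMod]⟩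
  have h := (toZMod (p := p)).toAddMonoidHom.ker.index_mul_measure
    (by rw [ker_toZMod_toAddMonoidHom_coe]; exact (isClopen_range_mul_prime p).isOpen.measurableSet) μ
  rw [ker_toZMod_toAddMonoidHom_coe, index_ker_toZMod, measure_univ, mul_comm] at h
  exact ENNReal.eq_inv_of_mul_eq_one_left h

end PadicInt

/-- For the translation relation `R` on `ℤ_p` and `U = pℤ_p`, the map
`h(x) = px` is a homeomorphism of `ℤ_p` onto `U` with `(x,y) ∈ R ↔ (h x, h y) ∈ R|_U`; hence
`R|_U` is orbit equivalent to `R`, and the normalized Haar measure gives `μ(U) = 1/p`. -/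
theorem statement17 (p : ℕ) [Fact p.Prime] [MeasurableSpace ℤ_[p]] [BorelSpace ℤ_[p]] :
    IsClopen (Set.range fun x : ℤ_[p] => (p : ℤ_[p]) * x) ∧
    (∃ h : ℤ_[p] ≃ₜ ↥(Set.range fun x : ℤ_[p] => (p : ℤ_[p]) * x),
      (∀ x : ℤ_[p], (h x : ℤ_[p]) = (p : ℤ_[p]) * x) ∧
      ∀ x y : ℤ_[p], ((x, y) ∈ padicTranslationRel p ↔ (h x, h y) ∈
        restrictRel (padicTranslationRel p) (Set.range fun x : ℤ_[p] => (p : ℤ_[p]) * x))) ∧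
    OrbitEquiv (padicTranslationRel p)
      (restrictRel (padicTranslationRel p) (Set.range fun x : ℤ_[p] => (p : ℤ_[p]) * x)) ∧
    ∀ μ : Measure ℤ_[p], IsProbabilityMeasure μ →
      (∀ a : ℤ_[p], Measure.map (fun x => a + x) μ = μ) →
      μ (Set.range fun x : ℤ_[p] => (p : ℤ_[p]) * x) = (p : ℝ≥0∞)⁻¹ := by
  have h : ∀ x y : ℤ_[p], (x, y) ∈ padicTranslationRel p ↔
      (PadicInt.mulPrimeHomeomorph p x, PadicInt.mulPrimeHomeomorph p y) ∈
        restrictRel (padicTranslationRel p) (Set.range fun x : ℤ_[p] => (p : ℤ_[p]) * x) :=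
    fun x y => (PadicInt.mul_prime_mem_padicTranslationRel_iff p x y).symm
  refine ⟨PadicInt.isClopen_range_mul_prime p, ⟨_, fun _ => rfl, h⟩, ⟨_, h⟩, fun μ _ hμ => ?_⟩
  have : μ.IsAddLeftInvariant := ⟨hμ⟩
  exact PadicInt.measure_range_mul_prime p μ
end
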